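/- Let η ∈ {1,2} and let q, r, s be primes with q ≡ 3 (mod 4), r ≡ s ≡ 5 (mod 8), Legendre symbols (q/r) = (q/s) = (−1)^{δ_{η,2}} and (r/s) = 1, suppose the negative Pell equation x² − rs·y² = −1 has no integer solutions, assume the non-square condition, and assume h₂(ηqrs) = 8. Then for every integer n ≥ 0, the 2-Sylow subgroup of the ideal class group of the n-th layer F_n of the cyclotomic ℤ₂-extension of F = ℚ(√(ηqrs)) is isomorphic to ℤ/2ℤ × ℤ/4ℤ; in particular A(F) ≅ ℤ/2ℤ × ℤ/4ℤ. -/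

import Mathlib

open IntermediateField NumberField

/-- The `n`-th layer `k(2·cos(2π/2^(n+2)))` of the cyclotomic `ℤ₂`-extension of a
(totally real) subfield of `ℝ`. -/
noncomputable def layer (F : IntermediateField ℚ ℝ) (n : ℕ) : IntermediateField ℚ ℝ :=
  F ⊔ IntermediateField.adjoin ℚ {2 * Real.cos (2 * Real.pi / 2 ^ (n + 2))}

/-- The 2-part of the class number of a subfield of `ℝ` (the largest power of 2 dividing
the cardinality of the class group of its ring of integers). -/
noncomputable def h2 (F : IntermediateField ℚ ℝ) : ℕ :=
  2 ^ ((Nat.card (ClassGroup (NumberField.RingOfIntegers F))).factorization 2)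

namespace S4

/-! ### Group theory -/

/-- The 2-primary part of a commutative group. -/
def A2 (G : Type*) [CommGroup G] : Subgroup G where
  carrier := {x | ∃ k : ℕ, x ^ (2 ^ k) = 1}
  one_mem' := ⟨0, by simp⟩
  mul_mem' := by
    rintro a b ⟨k, hk⟩ ⟨l, hl⟩
    refine ⟨k + l, ?_⟩
    rw [mul_pow, pow_add, pow_mul, hk, one_pow, mul_comm (2 ^ k), pow_mul, hl, one_pow, one_mul]
  inv_mem' := by
    rintro a ⟨k, hk⟩
    exact ⟨k, by rw [inv_pow, hk, inv_one]⟩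

theorem mem_A2 {G : Type*} [CommGroup G] {x : G} : x ∈ A2 G ↔ ∃ k : ℕ, x ^ (2 ^ k) = 1 := Iff.rfl

theorem map_mem_A2 {G H : Type*} [CommGroup G] [CommGroup H] (f : G →* H) {x : G}
    (hx : x ∈ A2 G) : f x ∈ A2 H := by
  obtain ⟨k, hk⟩ := hx
  exact ⟨k, by rw [← map_pow, hk, map_one]⟩

theorem isPGroup_A2 (G : Type*) [CommGroup G] : IsPGroup 2 (A2 G) := by
  rintro ⟨x, k, hk⟩
  exact ⟨k, Subtype.ext (by simpa using hk)⟩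

theorem le_A2 {G : Type*} [CommGroup G] {H : Subgroup G} (h : IsPGroup 2 H) : H ≤ A2 G := by
  intro x hx
  obtain ⟨k, hk⟩ := h ⟨x, hx⟩
  exact ⟨k, by simpa using congrArg Subtype.val hk⟩

theorem sylow_eq_A2 {G : Type*} [CommGroup G] (P : Sylow 2 G) : (P : Subgroup G) = A2 G :=
  (P.is_maximal' (isPGroup_A2 G) (le_A2 P.isPGroup')).symm

theorem card_A2 (G : Type*) [CommGroup G] [Finite G] :
    Nat.card (A2 G) = 2 ^ (Nat.card G).factorization 2 := by
  haveI : Fact (Nat.Prime 2) := ⟨Nat.prime_two⟩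
  have P : Sylow 2 G := default
  rw [← sylow_eq_A2 P]
  exact P.card_eq_multiplicity

/-- The exponent `m` is odd and projects to the 2-part. -/
theorem exists_odd_pow (G : Type*) [CommGroup G] [Finite G] :
    ∃ m : ℕ, Odd m ∧ ∀ x : G, x ^ m ∈ A2 G := by
  refine ⟨Nat.card G / 2 ^ (Nat.card G).factorization 2, ?_, ?_⟩
  · rw [← Nat.not_even_iff_odd, even_iff_two_dvd]
    exact Nat.not_dvd_ordCompl Nat.prime_two Nat.card_pos.ne'
  · intro x
    refine ⟨(Nat.card G).factorization 2, ?_⟩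
    rw [← pow_mul, Nat.div_mul_cancel (Nat.ordProj_dvd _ _), pow_card_eq_one']

/-- A subgroup of the 2-part whose order divides `n * 2^j` has order dividing the 2-part. -/
theorem card_dvd_of_le_A2 {G : Type*} [CommGroup G] [Finite G] {H : Subgroup G} (h : H ≤ A2 G)
    {n : ℕ} (hn : n ≠ 0) (hd : Nat.card H ∣ n) : Nat.card H ∣ 2 ^ n.factorization 2 := by
  haveI : Fact (Nat.Prime 2) := ⟨Nat.prime_two⟩
  have hp : IsPGroup 2 H := (isPGroup_A2 G).of_injective (Subgroup.inclusion h)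
    (Subgroup.inclusion_injective h)
  obtain ⟨k, hk⟩ := IsPGroup.iff_card.1 hp
  rw [hk] at hd ⊢
  exact pow_dvd_pow _ ((Nat.prime_two.pow_dvd_iff_le_factorization hn).1 hd)

theorem odd_A2 {G : Type*} [CommGroup G] {x : G} (hx : x ∈ A2 G) {m : ℕ} (hm : Odd m)
    (h : x ^ m = 1) : x = 1 := by
  obtain ⟨k, hk⟩ := hx
  have h1 := orderOf_dvd_of_pow_eq_one h
  have h2 := orderOf_dvd_of_pow_eq_one hk
  have hc : Nat.Coprime m (2 ^ k) := (Nat.coprime_two_right.2 hm).pow_right k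
  have := Nat.eq_one_of_dvd_coprimes hc h1 h2
  exact orderOf_eq_one_iff.1 this

/-- Order 8 with four elements of exponent two. -/
theorem equiv_of_card_eight {A : Type*} [CommGroup A] (h8 : Nat.card A = 8)
    (h4 : Nat.card {x : A // x ^ 2 = 1} = 4) :
    Nonempty (A ≃* Multiplicative (ZMod 2 × ZMod 4)) := by
  haveI : Finite A := Nat.finite_of_card_ne_zero (by rw [h8]; norm_num)
  -- an element of order 4
  have hall8 : ∀ x : A, x ^ 8 = 1 := fun x => by rw [← h8]; exact pow_card_eq_one'
  obtain ⟨g, hg⟩ : ∃ g : A, g ^ 2 ≠ 1 := by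
    by_contra! hc
    have : Nat.card {x : A // x ^ 2 = 1} = Nat.card A :=
      Nat.card_congr (Equiv.subtypeUnivEquiv hc)
    omega
  have hg4 : g ^ 4 = 1 := by
    by_contra hne
    have ho : orderOf g = 2 ^ (2 + 1) :=
      orderOf_eq_prime_pow (by norm_num; exact hne) (by norm_num; exact hall8 g)
    have hz : Subgroup.zpowers g = ⊤ := by
      apply Subgroup.eq_top_of_card_eq
      rw [Nat.card_zpowers, ho, h8]; norm_num
    haveI : IsCyclic A := ⟨g, fun x => Subgroup.mem_zpowers_iff.1 (by rw [hz]; trivial)⟩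
    haveI : Fintype A := Fintype.ofFinite A
    classical
    have := IsCyclic.card_pow_eq_one_le (α := A) (n := 2) (by norm_num)
    rw [Nat.card_eq_fintype_card, Fintype.card_subtype] at h4
    omega
  have hog : orderOf g = 2 ^ (1 + 1) :=
    orderOf_eq_prime_pow (by norm_num; exact hg) (by norm_num; exact hg4)
  obtain ⟨h, hh2, hhn⟩ : ∃ h : A, h ^ 2 = 1 ∧ h ≠ 1 ∧ h ≠ g ^ 2 := by
    classical
    by_contra! hc
    have hle : Nat.card {x : A // x ^ 2 = 1} ≤ Nat.card (({1, g ^ 2} : Finset A)) := by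
      refine Nat.card_le_card_of_injective
        (fun x : {x : A // x ^ 2 = 1} => (⟨x.1, ?_⟩ : (({1, g ^ 2} : Finset A)))) ?_
      · by_cases hx : x.1 = 1
        · simp [hx]
        · simp [hc x.1 x.2 hx]
      · intro x y hxy
        simpa [Subtype.ext_iff] using hxy
    rw [Nat.card_eq_fintype_card (α := (({1, g ^ 2} : Finset A))), Fintype.card_coe] at hle
    have := Finset.card_le_two (a := (1 : A)) (b := g ^ 2)
    omega
  have hhg : ∀ i : ℕ, i < 4 → h ≠ g ^ i := by
    intro i hi he
    interval_cases i
    · exact hhn.1 (by simpa using he)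
    · rw [pow_one] at he; exact hg (he ▸ hh2)
    · exact hhn.2 he
    · have : g ^ 6 = 1 := by rw [show 6 = 3 * 2 from rfl, pow_mul, ← he, hh2]
      apply hg
      calc g ^ 2 = g ^ 2 * g ^ 4 := by rw [hg4, mul_one]
        _ = g ^ 6 := by rw [← pow_add]
        _ = 1 := this
  let f1 : Multiplicative (ZMod 2) →* A :=
    AddMonoidHom.toMultiplicativeLeft (ZMod.lift 2 ⟨(zmultiplesHom (Additive A)) (Additive.ofMul h), by
      have := congrArg Additive.ofMul hh2
      rw [ofMul_pow, ofMul_one] at this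
      simp only [zmultiplesHom_apply]
      rw [natCast_zsmul]; exact this⟩)
  let f2 : Multiplicative (ZMod 4) →* A :=
    AddMonoidHom.toMultiplicativeLeft (ZMod.lift 4 ⟨(zmultiplesHom (Additive A)) (Additive.ofMul g), by
      have := congrArg Additive.ofMul hg4
      rw [ofMul_pow, ofMul_one] at this
      simp only [zmultiplesHom_apply]
      rw [natCast_zsmul]; exact this⟩)
  have f1v : ∀ i : ℕ, f1 (Multiplicative.ofAdd (i : ZMod 2)) = h ^ i := by
    intro i
    have : ((i : ℕ) : ZMod 2) = ((i : ℤ) : ZMod 2) := by simp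
    simp [f1, this, ZMod.lift_coe, -Int.cast_natCast]
  have f2v : ∀ i : ℕ, f2 (Multiplicative.ofAdd (i : ZMod 4)) = g ^ i := by
    intro i
    have : ((i : ℕ) : ZMod 4) = ((i : ℤ) : ZMod 4) := by simp
    simp [f2, this, ZMod.lift_coe, -Int.cast_natCast]
  let f : Multiplicative (ZMod 2 × ZMod 4) →* A :=
    { toFun := fun x => f1 (Multiplicative.ofAdd x.toAdd.1) * f2 (Multiplicative.ofAdd x.toAdd.2)
      map_one' := by simp
      map_mul' := by
        intro x y
        simp only [toAdd_mul, Prod.fst_add, Prod.snd_add, ofAdd_add, map_mul]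
        exact mul_mul_mul_comm _ _ _ _ }
  have finj : Function.Injective f := by
    rw [injective_iff_map_eq_one]
    intro x hx
    obtain ⟨a, b⟩ := x
    have ha : a = ((a.val : ℕ) : ZMod 2) := (ZMod.natCast_zmod_val a).symm
    have hb : b = ((b.val : ℕ) : ZMod 4) := (ZMod.natCast_zmod_val b).symm
    have hx' : h ^ a.val * g ^ b.val = 1 := by
      rw [← f1v, ← f2v, ← ha, ← hb]; exact hx
    have hav := ZMod.val_lt a
    have hbv := ZMod.val_lt b
    have key : ∀ i < 2, ∀ j < 4, h ^ i * g ^ j = 1 → i = 0 ∧ j = 0 := by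
      intro i hi j hj hij
      have hi0 : i = 0 := by
        by_contra hi0
        have : i = 1 := by omega
        subst this
        rw [pow_one] at hij
        have e1 : h = g ^ (4 - j) := by
          rw [eq_inv_of_mul_eq_one_left hij, inv_eq_of_mul_eq_one_right]
          rw [← pow_add, show j + (4 - j) = 4 by omega, hg4]
        rcases Nat.eq_zero_or_pos j with hj0 | hj0
        · subst hj0
          exact hhn.1 (by simpa using hij)
        · exact hhg (4 - j) (by omega) e1
      subst hi0
      rw [pow_zero, one_mul] at hij
      have := orderOf_dvd_of_pow_eq_one hij
      rw [hog] at this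
      refine ⟨rfl, Nat.eq_zero_of_dvd_of_lt this (by omega)⟩
    obtain ⟨k1, k2⟩ := key _ hav _ hbv hx'
    rw [k1] at ha; rw [k2] at hb
    change Multiplicative.ofAdd (a, b) = 1
    rw [ha, hb]; rfl
  have fbij : Function.Bijective f := by
    rw [Nat.bijective_iff_injective_and_card]
    refine ⟨finj, ?_⟩
    rw [h8, Nat.card_congr Multiplicative.toAdd, Nat.card_prod, Nat.card_zmod, Nat.card_zmod]
  exact ⟨(MulEquiv.ofBijective f fbij).symm⟩

/-- Frattini argument. -/
theorem frattini {A : Type*} [CommGroup A] {k : ℕ} (hA : ∀ x : A, x ^ (2 ^ k) = 1)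
    (H : Subgroup A) (hH : ∀ x : A, ∃ h ∈ H, ∃ y : A, x = h * y ^ 2) : H = ⊤ := by
  have key : ∀ j : ℕ, ∀ x : A, ∃ h ∈ H, ∃ y : A, x = h * y ^ (2 ^ j) := by
    intro j
    induction j with
    | zero => intro x; exact ⟨1, H.one_mem, x, by simp⟩
    | succ j ih =>
      intro x
      obtain ⟨h, hh, y, rfl⟩ := ih x
      obtain ⟨h', hh', z, rfl⟩ := hH y
      refine ⟨h * h' ^ (2 ^ j), H.mul_mem hh (H.pow_mem hh' _), z, ?_⟩
      rw [mul_pow, ← pow_mul, pow_succ' 2 j, mul_assoc]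
  rw [eq_top_iff]
  intro x _
  obtain ⟨h, hh, y, rfl⟩ := key k x
  rw [hA, mul_one]; exact hh

/-- Nakayama argument: if `τ⁴ = 1` and `(τ-1)A ⊆ (τ²-1)A` then `τ = 1` on a finite 2-group. -/
theorem nakayama {A : Type*} [CommGroup A] {k : ℕ} (hA : ∀ x : A, x ^ (2 ^ k) = 1)
    (τ : A →* A) (h4 : ∀ x, τ (τ (τ (τ x))) = x)
    (hsub : ∀ x, ∃ y, τ x * x⁻¹ = τ (τ y) * y⁻¹) : ∀ x, τ x = x := by
  have step : ∀ x, ∃ y, τ x * x⁻¹ = τ (τ y * y⁻¹) * (τ y * y⁻¹) := by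
    intro x
    obtain ⟨y, hy⟩ := hsub x
    refine ⟨y, hy.trans ?_⟩
    simp only [map_mul, map_inv]
    group
  have two : ∀ x, ∃ y, τ x * x⁻¹ = (τ y * y⁻¹) ^ 2 := by
    intro x
    obtain ⟨a, ha⟩ := step x
    obtain ⟨b, hb⟩ := step a
    obtain ⟨c, hc⟩ := step b
    obtain ⟨d, hd⟩ := step c
    refine ⟨d * τ (τ d) ^ 3 * τ (τ (τ d)) ^ 2 * τ d ^ 2, ?_⟩
    rw [ha, hb, hc, hd]
    simp only [map_mul, map_inv, h4, map_pow]
    generalize τ (τ (τ d)) = u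
    generalize τ (τ d) = v
    generalize τ d = w
    apply Additive.ofMul.injective
    simp only [ofMul_mul, ofMul_inv, ofMul_pow]
    abel
  have all : ∀ j : ℕ, ∀ x, ∃ y, τ x * x⁻¹ = (τ y * y⁻¹) ^ (2 ^ j) := by
    intro j
    induction j with
    | zero => intro x; exact ⟨x, by simp⟩
    | succ j ih =>
      intro x
      obtain ⟨y, hy⟩ := ih x
      obtain ⟨z, hz⟩ := two y
      exact ⟨z, by rw [hy, hz, ← pow_mul, pow_succ' 2 j]⟩
  intro x
  obtain ⟨y, hy⟩ := all k x
  rw [hA] at hy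
  exact mul_inv_eq_one.1 hy

end S4

namespace S4

/-- fixed subgroup -/
def fixS {E : Type*} [CommGroup E] (σ : E →* E) : Subgroup E where
  carrier := {x | σ x = x}
  one_mem' := by simp
  mul_mem' := by intro a b ha hb; simp only [Set.mem_ofPred_eq] at *; rw [map_mul, ha, hb]
  inv_mem' := by intro a ha; simp only [Set.mem_ofPred_eq] at *; rw [map_inv, ha]

theorem mem_fixS {E : Type*} [CommGroup E] {σ : E →* E} {x : E} : x ∈ fixS σ ↔ σ x = x := Iff.rfl

/-- norm hom -/
def nm {E : Type*} [CommGroup E] (σ : E →* E) : E →* E := MonoidHom.id E * σ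

theorem nm_apply {E : Type*} [CommGroup E] (σ : E →* E) (x : E) : nm σ x = x * σ x := rfl

/-- difference hom -/
def dl {E : Type*} [CommGroup E] (σ : E →* E) : E →* E := σ * (MonoidHom.id E)⁻¹

theorem dl_apply {E : Type*} [CommGroup E] (σ : E →* E) (x : E) : dl σ x = σ x * x⁻¹ := rfl

/-- squares -/
abbrev sq (E : Type*) [CommGroup E] : E →* E := powMonoidHom 2

theorem unit_index {E : Type*} [CommGroup E] (σ : E →* E) (hσ : ∀ x, σ (σ x) = x) (neg : E)
    (hneg : σ neg = neg) (hneg1 : neg ≠ 1) (hneg2 : neg ^ 2 = 1)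
    (htor : ∀ x : E, x ^ 2 = 1 → x = 1 ∨ x = neg)
    (hns : ∀ x : E, x ^ 2 ≠ neg) (α : ℕ) (hα : α ≠ 0)
    (h1 : ((fixS σ).map (sq E)).relIndex (fixS σ) = α)
    (h2 : (sq E).range.index = α ^ 2) :
    (dl σ).range.relIndex (nm σ).ker = 2 * (nm σ).range.relIndex (fixS σ) ∧
      (nm σ).range.relIndex (fixS σ) ≠ 0 := by
  set P := fixS σ with hP
  set Q := (nm σ).ker with hQ
  have memP : ∀ x, x ∈ P ↔ σ x = x := fun x => Iff.rfl
  have memQ : ∀ x, x ∈ Q ↔ x * σ x = 1 := fun x => Iff.rfl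
  have eqinv : ∀ x ∈ Q, σ x = x⁻¹ := fun x hx => eq_inv_of_mul_eq_one_right ((memQ x).1 hx)
  have hPQ : ∀ x, x ∈ P → x ∈ Q → x = 1 ∨ x = neg := by
    intro x h1 h2
    apply htor
    have := (memQ x).1 h2
    rw [(memP x).1 h1] at this
    rw [pow_two, this]
  have hnegP : neg ∈ P := hneg
  have hnegQ : neg ∈ Q := by rw [memQ, hneg, ← pow_two, hneg2]
  -- a
  have ha1 : (P.map (sq E)).relIndex (nm σ).range = (P ⊔ Q).index := by
    rw [← Subgroup.index_comap]
    congr 1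
    ext x
    rw [Subgroup.mem_comap, Subgroup.mem_map, Subgroup.mem_sup]
    constructor
    · rintro ⟨y, hy, hxy⟩
      refine ⟨y, hy, y⁻¹ * x, ?_, by simp⟩
      rw [memQ, map_mul, map_inv, (memP y).1 hy]
      have : y ^ 2 = x * σ x := hxy
      rw [show y⁻¹ * x * (y⁻¹ * σ x) = (x * σ x) * (y ^ 2)⁻¹ by
        apply Additive.ofMul.injective; simp only [ofMul_mul, ofMul_inv, ofMul_pow, ofMul_one]; abel]
      rw [this]; simp
    · rintro ⟨y, hy, z, hz, rfl⟩
      refine ⟨y, hy, ?_⟩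
      rw [nm_apply, map_mul, (memP y).1 hy, eqinv z hz]
      change y ^ 2 = _
      rw [pow_two]; simp [mul_comm, mul_left_comm]
  have ha2 : (Q.map (sq E)).relIndex (dl σ).range = (P ⊔ Q).index := by
    rw [← Subgroup.index_comap]
    congr 1
    ext x
    rw [Subgroup.mem_comap, Subgroup.mem_map, Subgroup.mem_sup]
    constructor
    · rintro ⟨y, hy, hxy⟩
      refine ⟨x * y, ?_, y⁻¹, inv_mem hy, by simp⟩
      have : y ^ 2 = σ x * x⁻¹ := hxy
      have h3 : σ x = y ^ 2 * x := by rw [this]; simp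
      rw [memP, map_mul, eqinv y hy, h3]
      apply Additive.ofMul.injective; simp only [ofMul_mul, ofMul_inv, ofMul_pow, ofMul_one]; abel
    · rintro ⟨y, hy, z, hz, rfl⟩
      refine ⟨z⁻¹, inv_mem hz, ?_⟩
      rw [dl_apply, map_mul, (memP y).1 hy, eqinv z hz]
      change z⁻¹ ^ 2 = _
      rw [pow_two]; simp [mul_comm, mul_left_comm]
  have le1 : P.map (sq E) ≤ (nm σ).range := by
    rintro _ ⟨y, hy, rfl⟩
    exact ⟨y, by rw [nm_apply, (memP y).1 hy, ← pow_two]; rfl⟩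
  have le2 : (nm σ).range ≤ P := by
    rintro _ ⟨y, rfl⟩
    rw [memP, nm_apply, map_mul, hσ, mul_comm]
  have le3 : Q.map (sq E) ≤ (dl σ).range := by
    rintro _ ⟨y, hy, rfl⟩
    refine ⟨y⁻¹, ?_⟩
    rw [dl_apply, map_inv, eqinv y hy, inv_inv, ← pow_two]; rfl
  have le4 : (dl σ).range ≤ Q := by
    rintro _ ⟨y, rfl⟩
    rw [memQ, dl_apply, map_mul, map_inv, hσ]; simp [mul_comm, mul_left_comm]
  have e1 := Subgroup.relIndex_mul_relIndex _ _ _ le1 le2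
  have e2 := Subgroup.relIndex_mul_relIndex _ _ _ le3 le4
  rw [ha1, h1] at e1
  rw [ha2] at e2
  set a := (P ⊔ Q).index with haa
  have hane : a ≠ 0 := by rintro h; rw [h, zero_mul] at e1; exact hα e1.symm
  -- index of H ^ 2 in H
  set H := P ⊔ Q with hH
  have hkerH : (sq E).ker ≤ H := by
    intro x hx
    rcases htor x hx with rfl | rfl
    · exact one_mem _
    · exact (le_sup_left : P ≤ H) hnegP
  have e3 : (H.map (sq E)).relIndex (sq E).range = a := by
    rw [← Subgroup.index_comap, Subgroup.comap_map_eq_self hkerH]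
  have hHr : H.map (sq E) ≤ H := by
    rintro _ ⟨y, hy, rfl⟩
    exact pow_mem hy 2
  have e4 : (H.map (sq E)).relIndex H = α ^ 2 := by
    have k1 := Subgroup.relIndex_mul_index hHr
    have k2 := Subgroup.relIndex_mul_index (Subgroup.map_le_range (sq E) H)
    rw [e3, h2] at k2
    rw [← k2, mul_comm] at k1
    exact Nat.eq_of_mul_eq_mul_left (Nat.pos_of_ne_zero hane) k1
  -- decomposition
  set Q2 := Q.map (sq E) with hQ2
  set P2 := P.map (sq E) with hP2
  have hQ2Q : Q2 ≤ Q := le3.trans le4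
  have hP2P : P2 ≤ P := le1.trans le2
  have hmapH : H.map (sq E) = P2 ⊔ Q2 := Subgroup.map_sup _ _ _
  have f1 : (P ⊔ Q2).relIndex H = ((P ⊔ Q2) ⊓ Q).relIndex Q := by
    rw [Subgroup.inf_relIndex_right]
    have : H = (P ⊔ Q2) ⊔ Q := by
      rw [sup_assoc, sup_eq_right.2 hQ2Q]
    rw [this, Subgroup.relIndex_sup_left]
  have f2 : (P2 ⊔ Q2).relIndex (P ⊔ Q2) = α := by
    have : P ⊔ Q2 = (P2 ⊔ Q2) ⊔ P := by
      rw [sup_comm P2, sup_assoc, sup_eq_right.2 hP2P, sup_comm]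
    rw [this, Subgroup.relIndex_sup_left, ← Subgroup.inf_relIndex_right, ← h1]
    congr 1
    apply le_antisymm
    · rintro x ⟨hx, hxP⟩
      obtain ⟨u, hu, v, hv, rfl⟩ := Subgroup.mem_sup.1 hx
      have hvP : v ∈ P := by
        have := P.mul_mem (P.inv_mem (hP2P hu)) hxP
        simpa using this
      obtain ⟨w, hw, rfl⟩ := hv
      have : (sq E) w = 1 := by
        rcases hPQ _ hvP (hQ2Q ⟨w, hw, rfl⟩) with h | h
        · exact h
        · exact absurd h (hns w)
      rw [this, mul_one]; exact hu
    · exact le_inf le_sup_left hP2P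
  have f3 : (P2 ⊔ Q2).relIndex (P ⊔ Q2) * (P ⊔ Q2).relIndex H = (P2 ⊔ Q2).relIndex H :=
    Subgroup.relIndex_mul_relIndex _ _ _ (sup_le_sup_right hP2P _) (sup_le_sup_left hQ2Q _)
  have f4 : Q2.relIndex ((P ⊔ Q2) ⊓ Q) = 2 := by
    have hle : Q2 ≤ (P ⊔ Q2) ⊓ Q := le_inf le_sup_right hQ2Q
    have hz : (P ⊔ Q2) ⊓ Q = Q2 ⊔ Subgroup.zpowers neg := by
      apply le_antisymm
      · rintro x ⟨hx, hxQ⟩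
        obtain ⟨u, hu, v, hv, rfl⟩ := Subgroup.mem_sup.1 hx
        have huQ : u ∈ Q := by
          have := Q.mul_mem hxQ (Q.inv_mem (hQ2Q hv))
          simpa using this
        rw [mul_comm]
        refine Subgroup.mul_mem_sup hv ?_
        rcases hPQ u hu huQ with rfl | rfl
        · exact one_mem _
        · exact Subgroup.mem_zpowers _
      · refine sup_le hle ?_
        rw [Subgroup.zpowers_le]
        exact ⟨(le_sup_left : P ≤ P ⊔ Q2) hnegP, hnegQ⟩
    rw [hz, Subgroup.relIndex_sup_left, ← Subgroup.inf_relIndex_right]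
    have : Q2 ⊓ Subgroup.zpowers neg = ⊥ := by
      rw [eq_bot_iff]
      rintro x ⟨⟨w, hw, rfl⟩, hx⟩
      obtain ⟨k, hk⟩ := hx
      have : (sq E w) ^ 2 = 1 := by
        rw [← hk]
        simp only [← zpow_natCast, ← zpow_mul]
        rw [mul_comm, zpow_mul]
        norm_cast
        rw [hneg2, one_zpow]
      rcases htor _ this with h | h
      · simpa using h
      · exact absurd h (hns w)
    rw [this, Subgroup.relIndex_bot_left, Nat.card_zpowers]
    exact orderOf_eq_prime hneg2 hneg1
  have f5 := Subgroup.relIndex_mul_relIndex Q2 ((P ⊔ Q2) ⊓ Q) Q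
    (le_inf le_sup_right hQ2Q) inf_le_right
  rw [f4] at f5
  rw [← hmapH, e4, hmapH, f2, f1] at f3
  have f6 : ((P ⊔ Q2) ⊓ Q).relIndex Q = α := by
    rw [pow_two] at f3
    exact Nat.eq_of_mul_eq_mul_left (Nat.pos_of_ne_zero hα) f3
  rw [f6, ← e2] at f5
  constructor
  · apply Nat.eq_of_mul_eq_mul_left (Nat.pos_of_ne_zero hane)
    rw [← f5, ← e1]; ring
  · rintro h; rw [h, mul_zero] at e1; exact hα e1.symm

theorem chev_abstract {E M J : Type*} [CommGroup E] [CommGroup M] [CommGroup J]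
    (σE : E →* E) (σM : M →* M) (σJ : J →* J) (ι : E →* M) (pr : M →* J)
    (hι : Function.Injective ι) (hιeq : ∀ e, ι (σE e) = σM (ι e))
    (hpreq : ∀ a, pr (σM a) = σJ (pr a))
    (hσM : ∀ x, σM (σM x) = x)
    (hσJ : ∀ x, σJ (σJ x) = x)
    (hex : ∀ a, pr a = 1 ↔ ∃ e, ι e = a)
    (h90 : ∀ a, a * σM a = 1 → ∃ b, a = σM b * b⁻¹)
    (JK T : Subgroup J) (hJK : JK ≤ fixS σJ) (hMJ : (fixS σM).map pr ≤ JK)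
    (hT : ∀ I, I ∈ T ↔ ∃ a, σJ I = I * pr a)
    (U : Subgroup E) (hU : ∀ u, u ∈ U ↔ ∃ a, ι u = a * σM a)
    (hne : (nm σE).range.relIndex (fixS σE) ≠ 0)
    (huni : (dl σE).range.relIndex (nm σE).ker = 2 * (nm σE).range.relIndex (fixS σE)) :
    pr.range.relIndex T * (2 * U.relIndex (fixS σE)) ∣
      JK.relIndex (fixS σJ) * ((fixS σM).map pr).relIndex JK := by
  have hUK : U ≤ fixS σE := by
    intro u hu
    obtain ⟨a, ha⟩ := (hU u).1 hu
    apply hι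
    rw [hιeq, ha, map_mul, hσM, mul_comm]
  have hNU : (nm σE).range ≤ U := by
    rintro _ ⟨e, rfl⟩
    rw [hU]
    exact ⟨ι e, by rw [nm_apply, map_mul, hιeq]⟩
  -- the group R
  let R : Subgroup (J × M) :=
    { carrier := {x | σJ x.1 = x.1 * pr x.2}
      one_mem' := by simp
      mul_mem' := by
        intro a b ha hb
        simp only [Set.mem_ofPred_eq, Prod.fst_mul, Prod.snd_mul, map_mul] at *
        rw [ha, hb, mul_mul_mul_comm]
      inv_mem' := by
        intro a ha
        simp only [Set.mem_ofPred_eq, Prod.fst_inv, Prod.snd_inv, map_inv] at *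
        rw [ha, mul_inv] }
  have memR : ∀ x : J × M, x ∈ R ↔ σJ x.1 = x.1 * pr x.2 := fun x => Iff.rfl
  have hfstR : T = R.map (MonoidHom.fst J M) := by
    ext I
    rw [hT, Subgroup.mem_map]
    constructor
    · rintro ⟨a, ha⟩; exact ⟨(I, a), ha, rfl⟩
    · rintro ⟨⟨I', a⟩, ha, rfl⟩; exact ⟨a, ha⟩
  let ψ : J × M →* M := (nm σM).comp (MonoidHom.snd J M)
  set F := fixS σJ with hF
  set P := pr.range with hP
  have hFP : F ⊔ P ≤ T := by
    refine sup_le ?_ ?_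
    · intro I hI; rw [hT]; exact ⟨1, by rw [map_one, mul_one]; exact hI⟩
    · rintro _ ⟨a, rfl⟩; rw [hT]
      refine ⟨σM a * a⁻¹, ?_⟩
      rw [map_mul, hpreq, map_inv]; simp [mul_comm]
  -- invariance: J σ fix σ of pr
  have key : R ⊓ ((F ⊔ P).comap (MonoidHom.fst J M)) = R ⊓ (((nm σE).range.map ι).comap ψ) := by
    ext ⟨I, a⟩
    simp only [Subgroup.mem_inf, and_congr_right_iff, Subgroup.mem_comap]
    intro hR
    have hR' : σJ I = I * pr a := hR
    constructor
    · intro h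
      obtain ⟨A, hA, _, ⟨b, rfl⟩, hAb⟩ := Subgroup.mem_sup.1 h
      have hAb : A * pr b = I := hAb
      have hA : σJ A = A := hA
      have h1 : pr (σM b * b⁻¹ * a⁻¹) = 1 := by
        rw [← hAb, map_mul, hA, ← hpreq] at hR'
        rw [map_mul, map_mul, map_inv, map_inv]
        have : pr (σM b) = pr b * pr a := by
          rw [mul_assoc] at hR'; exact mul_left_cancel hR'
        rw [this]; simp [mul_comm]
      obtain ⟨e, he⟩ := (hex _).1 h1
      refine ⟨nm σE e⁻¹, ⟨e⁻¹, rfl⟩, ?_⟩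
      change ι (nm σE e⁻¹) = a * σM a
      rw [nm_apply, map_mul, hιeq, map_inv, he]
      simp only [map_mul, map_inv, hσM]
      apply Additive.ofMul.injective; simp only [ofMul_mul, ofMul_inv, ofMul_pow, ofMul_one]; abel
    · rintro ⟨_, ⟨e, rfl⟩, he⟩
      have he : ι (nm σE e) = a * σM a := he
      obtain ⟨b, hb⟩ := h90 (a * (ι e)⁻¹) (by
        rw [map_mul, map_inv, ← hιeq, mul_mul_mul_comm, ← he, nm_apply, map_mul]
        apply Additive.ofMul.injective; simp only [ofMul_mul, ofMul_inv, ofMul_pow, ofMul_one]; abel)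
      have hpa : pr a = σJ (pr b) * (pr b)⁻¹ := by
        have h2 := congrArg pr hb
        rw [map_mul, map_inv, (hex (ι e)).2 ⟨e, rfl⟩, inv_one, mul_one, map_mul, map_inv,
          hpreq] at h2
        exact h2
      refine Subgroup.mem_sup.2 ⟨I * (pr b)⁻¹, ?_, pr b, ⟨b, rfl⟩, by simp⟩
      rw [mem_fixS, map_mul, map_inv, hR', hpa]
      apply Additive.ofMul.injective; simp only [ofMul_mul, ofMul_inv, ofMul_pow, ofMul_one]; abel
  have t1 : (F ⊔ P).relIndex T = ((nm σE).range.map ι).relIndex (R.map ψ) := by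
    rw [hfstR, ← Subgroup.relIndex_comap, ← Subgroup.inf_relIndex_left, key,
      Subgroup.inf_relIndex_left, Subgroup.relIndex_comap]
  have hNE : (nm σE).range.map ι ≤ R.map ψ := by
    rintro _ ⟨_, ⟨e, rfl⟩, rfl⟩
    refine ⟨(1, ι e), ?_, ?_⟩
    · change σJ 1 = 1 * pr (ι e)
      rw [map_one, one_mul, (hex _).2 ⟨e, rfl⟩]
    · change ι e * σM (ι e) = ι (e * σE e)
      rw [map_mul, hιeq]
  have hψU : R.map ψ ≤ U.map ι := by
    rintro _ ⟨⟨I, a⟩, hR, rfl⟩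
    have hR' : σJ I = I * pr a := hR
    change a * σM a ∈ _
    have hJ2 := hσJ I
    have : pr (a * σM a) = 1 := by
      rw [map_mul, hpreq]
      have h3 : I = I * (pr a * σJ (pr a)) := by
        conv_lhs => rw [← hJ2, hR', map_mul, hR']
        rw [mul_assoc]
      exact (mul_eq_left.1 h3.symm)
    obtain ⟨e, he⟩ := (hex _).1 this
    exact ⟨e, (hU e).2 ⟨a, he⟩, he⟩
  have t2 : (F ⊔ P).relIndex T ∣ (nm σE).range.relIndex U := by
    rw [t1, ← Subgroup.relIndex_map_map_of_injective _ _ hι,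
      ← Subgroup.relIndex_mul_relIndex _ _ _ hNE hψU]
    exact dvd_mul_right _ _
  have t3 := Subgroup.relIndex_mul_relIndex _ _ _ hNU hUK
  -- principal part
  set PK := (fixS σM).map pr with hPK
  have hPKF : PK ≤ F := hMJ.trans hJK
  have hPKP : PK ≤ P := Subgroup.map_le_range _ _
  let M1 : Subgroup M := (fixS σJ).comap pr
  have s1 : PK.relIndex (F ⊓ P) = (dl σE).range.relIndex (nm σE).ker := by
    have e1 : F ⊓ P = M1.map pr := by
      rw [Subgroup.map_comap_eq, inf_comm]
    have e2 : M1.map (dl σM) = ((nm σE).ker).map ι := by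
      ext x
      constructor
      · rintro ⟨a, ha, rfl⟩
        have ha : σJ (pr a) = pr a := ha
        have : pr (dl σM a) = 1 := by
          rw [dl_apply, map_mul, map_inv, hpreq, ha, mul_inv_cancel]
        obtain ⟨e, he⟩ := (hex _).1 this
        refine ⟨e, ?_, he⟩
        change e * σE e = 1
        apply hι
        rw [map_mul, hιeq, he, dl_apply, map_mul, map_inv, hσM, map_one]
        apply Additive.ofMul.injective; simp only [ofMul_mul, ofMul_inv, ofMul_one]; abel
      · rintro ⟨e, he, rfl⟩
        have he : e * σE e = 1 := he
        obtain ⟨b, hb⟩ := h90 (ι e) (by rw [← hιeq, ← map_mul, he, map_one])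
        refine ⟨b, ?_, hb.symm⟩
        change σJ (pr b) = pr b
        have := congrArg pr hb
        rw [(hex (ι e)).2 ⟨e, rfl⟩, map_mul, map_inv, hpreq] at this
        exact (mul_inv_eq_one.1 this.symm)
    have e3 : M1 ⊓ (PK.comap pr) = M1 ⊓ (((dl σE).range.map ι).comap (dl σM)) := by
      ext a
      simp only [Subgroup.mem_inf, and_congr_right_iff, Subgroup.mem_comap]
      intro ha
      constructor
      · rintro ⟨b, hb, hab⟩
        have hb : σM b = b := hb
        obtain ⟨e, he⟩ := (hex (a * b⁻¹)).1 (by rw [map_mul, map_inv, hab, mul_inv_cancel])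
        refine ⟨dl σE e, ⟨e, rfl⟩, ?_⟩
        rw [dl_apply, dl_apply, map_mul, map_inv, hιeq, he, map_mul, map_inv, hb]
        apply Additive.ofMul.injective; simp only [ofMul_mul, ofMul_inv]; abel
      · rintro ⟨_, ⟨e, rfl⟩, he⟩
        rw [dl_apply, dl_apply, map_mul, map_inv, hιeq] at he
        refine ⟨a * (ι e)⁻¹, ?_, ?_⟩
        · change σM _ = _
          rw [map_mul, map_inv]
          have h5 : σM a = σM (ι e) * (ι e)⁻¹ * a := by rw [he]; simp
          rw [h5]
          apply Additive.ofMul.injective; simp only [ofMul_mul, ofMul_inv]; abel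
        · rw [map_mul, map_inv, (hex (ι e)).2 ⟨e, rfl⟩, inv_one, mul_one]
    rw [e1, ← Subgroup.relIndex_comap, ← Subgroup.inf_relIndex_left, e3,
      Subgroup.inf_relIndex_left, Subgroup.relIndex_comap, e2,
      Subgroup.relIndex_map_map_of_injective _ _ hι]
  have s2 := Subgroup.relIndex_mul_relIndex PK (F ⊓ P) F (le_inf hPKF hPKP) inf_le_left
  have s3 := Subgroup.relIndex_mul_relIndex PK JK F hMJ hJK
  have s4 := Subgroup.relIndex_mul_relIndex P (F ⊔ P) T le_sup_right hFP
  have s5 : P.relIndex (F ⊔ P) = (F ⊓ P).relIndex F := by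
    rw [Subgroup.relIndex_sup_right, Subgroup.inf_relIndex_left]
  have hUne : (nm σE).range.relIndex U ≠ 0 := by
    intro h; rw [h, zero_mul] at t3; exact hne t3.symm
  apply Nat.dvd_of_mul_dvd_mul_right (Nat.pos_of_ne_zero hUne)
  have : P.relIndex T * (2 * U.relIndex (fixS σE)) * (nm σE).range.relIndex U =
      (F ⊔ P).relIndex T * (JK.relIndex F * PK.relIndex JK) := by
    rw [mul_comm (JK.relIndex F), s3, ← s2, s1, huni, ← t3, ← s4, s5]
    ring
  rw [this, mul_comm]
  exact mul_dvd_mul_left _ t2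
end S4

namespace S4
open nonZeroDivisors

/-! ### Lifting homs to class groups -/
theorem clLift_aux {R G : Type*} [CommRing R] [IsDomain R] [IsDedekindDomain R] [CommGroup G]
    (f : (Ideal R)⁰ →* G)
    (hf : ∀ x : R, ∀ h : Ideal.span {x} ∈ (Ideal R)⁰, f ⟨Ideal.span {x}, h⟩ = 1)
    {I J : (Ideal R)⁰} (h : ClassGroup.mk0 I = ClassGroup.mk0 J) : f I = f J := by
  obtain ⟨x, y, hx, hy, h⟩ := ClassGroup.mk0_eq_mk0_iff.1 h
  have hx' : Ideal.span {x} ∈ (Ideal R)⁰ := by simpa [mem_nonZeroDivisors_iff_ne_zero] using hx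
  have hy' : Ideal.span {y} ∈ (Ideal R)⁰ := by simpa [mem_nonZeroDivisors_iff_ne_zero] using hy
  have : (⟨Ideal.span {x}, hx'⟩ : (Ideal R)⁰) * I = ⟨Ideal.span {y}, hy'⟩ * J := Subtype.ext h
  have h2 := congrArg f this
  rwa [map_mul, map_mul, hf, hf, one_mul, one_mul] at h2

/-- lift of a hom on ideals to the class group -/
noncomputable def clLift {R G : Type*} [CommRing R] [IsDomain R] [IsDedekindDomain R] [CommGroup G]
    (f : (Ideal R)⁰ →* G)
    (hf : ∀ x : R, ∀ h : Ideal.span {x} ∈ (Ideal R)⁰, f ⟨Ideal.span {x}, h⟩ = 1) :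
    ClassGroup R →* G :=
  MonoidHom.mk' (fun c => f (Function.surjInv ClassGroup.mk0_surjective c)) (by
    intro a b
    rw [← map_mul]
    apply clLift_aux f hf
    rw [map_mul]
    simp only [Function.surjInv_eq])

theorem clLift_mk0 {R G : Type*} [CommRing R] [IsDomain R] [IsDedekindDomain R] [CommGroup G]
    (f : (Ideal R)⁰ →* G)
    (hf : ∀ x : R, ∀ h : Ideal.span {x} ∈ (Ideal R)⁰, f ⟨Ideal.span {x}, h⟩ = 1) (I : (Ideal R)⁰) :
    clLift f hf (ClassGroup.mk0 I) = f I := by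
  apply clLift_aux f hf
  exact Function.surjInv_eq _ _

theorem ideal_ne_zero {R : Type*} [CommRing R] [IsDomain R] (I : (Ideal R)⁰) : (I : Ideal R) ≠ ⊥ :=
  mem_nonZeroDivisors_iff_ne_zero.1 I.2

/-- Ideal maps along injective ring homs -/
noncomputable def idMap {R S : Type*} [CommRing R] [CommRing S] [IsDomain R] [IsDomain S]
    (f : R →+* S) (hf : Function.Injective f) : (Ideal R)⁰ →* (Ideal S)⁰ where
  toFun I := ⟨(I : Ideal R).map f, by
    rw [mem_nonZeroDivisors_iff_ne_zero, Ne, Ideal.zero_eq_bot,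
      Ideal.map_eq_bot_iff_of_injective hf]
    exact ideal_ne_zero I⟩
  map_one' := by ext1; simp [Ideal.one_eq_top, Ideal.map_top]
  map_mul' I J := by ext1; simp [Ideal.map_mul]

theorem coe_idMap {R S : Type*} [CommRing R] [CommRing S] [IsDomain R] [IsDomain S]
    (f : R →+* S) (hf : Function.Injective f) (I : (Ideal R)⁰) :
    (idMap f hf I : Ideal S) = (I : Ideal R).map f := rfl

/-- class group maps along injective ring homs -/
noncomputable def clMap {R S : Type*} [CommRing R] [CommRing S] [IsDomain R] [IsDomain S]
    [IsDedekindDomain R] [IsDedekindDomain S] (f : R →+* S) (hf : Function.Injective f) :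
    ClassGroup R →* ClassGroup S :=
  clLift (ClassGroup.mk0.comp (idMap f hf)) (by
    intro x h
    rw [MonoidHom.comp_apply, ClassGroup.mk0_eq_one_iff, coe_idMap]
    refine ⟨f x, ?_⟩
    simp [Ideal.map_span, Ideal.submodule_span_eq])

theorem clMap_mk0 {R S : Type*} [CommRing R] [CommRing S] [IsDomain R] [IsDomain S]
    [IsDedekindDomain R] [IsDedekindDomain S] (f : R →+* S) (hf : Function.Injective f)
    (I : (Ideal R)⁰) : clMap f hf (ClassGroup.mk0 I) = ClassGroup.mk0 (idMap f hf I) :=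
  clLift_mk0 _ _ _

theorem cl_ind {R : Type*} [CommRing R] [IsDomain R] [IsDedekindDomain R]
    {p : ClassGroup R → Prop} (h : ∀ I : (Ideal R)⁰, p (ClassGroup.mk0 I)) (c) : p c := by
  obtain ⟨I, rfl⟩ := ClassGroup.mk0_surjective c
  exact h I

/-! ### Fractional ideals -/
section frac
variable {K L : Type*} [Field K] [Field L] [NumberField K] [NumberField L]

theorem nzd_le {R S : Type*} [CommRing R] [CommRing S] [IsDomain R] [IsDomain S]
    (f : R →+* S) (hf : Function.Injective f) : R⁰ ≤ Submonoid.comap f S⁰ := by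
  intro x hx
  rw [Submonoid.mem_comap, mem_nonZeroDivisors_iff_ne_zero, Ne, map_eq_zero_iff f hf]
  exact mem_nonZeroDivisors_iff_ne_zero.1 hx

/-- extension of fractional ideals -/
noncomputable def extU (f : 𝓞 K →+* 𝓞 L) (hf : Function.Injective f) :
    (FractionalIdeal (𝓞 K)⁰ K)ˣ →* (FractionalIdeal (𝓞 L)⁰ L)ˣ :=
  Units.map (FractionalIdeal.extendedHom' (K := K) L (nzd_le f hf)).toMonoidHom

theorem extU_mk0 (f : 𝓞 K →+* 𝓞 L) (hf : Function.Injective f) (I : (Ideal (𝓞 K))⁰) :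
    extU f hf (FractionalIdeal.mk0 K I) = FractionalIdeal.mk0 L (idMap f hf I) := by
  ext1
  exact FractionalIdeal.extended_coeIdeal_eq_map L (nzd_le f hf) (I : Ideal (𝓞 K))

theorem extU_pr (f : 𝓞 K →+* 𝓞 L) (hf : Function.Injective f) (g : K →+* L)
    (hg : ∀ x : 𝓞 K, g x = f x) (x : Kˣ) :
    extU f hf (toPrincipalIdeal (𝓞 K) K x) =
      toPrincipalIdeal (𝓞 L) L (Units.map (g : K →* L) x) := by
  have h1 : IsLocalization.map (S := K) L f (nzd_le f hf) = g := by
    apply IsLocalization.ringHom_ext (𝓞 K)⁰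
    ext y
    simp only [RingHom.comp_apply, IsLocalization.map_eq]
    exact (hg y).symm
  ext1
  rw [coe_toPrincipalIdeal]
  change FractionalIdeal.extended L (nzd_le f hf) (toPrincipalIdeal (𝓞 K) K x : FractionalIdeal (𝓞 K)⁰ K) = _
  rw [coe_toPrincipalIdeal, FractionalIdeal.extended_spanSingleton, h1]
  rfl

theorem frac_repr (I : (FractionalIdeal (𝓞 K)⁰ K)ˣ) : ∃ (A : (Ideal (𝓞 K))⁰) (d : Kˣ) (d0 : 𝓞 K),
    (d : K) = d0 ∧ I * toPrincipalIdeal (𝓞 K) K d = FractionalIdeal.mk0 K A := by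
  have hd : ((I : FractionalIdeal (𝓞 K)⁰ K).den : 𝓞 K) ≠ 0 := nonZeroDivisors.ne_zero (SetLike.coe_mem _)
  have hd' : (((I : FractionalIdeal (𝓞 K)⁰ K).den : 𝓞 K) : K) ≠ 0 := by
    simpa using hd
  have h0 : (I : FractionalIdeal (𝓞 K)⁰ K).num ≠ ⊥ := by
    intro h
    have := (FractionalIdeal.num_eq_zero_iff (R := 𝓞 K) (K := K) (I := I)
      ).1 h
    exact I.ne_zero this
  refine ⟨⟨(I : FractionalIdeal (𝓞 K)⁰ K).num, mem_nonZeroDivisors_iff_ne_zero.2 h0⟩, Units.mk0 _ hd', _, rfl, ?_⟩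
  ext1
  rw [Units.val_mul, coe_toPrincipalIdeal, FractionalIdeal.coe_mk0]
  have := FractionalIdeal.den_mul_self_eq_num' (R := 𝓞 K) (P := K) (S := (𝓞 K)⁰) (I : FractionalIdeal (𝓞 K)⁰ K)
  rw [mul_comm]
  exact this

theorem frac_ext {G : Type*} [CommGroup G] {f g : (FractionalIdeal (𝓞 K)⁰ K)ˣ →* G}
    (h : ∀ A : (Ideal (𝓞 K))⁰, f (FractionalIdeal.mk0 K A) = g (FractionalIdeal.mk0 K A)) :
    f = g := by
  ext I
  obtain ⟨A, d, d0, hd, hA⟩ := frac_repr I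
  have h1 := h A
  have h2 : toPrincipalIdeal (𝓞 K) K d = FractionalIdeal.mk0 K ⟨Ideal.span {d0}, by
      rw [mem_nonZeroDivisors_iff_ne_zero]
      have : (d : K) ≠ 0 := d.ne_zero
      rw [hd] at this
      simpa using this⟩ := by
    ext1
    rw [coe_toPrincipalIdeal, FractionalIdeal.coe_mk0, FractionalIdeal.coeIdeal_span_singleton, hd]
  have h3 := h ⟨Ideal.span {d0}, by
      rw [mem_nonZeroDivisors_iff_ne_zero]
      have : (d : K) ≠ 0 := d.ne_zero
      rw [hd] at this
      simpa using this⟩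
  rw [← h2] at h3
  rw [← hA, map_mul, map_mul, h3] at h1
  exact mul_right_cancel h1

theorem pr_eq_one_iff (a : Kˣ) : toPrincipalIdeal (𝓞 K) K a = 1 ↔
    ∃ e : (𝓞 K)ˣ, Units.map (algebraMap (𝓞 K) K : 𝓞 K →* K) e = a := by
  rw [toPrincipalIdeal_eq_iff, Units.val_one]
  constructor
  · intro h
    have h1 : FractionalIdeal.spanSingleton (𝓞 K)⁰ (a : K) = FractionalIdeal.spanSingleton (𝓞 K)⁰ 1 := by
      rw [h, FractionalIdeal.spanSingleton_one]
    rw [FractionalIdeal.spanSingleton_eq_spanSingleton] at h1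
    obtain ⟨z, hz⟩ := h1
    refine ⟨z⁻¹, ?_⟩
    have : Units.map (algebraMap (𝓞 K) K : 𝓞 K →* K) z * a = 1 := by
      ext1
      simpa [Units.smul_def, Algebra.smul_def] using hz
    rw [map_inv]
    exact inv_eq_of_mul_eq_one_right this
  · rintro ⟨e, rfl⟩
    rw [← FractionalIdeal.spanSingleton_one, FractionalIdeal.spanSingleton_eq_spanSingleton]
    refine ⟨e⁻¹, ?_⟩
    rw [Units.smul_def, Algebra.smul_def]
    simp only [Units.coe_map, MonoidHom.coe_coe]
    rw [← map_mul]; simp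
end frac
end S4

namespace S4
open nonZeroDivisors

section quad
variable {K L : Type} [Field K] [Field L] [NumberField K] [NumberField L] [Algebra K L]

/-- action on integers -/
noncomputable abbrev sI (σ : L ≃ₐ[K] L) : 𝓞 L →+* 𝓞 L :=
  RingOfIntegers.mapRingHom ((σ : L →ₐ[K] L) : L →+* L)

theorem coe_sI (σ : L ≃ₐ[K] L) (x : 𝓞 L) : ((sI σ x : 𝓞 L) : L) = σ x := rfl

theorem sI_inj (σ : L ≃ₐ[K] L) : Function.Injective (sI σ) := by
  intro x y h
  have := congrArg (fun z : 𝓞 L => (z : L)) h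
  simp only [coe_sI] at this
  exact RingOfIntegers.ext (σ.injective this)

theorem sI_comp (σ τ : L ≃ₐ[K] L) (x : 𝓞 L) : sI σ (sI τ x) = sI (σ * τ) x := rfl

theorem sI_alg (σ : L ≃ₐ[K] L) (x : 𝓞 K) :
    sI σ (algebraMap (𝓞 K) (𝓞 L) x) = algebraMap (𝓞 K) (𝓞 L) x := by
  ext
  rw [coe_sI]
  exact σ.commutes _

theorem sI_one (x : 𝓞 L) : sI (1 : L ≃ₐ[K] L) x = x := rfl

theorem map_sI_comp (σ τ : L ≃ₐ[K] L) (I : Ideal (𝓞 L)) :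
    (I.map (sI τ)).map (sI σ) = I.map (sI (σ * τ)) := by
  rw [Ideal.map_map]; rfl

theorem map_sI_one (I : Ideal (𝓞 L)) : I.map (sI (1 : L ≃ₐ[K] L)) = I := by
  have : sI (1 : L ≃ₐ[K] L) = RingHom.id _ := rfl
  rw [this, Ideal.map_id]

theorem mem_map_sI (σ : L ≃ₐ[K] L) (I : Ideal (𝓞 L)) (x : 𝓞 L) :
    x ∈ I.map (sI σ) ↔ sI σ⁻¹ x ∈ I := by
  have h : ∀ (τ : L ≃ₐ[K] L) (J : Ideal (𝓞 L)) (y : 𝓞 L), y ∈ J → sI τ y ∈ J.map (sI τ) :=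
    fun τ J y hy => Ideal.mem_map_of_mem _ hy
  constructor
  · intro hx
    have := h σ⁻¹ _ _ hx
    rwa [map_sI_comp, inv_mul_cancel, map_sI_one] at this
  · intro hx
    have := h σ _ _ hx
    rwa [sI_comp, mul_inv_cancel, sI_one] at this

theorem alg_inj : Function.Injective (algebraMap (𝓞 K) (𝓞 L)) :=
  FaithfulSMul.algebraMap_injective _ _

theorem map_sI_map_alg (σ : L ≃ₐ[K] L) (I : Ideal (𝓞 K)) :
    (I.map (algebraMap (𝓞 K) (𝓞 L))).map (sI σ) = I.map (algebraMap (𝓞 K) (𝓞 L)) := by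
  rw [Ideal.map_map]
  congr 1
  ext x
  exact σ.commutes _

theorem absNorm_map_sI (σ : L ≃ₐ[K] L) (I : Ideal (𝓞 L)) :
    Ideal.absNorm (I.map (sI σ)) = Ideal.absNorm I := by
  let e : 𝓞 L ≃+* 𝓞 L := RingOfIntegers.mapRingEquiv (σ : L ≃+* L)
  have h : I.map (sI σ) = I.map (e : 𝓞 L →+* 𝓞 L) := rfl
  rw [h, Ideal.absNorm_apply, Ideal.absNorm_apply, Submodule.cardQuot_apply, Submodule.cardQuot_apply]
  exact (Nat.card_congr (Ideal.quotientEquiv I _ e rfl).toEquiv).symm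

theorem isPrime_map_sI (σ : L ≃ₐ[K] L) (I : Ideal (𝓞 L)) [I.IsPrime] : (I.map (sI σ)).IsPrime := by
  let e : 𝓞 L ≃+* 𝓞 L := RingOfIntegers.mapRingEquiv (σ : L ≃+* L)
  exact Ideal.map_isPrime_of_equiv e

theorem ideal_eq_of_le_of_absNorm {I J : Ideal (𝓞 L)} (h : I ≤ J) (hI : I ≠ ⊥)
    (hn : Ideal.absNorm I = Ideal.absNorm J) : I = J := by
  obtain ⟨C, hC⟩ := Ideal.dvd_iff_le.2 h
  have h1 : Ideal.absNorm J * Ideal.absNorm C = Ideal.absNorm J := by rw [← map_mul, ← hC, hn]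
  have h2 : Ideal.absNorm J ≠ 0 := by
    rw [← hn, Ne, Ideal.absNorm_eq_zero_iff]; exact hI
  have h3 : Ideal.absNorm C = 1 := by
    apply Nat.eq_of_mul_eq_mul_left (Nat.pos_of_ne_zero h2); rw [h1, mul_one]
  rw [Ideal.absNorm_eq_one_iff] at h3
  rw [hC, h3, Ideal.mul_top]

variable [Algebra.IsQuadraticExtension K L] (σ : L ≃ₐ[K] L) (hσ : σ ≠ 1)
include hσ

theorem gal_two (g : L ≃ₐ[K] L) : g = 1 ∨ g = σ := by
  have h : Nat.card (L ≃ₐ[K] L) = 2 := by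
    rw [IsGalois.card_aut_eq_finrank, Algebra.IsQuadraticExtension.finrank_eq_two]
  rw [Nat.card_eq_two_iff' (1 : L ≃ₐ[K] L)] at h
  obtain ⟨y, hy, hu⟩ := h
  by_cases hg : g = 1
  · exact Or.inl hg
  · right; rw [hu g hg, hu σ hσ]

theorem gal_sq : σ * σ = 1 := by
  rcases gal_two σ hσ (σ * σ) with h | h
  · exact h
  · exact absurd (mul_eq_left.1 h) hσ

theorem sig_sig (x : L) : σ (σ x) = x := by
  have := congrArg (fun g : L ≃ₐ[K] L => g x) (gal_sq σ hσ)
  simpa using this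

theorem sI_sI (x : 𝓞 L) : sI σ (sI σ x) = x := by
  ext; exact sig_sig σ hσ x

theorem fix_field {x : L} (hx : σ x = x) : ∃ y : K, algebraMap K L y = x := by
  have : x ∈ (⊥ : IntermediateField K L) := by
    rw [IsGalois.mem_bot_iff_fixed]
    intro g
    rcases gal_two σ hσ g with rfl | rfl
    · rfl
    · exact hx
  exact IntermediateField.mem_bot.1 this

theorem fix_int {x : 𝓞 L} (hx : sI σ x = x) : ∃ y : 𝓞 K, algebraMap (𝓞 K) (𝓞 L) y = x := by
  obtain ⟨y, hy⟩ := fix_field σ hσ (congrArg (fun z : 𝓞 L => (z : L)) hx)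
  have hi : IsIntegral ℤ y := by
    have h : IsIntegral ℤ (algebraMap K L y) := by rw [hy]; exact x.isIntegral_coe
    exact (isIntegral_algebraMap_iff (algebraMap K L).injective).1 h
  exact ⟨⟨y, hi⟩, RingOfIntegers.ext hy⟩

theorem norm_eq_mul (x : L) : algebraMap K L (Algebra.norm K x) = x * σ x := by
  classical
  rw [Algebra.norm_eq_prod_automorphisms]
  have : (Finset.univ : Finset (L ≃ₐ[K] L)) = {1, σ} := by
    ext g; simpa using gal_two σ hσ g
  rw [this, Finset.prod_pair hσ.symm]; rfl

theorem intNorm_eq_mul (x : 𝓞 L) :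
    algebraMap (𝓞 K) (𝓞 L) (Algebra.intNorm (𝓞 K) (𝓞 L) x) = x * sI σ x := by
  ext
  have h1 := Algebra.algebraMap_intNorm (A := 𝓞 K) (K := K) (L := L) (B := 𝓞 L) x
  have h2 := norm_eq_mul σ hσ (x : L)
  have h3 : ((algebraMap (𝓞 K) (𝓞 L) (Algebra.intNorm (𝓞 K) (𝓞 L) x) : 𝓞 L) : L) =
    algebraMap K L (algebraMap (𝓞 K) K (Algebra.intNorm (𝓞 K) (𝓞 L) x)) := rfl
  rw [h3, h1]
  exact h2

theorem map_relNorm_eq (I : Ideal (𝓞 L)) (hI : I ≠ ⊥) :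
    (Ideal.relNorm (𝓞 K) I).map (algebraMap (𝓞 K) (𝓞 L)) = I * I.map (sI σ) := by
  apply ideal_eq_of_le_of_absNorm
  · rw [Ideal.map_relNorm, Ideal.span_le]
    rintro _ ⟨x, hx, rfl⟩
    rw [SetLike.mem_coe, Function.comp_apply, intNorm_eq_mul σ hσ]
    exact Ideal.mul_mem_mul hx (Ideal.mem_map_of_mem _ hx)
  · rw [Ne, Ideal.map_eq_bot_iff_of_injective alg_inj, Ideal.relNorm_eq_bot_iff]
    exact hI
  · rw [Ideal.absNorm_algebraMap, map_mul, absNorm_map_sI, Ideal.absNorm_relNorm, ← pow_two,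
      ← IsFractionRing.finrank_eq (𝓞 K) K (𝓞 L) L,
      Algebra.IsQuadraticExtension.finrank_eq_two]

theorem hilb90 (a : Lˣ) (ha : (a : L) * σ a = 1) : ∃ b : Lˣ, (a : L) = σ b * (b : L)⁻¹ := by
  have hz : ∀ x : L ≃ₐ[K] L, x ∈ Subgroup.zpowers σ := by
    intro g
    rcases gal_two σ hσ g with rfl | rfl
    · exact one_mem _
    · exact Subgroup.mem_zpowers _
  have hn : Algebra.norm K (a : L) = 1 := by
    apply (algebraMap K L).injective
    rw [norm_eq_mul σ hσ, ha, map_one]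
  obtain ⟨y, hy⟩ := groupCohomology.exists_div_of_norm_eq_one hz hn
  refine ⟨y⁻¹, ?_⟩
  rw [← hy]
  simp [div_eq_mul_inv, mul_comm]
end quad
end S4

namespace S4
open nonZeroDivisors
section units
variable {K : Type} [Field K] [NumberField K]

theorem exists_real_emb [IsTotallyReal K] : Nonempty (K →+* ℝ) := by
  obtain ⟨φ⟩ : Nonempty (K →+* ℂ) := inferInstance
  exact ⟨(IsTotallyReal.complexEmbedding_isReal φ).embedding⟩

theorem unit_tors (φ : K →+* ℝ) (x : (𝓞 K)ˣ) (n : ℕ) (hn : n ≠ 0) (hx : x ^ n = 1) :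
    x = 1 ∨ x = -1 := by
  have h : (φ (x : 𝓞 K)) ^ n = 1 := by
    rw [← map_pow]
    have : ((x : 𝓞 K) : K) ^ n = 1 := by
      have := congrArg (fun u : (𝓞 K)ˣ => ((u : 𝓞 K) : K)) hx
      simpa using this
    rw [this, map_one]
  have h2 : |φ (x : 𝓞 K)| = 1 := by
    rw [← abs_pow_eq_one _ hn, h, abs_one]
  have hinj : Function.Injective (fun u : (𝓞 K)ˣ => φ ((u : 𝓞 K) : K)) := by
    intro u v h
    exact Units.ext (RingOfIntegers.ext (φ.injective h))
  rcases eq_or_eq_neg_of_abs_eq h2 with h3 | h3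
  · left; apply hinj; simpa using h3
  · right; apply hinj; simpa using h3

theorem unit_neg_ne (φ : K →+* ℝ) : (-1 : (𝓞 K)ˣ) ≠ 1 := by
  intro h
  have := congrArg (fun u : (𝓞 K)ˣ => φ ((u : 𝓞 K) : K)) h
  simp at this
  norm_num at this

theorem unit_sq_ne (φ : K →+* ℝ) (x : (𝓞 K)ˣ) : x ^ 2 ≠ -1 := by
  intro h
  have := congrArg (fun u : (𝓞 K)ˣ => φ ((u : 𝓞 K) : K)) h
  simp at this
  nlinarith [sq_nonneg (φ ((x : 𝓞 K) : K))]

theorem sq_index [IsTotallyReal K] :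
    (sq (𝓞 K)ˣ).range.index = 2 ^ (Module.finrank ℚ K) := by
  obtain ⟨φ⟩ := exists_real_emb (K := K)
  set T := Units.torsion K
  have hT : ∀ x, x ∈ T ↔ x = 1 ∨ x = -1 := by
    intro x
    constructor
    · intro h
      obtain ⟨n, hn, h⟩ := isOfFinOrder_iff_pow_eq_one.1 ((CommGroup.mem_torsion _).1 h)
      exact unit_tors φ x n hn.ne' h
    · rintro (rfl | rfl)
      · exact one_mem _
      · exact (CommGroup.mem_torsion _).2 (isOfFinOrder_iff_pow_eq_one.2 ⟨2, by norm_num, by simp⟩)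
  have hTc : Nat.card T = 2 := by
    rw [Nat.card_eq_two_iff' (1 : T)]
    refine ⟨⟨-1, (hT _).2 (Or.inr rfl)⟩, ?_, ?_⟩
    · intro h; exact unit_neg_ne φ (congrArg Subtype.val h)
    · rintro ⟨y, hy⟩ h
      rcases (hT y).1 hy with rfl | rfl
      · exact absurd rfl h
      · rfl
  have hinf : (sq (𝓞 K)ˣ).range ⊓ T = ⊥ := by
    rw [eq_bot_iff]
    rintro x ⟨⟨y, hy⟩, h2⟩
    rcases (hT x).1 h2 with rfl | rfl
    · exact one_mem _
    · exact absurd hy (unit_sq_ne φ y)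
  have h1 : (sq (𝓞 K)ˣ).range.relIndex ((sq (𝓞 K)ˣ).range ⊔ T) = 2 := by
    rw [sup_comm, Subgroup.relIndex_sup_right, ← Subgroup.inf_relIndex_right, hinf, Subgroup.relIndex_bot_left, hTc]
  have h2 : ((sq (𝓞 K)ˣ).range ⊔ T) = (sq ((𝓞 K)ˣ ⧸ T)).range.comap (QuotientGroup.mk' T) := by
    ext x
    constructor
    · intro h
      obtain ⟨a, ⟨b, rfl⟩, t, ht, rfl⟩ := Subgroup.mem_sup.1 h
      refine ⟨QuotientGroup.mk' T b, ?_⟩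
      have : QuotientGroup.mk' T t = 1 := (QuotientGroup.eq_one_iff t).2 ht
      rw [map_mul, this]
      exact (mul_one (QuotientGroup.mk (b ^ 2) : (𝓞 K)ˣ ⧸ T)).symm
    · rintro ⟨b, hb⟩
      obtain ⟨b, rfl⟩ := QuotientGroup.mk'_surjective T b
      have : QuotientGroup.mk' T (b ^ 2) = QuotientGroup.mk' T x := by
        rw [← hb]; simp [sq]
      have h3 := QuotientGroup.eq.1 this
      rw [Subgroup.mem_sup]
      exact ⟨b ^ 2, ⟨b, rfl⟩, _, h3, by group⟩
  have h3 : (sq ((𝓞 K)ˣ ⧸ T)).range.index = 2 ^ (Units.rank K) := by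
    have := AddSubgroup.index_range_nsmul (M := Additive ((𝓞 K)ˣ ⧸ T)) 2
    rw [Units.finrank_modTorsion] at this
    rw [← this]
    rfl
  rw [← Subgroup.relIndex_mul_index (le_sup_left : _ ≤ (sq (𝓞 K)ˣ).range ⊔ T), h1, h2,
    Subgroup.index_comap_of_surjective _ (QuotientGroup.mk'_surjective T), h3, ← pow_succ']
  congr 1
  have h4 := InfinitePlace.card_eq_nrRealPlaces_add_nrComplexPlaces (K := K)
  rw [IsTotallyReal.nrComplexPlaces_eq_zero, add_zero, ← IsTotallyReal.finrank] at h4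
  rw [Units.rank, h4]
  have := Module.finrank_pos (R := ℚ) (M := K)
  omega
end units
end S4

namespace S4
open nonZeroDivisors

theorem relIndex_zpowers_dvd {J : Type*} [CommGroup J] (H : Subgroup J) (x : J) (hx : x ^ 2 ∈ H) :
    H.relIndex (H ⊔ Subgroup.zpowers x) ∣ 2 := by
  rw [Subgroup.relIndex_sup_left]
  have h := Subgroup.relIndex_ker (K := Subgroup.zpowers x) (QuotientGroup.mk' H)
  rw [QuotientGroup.ker_mk', MonoidHom.map_zpowers, Nat.card_zpowers] at h
  rw [h]
  apply orderOf_dvd_of_pow_eq_one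
  rw [← map_pow]
  exact (QuotientGroup.eq_one_iff _).2 hx

theorem relIndex_closure_dvd {J ι : Type*} [CommGroup J] (H : Subgroup J) (x : ι → J)
    (S : Finset ι) (hx : ∀ i ∈ S, x i ^ 2 ∈ H) :
    H.relIndex (H ⊔ Subgroup.closure (x '' S)) ∣ 2 ^ S.card := by
  classical
  induction S using Finset.induction_on with
  | empty => simp
  | insert a S ha ih =>
    have e : H ⊔ Subgroup.closure (x '' ((insert a S : Finset ι) : Set ι)) =
        (H ⊔ Subgroup.closure (x '' S)) ⊔ Subgroup.zpowers (x a) := by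
      rw [Finset.coe_insert, Set.image_insert_eq, Set.insert_eq, Subgroup.closure_union,
        ← Subgroup.zpowers_eq_closure, sup_assoc, sup_comm (Subgroup.zpowers _)]
    rw [e, ← Subgroup.relIndex_mul_relIndex H (H ⊔ Subgroup.closure (x '' S)) _ le_sup_left le_sup_left, Finset.card_insert_of_notMem ha,
      pow_succ]
    apply mul_dvd_mul
    · exact ih fun i hi => hx i (Finset.mem_insert_of_mem hi)
    · apply relIndex_zpowers_dvd
      exact (le_sup_left : H ≤ _) (hx a (Finset.mem_insert_self _ _))

theorem even_relIndex {J : Type*} [CommGroup J] (H L : Subgroup J) (x : J) (hx : x ∈ L) (hx2 : x ^ 2 = 1)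
    (hxH : x ∉ H) : 2 ∣ H.relIndex L := by
  by_contra h
  apply hxH
  have h1 := Subgroup.pow_index_mem (H.subgroupOf L) (⟨x, hx⟩ : L)
  rw [Subgroup.mem_subgroupOf] at h1
  obtain ⟨k, hk⟩ : Odd (H.subgroupOf L).index := by
    rw [← Nat.not_even_iff_odd, even_iff_two_dvd]; exact h
  rw [hk] at h1
  simpa [pow_succ, pow_mul, hx2] using h1

section cl
variable {K : Type} [Field K] [NumberField K]

theorem cl_ker : (ClassGroup.mk (R := 𝓞 K) K).ker = (toPrincipalIdeal (𝓞 K) K).range := by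
  ext I
  obtain ⟨A, d, d0, hd, hA⟩ := frac_repr I
  have hpr : ∀ x : Kˣ, ClassGroup.mk (R := 𝓞 K) K (toPrincipalIdeal (𝓞 K) K x) = 1 := by
    intro x
    rw [ClassGroup.mk_eq_one_iff]
    refine ⟨(x : K), ?_⟩
    simp [FractionalIdeal.coe_spanSingleton]
  constructor
  · intro h
    rw [MonoidHom.mem_ker] at h
    have h2 : ClassGroup.mk0 A = 1 := by
      rw [← ClassGroup.mk_mk0 K, ← hA, map_mul, h, hpr, one_mul]
    rw [ClassGroup.mk0_eq_one_iff] at h2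
    obtain ⟨a, ha⟩ := h2
    have ha0 : a ≠ 0 := by
      rintro rfl
      apply ideal_ne_zero A
      rw [ha]; simp
    have ha0' : (a : K) ≠ 0 := by simpa using ha0
    have h3 : FractionalIdeal.mk0 K A = toPrincipalIdeal (𝓞 K) K (Units.mk0 (a : K) ha0') := by
      symm
      rw [toPrincipalIdeal_eq_iff, FractionalIdeal.coe_mk0, ha]
      simp [FractionalIdeal.coeIdeal_span_singleton]
    refine ⟨Units.mk0 (a : K) ha0' * d⁻¹, ?_⟩
    rw [map_mul, ← h3, ← hA, map_inv, mul_inv_cancel_right]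
  · rintro ⟨x, rfl⟩
    exact hpr x

theorem cl_surj : Function.Surjective (ClassGroup.mk (R := 𝓞 K) K) := by
  intro c
  induction c using cl_ind with
  | h I => exact ⟨_, ClassGroup.mk_mk0 K I⟩

theorem pr_index : (toPrincipalIdeal (𝓞 K) K).range.index = Nat.card (ClassGroup (𝓞 K)) := by
  rw [← cl_ker, Subgroup.index_ker, MonoidHom.range_eq_top.2 cl_surj]
  exact Nat.card_congr Subgroup.topEquiv.toEquiv
end cl

section quad
variable {K L : Type} [Field K] [Field L] [NumberField K] [NumberField L] [Algebra K L]
variable [Algebra.IsQuadraticExtension K L] (σ : L ≃ₐ[K] L) (hσ : σ ≠ 1)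

/-- extended fractional ideals -/
noncomputable abbrev JKs (K L : Type) [Field K] [Field L] [NumberField K] [NumberField L] [Algebra K L] :
    Subgroup (FractionalIdeal (𝓞 L)⁰ L)ˣ := (extU (algebraMap (𝓞 K) (𝓞 L)) alg_inj).range

theorem mk0_mem_JK {P : (Ideal (𝓞 L))⁰} (h : ∃ p : Ideal (𝓞 K), (P : Ideal (𝓞 L)) = p.map (algebraMap (𝓞 K) (𝓞 L))) :
    FractionalIdeal.mk0 L P ∈ JKs K L := by
  obtain ⟨p, hp⟩ := h
  have hp0 : p ∈ (Ideal (𝓞 K))⁰ := by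
    rw [mem_nonZeroDivisors_iff_ne_zero]
    rintro rfl
    apply ideal_ne_zero P
    rw [hp]; simp
  refine ⟨FractionalIdeal.mk0 K ⟨p, hp0⟩, ?_⟩
  rw [extU_mk0]
  congr 1
  exact Subtype.ext hp.symm

include hσ in
theorem stable_mem (S : Finset (Ideal (𝓞 L))⁰)
    (hS : ∀ P : (Ideal (𝓞 L))⁰, (P : Ideal (𝓞 L)).IsPrime → (P : Ideal (𝓞 L)).map (sI σ) = P →
      P ∈ S ∨ ∃ p : Ideal (𝓞 K), (P : Ideal (𝓞 L)) = p.map (algebraMap (𝓞 K) (𝓞 L)))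
    (H : Subgroup (FractionalIdeal (𝓞 L)⁰ L)ˣ) (h1 : JKs K L ≤ H)
    (h2 : ∀ P ∈ S, FractionalIdeal.mk0 L P ∈ H) :
    ∀ n : ℕ, ∀ A : (Ideal (𝓞 L))⁰, Ideal.absNorm (A : Ideal (𝓞 L)) ≤ n → (A : Ideal (𝓞 L)).map (sI σ) = A →
      FractionalIdeal.mk0 L A ∈ H := by
  intro n
  induction n with
  | zero =>
    intro A hA
    exfalso
    apply ideal_ne_zero A
    rw [← Ideal.absNorm_eq_zero_iff]; omega
  | succ n ih =>
    intro A hA hs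
    by_cases htop : (A : Ideal (𝓞 L)) = ⊤
    · have : A = 1 := Subtype.ext (by rw [htop]; exact Ideal.one_eq_top.symm)
      rw [this, map_one]; exact one_mem _
    have key : ∀ C : (Ideal (𝓞 L))⁰, (C : Ideal (𝓞 L)) ∣ A → (C : Ideal (𝓞 L)) ≠ ⊤ →
        (C : Ideal (𝓞 L)).map (sI σ) = C → FractionalIdeal.mk0 L C ∈ H → FractionalIdeal.mk0 L A ∈ H := by
      intro C hC hCt hCs hCH
      obtain ⟨B, hB⟩ := hC
      have hB0 : B ∈ (Ideal (𝓞 L))⁰ := by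
        rw [mem_nonZeroDivisors_iff_ne_zero]
        rintro rfl
        apply ideal_ne_zero A
        rw [hB]; simp
      have hA2 : A = C * ⟨B, hB0⟩ := Subtype.ext hB
      rw [hA2, map_mul]
      refine mul_mem hCH (ih _ ?_ ?_)
      · have e1 : Ideal.absNorm (A : Ideal (𝓞 L)) = Ideal.absNorm (C : Ideal (𝓞 L)) * Ideal.absNorm B := by
          rw [hB, map_mul]
        have e2 : Ideal.absNorm (C : Ideal (𝓞 L)) ≠ 1 := by
          rw [Ne, Ideal.absNorm_eq_one_iff]; exact hCt
        have e3 : Ideal.absNorm (A : Ideal (𝓞 L)) ≠ 0 := by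
          rw [Ne, Ideal.absNorm_eq_zero_iff]; exact ideal_ne_zero A
        have e4 : Ideal.absNorm (C : Ideal (𝓞 L)) ≠ 0 := by
          intro h; rw [h, zero_mul] at e1; exact e3 e1
        have e5 : Ideal.absNorm B ≠ 0 := by
          intro h; rw [h, mul_zero] at e1; exact e3 e1
        have e6 : 2 ≤ Ideal.absNorm (C : Ideal (𝓞 L)) := by omega
        have e7 : 1 ≤ Ideal.absNorm B := by omega
        change Ideal.absNorm B ≤ n
        nlinarith
      · rw [hB, Ideal.map_mul, hCs] at hs
        exact mul_left_cancel₀ (ideal_ne_zero C) hs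
    obtain ⟨P, hPm, hPA⟩ := Ideal.exists_le_maximal _ htop
    have hP0 : P ∈ (Ideal (𝓞 L))⁰ := by
      rw [mem_nonZeroDivisors_iff_ne_zero]
      rintro rfl
      exact ideal_ne_zero A (le_bot_iff.1 hPA)
    have hPp : P.IsPrime := hPm.isPrime
    by_cases hPs : P.map (sI σ) = P
    · apply key ⟨P, hP0⟩ (Ideal.dvd_iff_le.2 hPA) hPm.ne_top hPs
      rcases hS ⟨P, hP0⟩ hPp hPs with h | h
      · exact h2 _ h
      · exact h1 (mk0_mem_JK h)
    · have hQp : (P.map (sI σ)).IsPrime := isPrime_map_sI σ P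
      have hP0' : P ≠ ⊥ := ideal_ne_zero ⟨P, hP0⟩
      have hQ0 : P.map (sI σ) ≠ ⊥ := by
        rw [Ne, Ideal.map_eq_bot_iff_of_injective (sI_inj σ)]; exact hP0'
      have hQm : (P.map (sI σ)).IsMaximal := hQp.isMaximal hQ0
      have hC0 : P * P.map (sI σ) ∈ (Ideal (𝓞 L))⁰ := by
        rw [mem_nonZeroDivisors_iff_ne_zero]; exact mul_ne_zero hP0' hQ0
      apply key ⟨P * P.map (sI σ), hC0⟩
      · rw [Ideal.dvd_iff_le]
        have hcop : IsCoprime P (P.map (sI σ)) := by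
          rw [Ideal.isCoprime_iff_sup_eq]
          exact hPm.coprime_of_ne hQm (Ne.symm hPs)
        change _ ≤ P * P.map (sI σ)
        rw [Ideal.mul_eq_inf_of_isCoprime hcop]
        refine le_inf hPA ?_
        rw [← hs]; exact Ideal.map_mono hPA
      · intro h
        apply hPm.ne_top
        rw [← top_le_iff, ← h]
        exact Ideal.mul_le_right (I := P.map (sI σ)) (J := P) |> fun h => (mul_comm P _).le.trans h
      · change (P * P.map (sI σ)).map (sI σ) = _
        rw [Ideal.map_mul, map_sI_comp, gal_sq σ hσ, map_sI_one, mul_comm]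
      · apply h1
        apply mk0_mem_JK
        exact ⟨_, (map_relNorm_eq σ hσ P hP0').symm⟩

/-- Galois action on nonzero elements -/
noncomputable abbrev sM (σ : L ≃ₐ[K] L) : Lˣ →* Lˣ := Units.map ((σ : L →ₐ[K] L) : L →* L)
/-- Galois action on units -/
noncomputable abbrev sE (σ : L ≃ₐ[K] L) : (𝓞 L)ˣ →* (𝓞 L)ˣ := Units.map (sI σ : 𝓞 L →* 𝓞 L)
/-- Galois action on fractional ideals -/
noncomputable abbrev sJ (σ : L ≃ₐ[K] L) : (FractionalIdeal (𝓞 L)⁰ L)ˣ →* (FractionalIdeal (𝓞 L)⁰ L)ˣ :=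
  extU (sI σ) (sI_inj σ)
/-- Galois action on the class group -/
noncomputable abbrev sC (σ : L ≃ₐ[K] L) : ClassGroup (𝓞 L) →* ClassGroup (𝓞 L) :=
  clMap (sI σ) (sI_inj σ)

theorem sJ_pr (a : Lˣ) : toPrincipalIdeal (𝓞 L) L (sM σ a) = sJ σ (toPrincipalIdeal (𝓞 L) L a) :=
  (extU_pr (sI σ) (sI_inj σ) ((σ : L →ₐ[K] L) : L →+* L) (fun _ => rfl) a).symm

theorem extU_pr' (a : Kˣ) : extU (algebraMap (𝓞 K) (𝓞 L)) alg_inj (toPrincipalIdeal (𝓞 K) K a) =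
    toPrincipalIdeal (𝓞 L) L (Units.map (algebraMap K L : K →* L) a) :=
  extU_pr _ _ (algebraMap K L) (fun _ => rfl) a

theorem mk_sJ (I : (FractionalIdeal (𝓞 L)⁰ L)ˣ) :
    ClassGroup.mk (R := 𝓞 L) L (sJ σ I) = sC σ (ClassGroup.mk (R := 𝓞 L) L I) := by
  have : (ClassGroup.mk (R := 𝓞 L) L).comp (sJ σ) = (sC σ).comp (ClassGroup.mk (R := 𝓞 L) L) := by
    apply frac_ext
    intro A
    rw [MonoidHom.comp_apply, MonoidHom.comp_apply, extU_mk0, ClassGroup.mk_mk0, ClassGroup.mk_mk0,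
      clMap_mk0]
  exact DFunLike.congr_fun this I

include hσ in
theorem sJ_sJ (I : (FractionalIdeal (𝓞 L)⁰ L)ˣ) : sJ σ (sJ σ I) = I := by
  have : (sJ σ).comp (sJ σ) = MonoidHom.id _ := by
    apply frac_ext
    intro A
    rw [MonoidHom.comp_apply, extU_mk0, extU_mk0]
    change _ = FractionalIdeal.mk0 L A
    congr 1
    apply Subtype.ext
    rw [coe_idMap, coe_idMap, map_sI_comp, gal_sq σ hσ, map_sI_one]
  exact DFunLike.congr_fun this I

include hσ in
theorem fixM_mem {a : Lˣ} (ha : sM σ a = a) : ∃ b : Kˣ, Units.map (algebraMap K L : K →* L) b = a := by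
  obtain ⟨y, hy⟩ := fix_field σ hσ (x := (a : L)) (congrArg Units.val ha)
  have hy0 : y ≠ 0 := by
    rintro rfl
    rw [map_zero] at hy
    exact a.ne_zero hy.symm
  exact ⟨Units.mk0 y hy0, Units.ext hy⟩

include hσ in
theorem fixE_eq : fixS (sE σ) = (Units.map (algebraMap (𝓞 K) (𝓞 L) : 𝓞 K →* 𝓞 L)).range := by
  ext u
  rw [mem_fixS]
  constructor
  · intro h
    have h1 : sI σ (u : 𝓞 L) = u := congrArg Units.val h
    have h2 : sI σ ((u⁻¹ : (𝓞 L)ˣ) : 𝓞 L) = (u⁻¹ : (𝓞 L)ˣ) := by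
      have := congrArg Units.val (congrArg (fun x => x⁻¹) h)
      rw [← map_inv] at this
      exact this
    obtain ⟨y, hy⟩ := fix_int σ hσ h1
    obtain ⟨z, hz⟩ := fix_int σ hσ h2
    have hyz : y * z = 1 := by
      apply alg_inj (K := K) (L := L)
      rw [map_mul, hy, hz, map_one, Units.mul_inv]
    exact ⟨⟨y, z, hyz, by rw [mul_comm, hyz]⟩, Units.ext hy⟩
  · rintro ⟨v, rfl⟩
    exact Units.ext (sI_alg σ (v : 𝓞 K))

include hσ in
theorem chevalley [IsTotallyReal K] [IsTotallyReal L] (S : Finset (Ideal (𝓞 L))⁰)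
    (hS : ∀ P : (Ideal (𝓞 L))⁰, (P : Ideal (𝓞 L)).IsPrime → (P : Ideal (𝓞 L)).map (sI σ) = P →
      P ∈ S ∨ ∃ p : Ideal (𝓞 K), (P : Ideal (𝓞 L)) = p.map (algebraMap (𝓞 K) (𝓞 L)))
    (hS2 : ∀ P ∈ S, (P : Ideal (𝓞 L)).map (sI σ) = P) :
    ∃ m : ℕ, Nat.card (fixS (sC σ)) * (2 * m) ∣ 2 ^ S.card * Nat.card (ClassGroup (𝓞 K)) ∧
      ((∀ a : L, a * σ a ≠ -1) → 2 ∣ m) := by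
  obtain ⟨φ⟩ := exists_real_emb (K := L)
  have hui := unit_index (sE σ) (fun x => Units.ext (sI_sI σ hσ x)) (-1)
    (Units.ext (by simp)) (unit_neg_ne φ) (by simp)
    (fun x hx => unit_tors φ x 2 (by norm_num) hx) (unit_sq_ne φ) (2 ^ Module.finrank ℚ K)
    (by positivity)
    (by
      rw [fixE_eq σ hσ, ← MonoidHom.range_comp]
      have : (sq (𝓞 L)ˣ).comp (Units.map (algebraMap (𝓞 K) (𝓞 L) : 𝓞 K →* 𝓞 L)) =
          (Units.map (algebraMap (𝓞 K) (𝓞 L) : 𝓞 K →* 𝓞 L)).comp (sq (𝓞 K)ˣ) := by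
        ext x; simp
      rw [this, MonoidHom.range_comp, MonoidHom.range_eq_map (Units.map _),
        Subgroup.relIndex_map_map_of_injective, Subgroup.relIndex_top_right, sq_index]
      intro u v h
      exact Units.ext (alg_inj (congrArg Units.val h)))
    (by
      rw [sq_index, ← pow_mul, ← Module.finrank_mul_finrank ℚ K L,
        Algebra.IsQuadraticExtension.finrank_eq_two K L])
  set U : Subgroup (𝓞 L)ˣ := (nm (sM σ)).range.comap (Units.map (algebraMap (𝓞 L) L : 𝓞 L →* L)) with hU
  have hMJ : (fixS (sM σ)).map (toPrincipalIdeal (𝓞 L) L) =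
      (toPrincipalIdeal (𝓞 K) K).range.map (extU (algebraMap (𝓞 K) (𝓞 L)) alg_inj) := by
    ext I
    constructor
    · rintro ⟨a, ha, rfl⟩
      obtain ⟨b, rfl⟩ := fixM_mem σ hσ ha
      exact ⟨_, ⟨b, rfl⟩, extU_pr' b⟩
    · rintro ⟨_, ⟨b, rfl⟩, rfl⟩
      exact ⟨Units.map (algebraMap K L : K →* L) b, Units.ext (σ.commutes _), (extU_pr' b).symm⟩
  have hJfix : JKs K L ≤ fixS (sJ σ) := by
    rintro _ ⟨I, rfl⟩
    rw [mem_fixS]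
    have : (sJ σ).comp (extU (algebraMap (𝓞 K) (𝓞 L)) alg_inj) =
      extU (algebraMap (𝓞 K) (𝓞 L)) alg_inj := by
      apply frac_ext
      intro A
      rw [MonoidHom.comp_apply, extU_mk0, extU_mk0]
      congr 1
      apply Subtype.ext
      rw [coe_idMap, coe_idMap, map_sI_map_alg]
    exact DFunLike.congr_fun this I
  have hmain := chev_abstract (sE σ) (sM σ) (sJ σ) (Units.map (algebraMap (𝓞 L) L : 𝓞 L →* L))
    (toPrincipalIdeal (𝓞 L) L) (fun u v h => Units.ext (RingOfIntegers.ext (congrArg Units.val h)))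
    (fun _ => Units.ext rfl) (sJ_pr σ) (fun x => Units.ext (sig_sig σ hσ x)) (sJ_sJ σ hσ)
    pr_eq_one_iff
    (fun a ha => by
      obtain ⟨b, hb⟩ := hilb90 σ hσ a (congrArg Units.val ha)
      refine ⟨b, Units.ext ?_⟩
      rw [hb]; simp)
    (JKs K L) ((fixS (sC σ)).comap (ClassGroup.mk (R := 𝓞 L) L))
    hJfix
    (by
      rw [hMJ]
      rintro _ ⟨I, -, rfl⟩
      exact ⟨I, rfl⟩)
    (by
      intro I
      rw [Subgroup.mem_comap, mem_fixS, ← mk_sJ, ← mul_inv_eq_one, ← map_inv, ← map_mul,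
        ← MonoidHom.mem_ker, cl_ker]
      constructor
      · rintro ⟨a, ha⟩
        refine ⟨a, ?_⟩
        rw [ha]; simp
      · rintro ⟨a, ha⟩
        refine ⟨a, ?_⟩
        rw [ha]; simp)
    U (by
      intro u
      constructor
      · rintro ⟨a, ha⟩
        exact ⟨a, ha.symm⟩
      · rintro ⟨a, ha⟩
        exact ⟨a, ha.symm⟩)
    hui.2 hui.1
  refine ⟨U.relIndex (fixS (sE σ)), ?_, ?_⟩
  · rw [← cl_ker, Subgroup.relIndex_ker, Subgroup.map_comap_eq_self_of_surjective cl_surj] at hmain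
    refine hmain.trans (mul_dvd_mul ?_ ?_)
    · set H := JKs K L ⊔ Subgroup.closure ((fun P => FractionalIdeal.mk0 L P) '' (S : Set (Ideal (𝓞 L))⁰))
      have hle : fixS (sJ σ) ≤ H := by
        intro I hI
        rw [mem_fixS] at hI
        obtain ⟨A, d, d0, hd, hA⟩ := frac_repr I
        have hd0 : sI σ d0 ≠ 0 := by
          intro h
          rw [map_eq_zero_iff _ (sI_inj σ)] at h
          apply d.ne_zero
          rw [hd, h]; simp
        have hd1 : Ideal.span {sI σ d0} ∈ (Ideal (𝓞 L))⁰ := by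
          rw [mem_nonZeroDivisors_iff_ne_zero]; simpa using hd0
        have e1 : toPrincipalIdeal (𝓞 L) L (sM σ d) = FractionalIdeal.mk0 L ⟨_, hd1⟩ := by
          rw [toPrincipalIdeal_eq_iff, FractionalIdeal.coe_mk0]
          simp only [FractionalIdeal.coeIdeal_span_singleton]
          congr 1
          change σ (d : L) = _
          rw [hd]; rfl
        have e2 : I * toPrincipalIdeal (𝓞 L) L (d * sM σ d) =
            FractionalIdeal.mk0 L (A * ⟨_, hd1⟩) := by
          rw [map_mul, map_mul, ← e1, ← hA, mul_assoc]
        have e3 : toPrincipalIdeal (𝓞 L) L (d * sM σ d) ∈ H := by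
          have hf : sM σ (d * sM σ d) = d * sM σ d := by
            apply Units.ext
            change σ ((d : L) * σ d) = d * σ d
            rw [map_mul, sig_sig σ hσ, mul_comm]
          obtain ⟨b, hb⟩ := fixM_mem σ hσ hf
          rw [← hb, ← extU_pr']
          exact (le_sup_left : _ ≤ H) ⟨_, rfl⟩
        have e4 : FractionalIdeal.mk0 L (A * ⟨_, hd1⟩) ∈ H := by
          refine stable_mem σ hσ S hS H le_sup_left ?_ _ _ le_rfl ?_
          · intro P hP
            exact (le_sup_right : _ ≤ H) (Subgroup.subset_closure ⟨P, hP, rfl⟩)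
          · have hf : sJ σ (FractionalIdeal.mk0 L (A * ⟨_, hd1⟩)) = FractionalIdeal.mk0 L (A * ⟨_, hd1⟩) := by
              rw [← e2, map_mul, hI, ← sJ_pr]
              congr 2
              apply Units.ext
              change σ ((d : L) * σ d) = d * σ d
              rw [map_mul, sig_sig σ hσ, mul_comm]
            rw [extU_mk0] at hf
            have := congrArg Units.val hf
            rw [FractionalIdeal.coe_mk0, FractionalIdeal.coe_mk0] at this
            exact FractionalIdeal.coeIdeal_injective this
        rw [← e2] at e4
        exact (mul_mem_cancel_right e3).1 e4
      refine (Dvd.intro _ (Subgroup.relIndex_mul_relIndex _ _ _ hJfix hle)).trans ?_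
      apply relIndex_closure_dvd
      intro P hP
      rw [← map_pow]
      apply mk0_mem_JK
      refine ⟨Ideal.relNorm (𝓞 K) (P : Ideal (𝓞 L)), ?_⟩
      rw [map_relNorm_eq σ hσ _ (ideal_ne_zero P), hS2 P hP, pow_two]; rfl
    · rw [hMJ, JKs, MonoidHom.range_eq_map (extU _ _), Subgroup.relIndex_map_map, ← pr_index, top_sup_eq,
        Subgroup.relIndex_top_right]
      exact Subgroup.index_dvd_of_le le_sup_left
  · intro hn
    apply even_relIndex _ _ (-1) _ (by simp)
    · rintro ⟨a, ha⟩
      apply hn (a : L)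
      have := congrArg Units.val ha
      rw [nm_apply] at this
      simpa using this
    · rw [mem_fixS]; exact Units.ext (by simp)
end quad
end S4

namespace S4
open nonZeroDivisors

section gen
variable {K L : Type} [Field K] [Field L] [NumberField K] [NumberField L] [Algebra K L]

/-- extension of classes -/
noncomputable abbrev jC (K L : Type) [Field K] [Field L] [NumberField K] [NumberField L] [Algebra K L] :
    ClassGroup (𝓞 K) →* ClassGroup (𝓞 L) := clMap (algebraMap (𝓞 K) (𝓞 L)) alg_inj

/-- norm of ideals -/
noncomputable def idN (K L : Type) [Field K] [Field L] [NumberField K] [NumberField L] [Algebra K L] :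
    (Ideal (𝓞 L))⁰ →* (Ideal (𝓞 K))⁰ where
  toFun I := ⟨Ideal.relNorm (𝓞 K) (I : Ideal (𝓞 L)), by
    rw [mem_nonZeroDivisors_iff_ne_zero, Ne, Ideal.zero_eq_bot, Ideal.relNorm_eq_bot_iff]
    exact ideal_ne_zero I⟩
  map_one' := by ext1; simp
  map_mul' I J := by ext1; simp

theorem coe_idN (I : (Ideal (𝓞 L))⁰) : (idN K L I : Ideal (𝓞 K)) = Ideal.relNorm (𝓞 K) (I : Ideal (𝓞 L)) := rfl

/-- norm of classes -/
noncomputable def rC (K L : Type) [Field K] [Field L] [NumberField K] [NumberField L] [Algebra K L] :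
    ClassGroup (𝓞 L) →* ClassGroup (𝓞 K) :=
  clLift (ClassGroup.mk0.comp (idN K L)) (by
    intro x h
    rw [MonoidHom.comp_apply, ClassGroup.mk0_eq_one_iff, coe_idN, Ideal.relNorm_singleton]
    exact ⟨_, rfl⟩)

theorem rC_mk0 (I : (Ideal (𝓞 L))⁰) : rC K L (ClassGroup.mk0 I) = ClassGroup.mk0 (idN K L I) :=
  clLift_mk0 _ _ _

theorem rC_sC (σ : L ≃ₐ[K] L) (c : ClassGroup (𝓞 L)) : rC K L (sC σ c) = rC K L c := by
  induction c using cl_ind with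
  | h I =>
    rw [clMap_mk0, rC_mk0, rC_mk0]
    congr 1
    apply Subtype.ext
    rw [coe_idN, coe_idN, coe_idMap]
    exact Ideal.relNorm_map_algEquiv (RingOfIntegers.mapAlgEquiv σ : 𝓞 L ≃ₐ[𝓞 K] 𝓞 L) (I : Ideal (𝓞 L))

theorem sC_sC (σ τ : L ≃ₐ[K] L) (c : ClassGroup (𝓞 L)) : sC σ (sC τ c) = sC (σ * τ) c := by
  induction c using cl_ind with
  | h I =>
    rw [clMap_mk0, clMap_mk0, clMap_mk0]
    congr 1
    apply Subtype.ext
    rw [coe_idMap, coe_idMap, coe_idMap, map_sI_comp]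

theorem sC_one (c : ClassGroup (𝓞 L)) : sC (1 : L ≃ₐ[K] L) c = c := by
  induction c using cl_ind with
  | h I =>
    rw [clMap_mk0]
    congr 1
    apply Subtype.ext
    rw [coe_idMap, map_sI_one]

end gen

section quad
variable {K L : Type} [Field K] [Field L] [NumberField K] [NumberField L] [Algebra K L]
variable [Algebra.IsQuadraticExtension K L] (σ : L ≃ₐ[K] L) (hσ : σ ≠ 1)
include hσ

theorem jC_rC (c : ClassGroup (𝓞 L)) : jC K L (rC K L c) = c * sC σ c := by
  induction c using cl_ind with
  | h I =>
    rw [rC_mk0, clMap_mk0, clMap_mk0, ← map_mul]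
    congr 1
    apply Subtype.ext
    rw [coe_idMap, coe_idN, map_relNorm_eq σ hσ _ (ideal_ne_zero I)]
    rfl

theorem primes_over {P Q : Ideal (𝓞 L)} (hP : P.IsPrime) (hP0 : P ≠ ⊥) (hQ : Q.IsPrime)
    (h : P.comap (algebraMap (𝓞 K) (𝓞 L)) ≤ Q.comap (algebraMap (𝓞 K) (𝓞 L))) :
    Q = P ∨ Q = P.map (sI σ) := by
  have h1 : P * P.map (sI σ) ≤ Q := by
    rw [← map_relNorm_eq σ hσ P hP0, Ideal.map_le_iff_le_comap]
    exact (Ideal.relNorm_le_comap (𝓞 K) P).trans h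
  have hs0 : P.map (sI σ) ≠ ⊥ := by
    rw [Ne, Ideal.map_eq_bot_iff_of_injective (sI_inj σ)]; exact hP0
  have hsp := isPrime_map_sI σ P
  rcases hQ.mul_le.1 h1 with h2 | h2
  · left; exact ((hP.isMaximal hP0).eq_of_le hQ.ne_top h2).symm
  · right; exact ((hsp.isMaximal hs0).eq_of_le hQ.ne_top h2).symm

theorem stable_prime {P : Ideal (𝓞 L)} (hP : P.IsPrime) (hP0 : P ≠ ⊥) (hs : P.map (sI σ) = P) :
    (∃ p : Ideal (𝓞 K), P = p.map (algebraMap (𝓞 K) (𝓞 L))) ∨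
    (P ^ 2 = (P.comap (algebraMap (𝓞 K) (𝓞 L))).map (algebraMap (𝓞 K) (𝓞 L)) ∧ ∀ x, sI σ x - x ∈ P) := by
  set p := P.comap (algebraMap (𝓞 K) (𝓞 L)) with hp
  have hpp : p.IsPrime := Ideal.comap_isPrime _ _
  haveI : P.LiesOver p := ⟨rfl⟩
  obtain ⟨s, hps⟩ := Ideal.exists_relNorm_eq_pow_of_isPrime P p
  have h1 : P ^ 2 = (p.map (algebraMap (𝓞 K) (𝓞 L))) ^ s := by
    rw [← Ideal.map_pow, ← hps, map_relNorm_eq σ hσ P hP0, hs, pow_two]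
  have hle : p.map (algebraMap (𝓞 K) (𝓞 L)) ≤ P := Ideal.map_comap_le
  have hPprime : Prime P := Ideal.prime_of_isPrime hP0 hP
  have hs0 : s ≠ 0 := by
    rintro rfl
    rw [pow_zero] at h1
    exact hPprime.not_isUnit ((isUnit_pow_iff (two_ne_zero)).1 (by rw [h1]; exact isUnit_one))
  have hdvd : p.map (algebraMap (𝓞 K) (𝓞 L)) ∣ P ^ 2 := by
    rw [h1]; exact dvd_pow_self _ hs0
  obtain ⟨i, hi, ha⟩ := (dvd_prime_pow hPprime 2).1 hdvd
  rw [associated_iff_eq] at ha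
  interval_cases i
  · exfalso
    rw [pow_zero, Ideal.one_eq_top] at ha
    rw [ha] at hle
    exact hP.ne_top (top_le_iff.1 hle)
  · left; exact ⟨p, by rw [ha, pow_one]⟩
  · right
    refine ⟨ha.symm, ?_⟩
    rw [ha, ← pow_mul] at h1
    have hs1 : s = 1 := by
      have hPu : ¬ IsUnit P := hPprime.not_isUnit
      have := (pow_inj_of_not_isUnit hPu hP0).1 h1
      omega
    rw [hs1, pow_one] at hps
    have hn : Ideal.absNorm p = Ideal.absNorm P := by
      rw [← hps, Ideal.absNorm_relNorm]
    have hsurj : Function.Surjective (Ideal.quotientMap P (algebraMap (𝓞 K) (𝓞 L)) le_rfl : 𝓞 K ⧸ p →+* 𝓞 L ⧸ P) := by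
      haveI : Finite (𝓞 L ⧸ P) := Ideal.finiteQuotientOfFreeOfNeBot P hP0
      apply ((Nat.bijective_iff_injective_and_card _).2 ⟨?_, ?_⟩).2
      · exact Ideal.quotientMap_injective
      · rw [Ideal.absNorm_apply, Ideal.absNorm_apply, Submodule.cardQuot_apply, Submodule.cardQuot_apply] at hn
        exact hn
    intro x
    obtain ⟨y, hy⟩ := hsurj (Ideal.Quotient.mk P x)
    obtain ⟨y, rfl⟩ := Ideal.Quotient.mk_surjective y
    rw [Ideal.quotientMap_mk] at hy
    have hy2 : algebraMap (𝓞 K) (𝓞 L) y - x ∈ P := (Ideal.Quotient.mk_eq_mk_iff_sub_mem _ _).1 hy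
    have hy3 : sI σ (algebraMap (𝓞 K) (𝓞 L) y - x) ∈ P := by
      rw [← hs]; exact Ideal.mem_map_of_mem _ hy2
    rw [map_sub, sI_alg] at hy3
    have := P.sub_mem hy2 hy3
    convert this using 1
    ring

theorem stable_prime_ram {P : Ideal (𝓞 L)} (hP : P.IsPrime) (hP0 : P ≠ ⊥) (hs : P.map (sI σ) = P)
    (α : 𝓞 L) (hα : σ (α : L) = - α) :
    (∃ p : Ideal (𝓞 K), P = p.map (algebraMap (𝓞 K) (𝓞 L))) ∨ 2 * α ∈ P := by
  rcases stable_prime σ hσ hP hP0 hs with h | ⟨-, h⟩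
  · exact Or.inl h
  · right
    have h1 := h α
    have h2 : sI σ α = - α := RingOfIntegers.ext hα
    rw [h2] at h1
    have := P.neg_mem h1
    convert this using 1
    ring
end quad
end S4

namespace S4
open nonZeroDivisors

section gf
variable (l : ℕ) [hl : Fact l.Prime] (d : ℤ)

/-- the local genus symbol at `l` of a positive integer, for the discriminant-like number `l*d` -/
noncomputable def gf (A : ℕ) : ℤ :=
  legendreSym l ((A / l ^ A.factorization l : ℕ) : ℤ) * legendreSym l d ^ (A.factorization l)

theorem gf_mul {A B : ℕ} (hA : A ≠ 0) (hB : B ≠ 0) : gf l d (A * B) = gf l d A * gf l d B := by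
  unfold gf
  rw [Nat.ordCompl_mul, Nat.factorization_mul hA hB, Finsupp.add_apply, pow_add, Nat.cast_mul,
    legendreSym.mul]
  ring

theorem gf_not_dvd {A : ℕ} (hA : ¬ l ∣ A) : gf l d A = legendreSym l A := by
  unfold gf
  rw [Nat.factorization_eq_zero_of_not_dvd hA]; simp

theorem gf_self : gf l d l = legendreSym l d := by
  unfold gf
  rw [hl.out.factorization_self]
  simp [Nat.div_self hl.out.pos, legendreSym.at_one]

theorem leg_sq {d : ℤ} (hd : ¬ (l : ℤ) ∣ d) : legendreSym l d ^ 2 = 1 := by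
  apply legendreSym.sq_one
  rwa [Ne, ZMod.intCast_zmod_eq_zero_iff_dvd]

variable (hd : ¬ (l : ℤ) ∣ d)
include hd

theorem gf_sq {A : ℕ} (hA : A ≠ 0) : gf l d A * gf l d A = 1 := by
  unfold gf
  have h1 := leg_sq l hd
  have h2 := leg_sq l (d := ((A / l ^ A.factorization l : ℕ) : ℤ))
    (by rw [Int.natCast_dvd_natCast]; exact Nat.not_dvd_ordCompl hl.out hA)
  have h3 : (legendreSym l d ^ (A.factorization l)) ^ 2 = 1 := by
    rw [← pow_mul, mul_comm, pow_mul, h1, one_pow]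
  calc _ = (legendreSym l ((A / l ^ A.factorization l : ℕ) : ℤ)) ^ 2 * (legendreSym l d ^ (A.factorization l)) ^ 2 := by ring
    _ = 1 := by rw [h2, h3, one_mul]

variable (hl4 : l % 4 = 1)
include hl4

omit hd in
theorem leg_neg (a : ℤ) : legendreSym l (-a) = legendreSym l a := by
  have h2 : l ≠ 2 := by rintro rfl; omega
  rw [legendreSym.at_neg h2, ZMod.χ₄_nat_one_mod_four hl4, one_mul]

omit hd in
theorem leg_natAbs (a : ℤ) : legendreSym l (a.natAbs : ℤ) = legendreSym l a := by
  rcases Int.natAbs_eq a with h | h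
  · rw [← h]
  · conv_rhs => rw [h, leg_neg l hl4]

omit hd hl4 in
theorem leg_congr {a b c : ℤ} (h : a = b + l * c) : legendreSym l a = legendreSym l b := by
  rw [legendreSym.mod l a, legendreSym.mod l b, h, Int.add_mul_emod_self_left]

theorem gf_norm (N : ℕ) : ∀ x y : ℤ, x.natAbs + y.natAbs ≤ N → (x ≠ 0 ∨ y ≠ 0) →
    (x ^ 2 - l * d * y ^ 2).natAbs ≠ 0 ∧ gf l d (x ^ 2 - l * d * y ^ 2).natAbs = 1 := by
  have hlp : Prime (l : ℤ) := Nat.prime_iff_prime_int.1 hl.out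
  have hl1 : 1 < l := hl.out.one_lt
  induction N with
  | zero => intro x y h h0; omega
  | succ N ih =>
    intro x y h h0
    by_cases hx : (l : ℤ) ∣ x
    · obtain ⟨x', rfl⟩ := hx
      by_cases hy : (l : ℤ) ∣ y
      · obtain ⟨y', rfl⟩ := hy
        have e : ((l * x') ^ 2 - l * d * (l * y') ^ 2).natAbs = l * l * (x' ^ 2 - l * d * y' ^ 2).natAbs := by
          rw [show (l * x') ^ 2 - l * d * (l * y') ^ 2 = ((l * l : ℕ) : ℤ) * (x' ^ 2 - l * d * y' ^ 2) by push_cast; ring,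
            Int.natAbs_mul, Int.natAbs_natCast]
        have h0' : x' ≠ 0 ∨ y' ≠ 0 := by
          rcases h0 with h | h
          · left; rintro rfl; simp at h
          · right; rintro rfl; simp at h
        have hb : x'.natAbs + y'.natAbs ≤ N := by
          rw [Int.natAbs_mul, Int.natAbs_mul, Int.natAbs_natCast] at h
          have : 0 < x'.natAbs + y'.natAbs := by omega
          nlinarith
        obtain ⟨i1, i2⟩ := ih x' y' hb h0'
        rw [e]
        have hll : l * l ≠ 0 := by positivity
        refine ⟨mul_ne_zero hll i1, ?_⟩
        rw [gf_mul l d hll i1, gf_mul l d hl.out.ne_zero hl.out.ne_zero, gf_sq l d hd hl.out.ne_zero, i2, one_mul]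
      · have e : ((l * x') ^ 2 - l * d * y ^ 2).natAbs = l * (l * x' ^ 2 - d * y ^ 2).natAbs := by
          rw [show (l * x') ^ 2 - l * d * y ^ 2 = (l : ℤ) * (l * x' ^ 2 - d * y ^ 2) by ring,
            Int.natAbs_mul, Int.natAbs_natCast]
        have hnd : ¬ (l : ℤ) ∣ (l * x' ^ 2 - d * y ^ 2) := by
          intro h
          have : (l : ℤ) ∣ d * y ^ 2 := (dvd_sub_right (dvd_mul_right _ _)).1 h
          rcases hlp.dvd_or_dvd this with h | h
          · exact hd h
          · exact hy (hlp.dvd_of_dvd_pow h)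
        have hnd' : ¬ l ∣ (l * x' ^ 2 - d * y ^ 2).natAbs := by rwa [← Int.natCast_dvd]
        have h0 : (l * x' ^ 2 - d * y ^ 2).natAbs ≠ 0 := by intro h; rw [h] at hnd'; exact hnd' (dvd_zero _)
        rw [e]
        refine ⟨mul_ne_zero hl.out.ne_zero h0, ?_⟩
        rw [gf_mul l d hl.out.ne_zero h0, gf_self, gf_not_dvd l d hnd', leg_natAbs l hl4,
          leg_congr l (a := l * x' ^ 2 - d * y ^ 2) (b := -(d * y ^ 2)) (c := x' ^ 2) (by ring), leg_neg l hl4, legendreSym.mul,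
          legendreSym.sq_one', mul_one, ← pow_two, leg_sq l hd]
        rwa [Ne, ZMod.intCast_zmod_eq_zero_iff_dvd]
    · have hnd : ¬ (l : ℤ) ∣ (x ^ 2 - l * d * y ^ 2) := by
        intro h
        have : (l : ℤ) ∣ x ^ 2 := (dvd_sub_left (by rw [mul_assoc]; exact dvd_mul_right _ _)).1 h
        exact hx (hlp.dvd_of_dvd_pow this)
      have hnd' : ¬ l ∣ (x ^ 2 - l * d * y ^ 2).natAbs := by rwa [← Int.natCast_dvd]
      refine ⟨by intro h; rw [h] at hnd'; exact hnd' (dvd_zero _), ?_⟩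
      rw [gf_not_dvd l d hnd', leg_natAbs l hl4,
          leg_congr l (a := x ^ 2 - l * d * y ^ 2) (b := x ^ 2) (c := - d * y ^ 2) (by ring), legendreSym.sq_one']
      rwa [Ne, ZMod.intCast_zmod_eq_zero_iff_dvd]

end gf

section ram
variable {F : Type} [Field F] [NumberField F]

/-- the explicit ramified prime -/
noncomputable def rp (p : ℕ) (a : 𝓞 F) : Ideal (𝓞 F) := Ideal.span {(p : 𝓞 F), a}

variable {p : ℕ} (hp : p.Prime) {a b u v w : 𝓞 F} (hab : a ^ 2 = p * b) (h1 : u * p + v * a + w * b = 1)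
include hab h1

theorem rp_sq : rp p a ^ 2 = Ideal.span {(p : 𝓞 F)} := by
  rw [rp, pow_two, Ideal.span_pair_mul_span_pair]
  apply le_antisymm
  · rw [Ideal.span_le]
    intro x hx
    simp only [Set.mem_insert_iff, Set.mem_singleton_iff] at hx
    simp only [SetLike.mem_coe, Ideal.mem_span_singleton]
    rcases hx with rfl | rfl | rfl | rfl
    · exact dvd_mul_right _ _
    · exact dvd_mul_right _ _
    · exact dvd_mul_left _ _
    · exact ⟨b, by rw [← hab, pow_two]⟩
  · rw [Ideal.span_singleton_le_iff_mem]
    have e : (p : 𝓞 F) = u * (p * p) + v * (p * a) + w * (a * a) := by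
      have := congrArg (fun z => (p : 𝓞 F) * z) h1
      simp only [mul_one] at this
      rw [← pow_two a, hab, ← this]
      simp only [this]
      conv_lhs => rw [← this]
      ring
    rw [e]
    refine Ideal.add_mem _ (Ideal.add_mem _ ?_ ?_) ?_ <;> apply Ideal.mul_mem_left <;> apply Ideal.subset_span <;> rw [← e] <;> simp

variable [Algebra.IsQuadraticExtension ℚ F]
theorem rp_norm : Ideal.absNorm (rp p a) = p := by
  have h := congrArg Ideal.absNorm (rp_sq hab h1)
  rw [map_pow, Ideal.absNorm_span_natCast, RingOfIntegers.rank,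
    Algebra.IsQuadraticExtension.finrank_eq_two] at h
  exact Nat.pow_left_injective (by norm_num : 2 ≠ 0) h

include hp
theorem rp_prime : (rp p a).IsPrime := by
  apply Ideal.isPrime_of_irreducible_absNorm
  rw [rp_norm hab h1]; exact hp

theorem rp_ne : rp p a ≠ ⊥ := by
  intro h
  have := rp_norm hab h1
  rw [h, Ideal.absNorm_bot] at this
  exact hp.ne_zero this.symm

theorem rp_unique {P : Ideal (𝓞 F)} (hP : P.IsPrime) (h : (p : 𝓞 F) ∈ P) : P = rp p a := by
  have ha : a ∈ P := hP.mem_of_pow_mem 2 (by rw [hab]; exact Ideal.mul_mem_right _ _ h)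
  have hle : rp p a ≤ P := by
    rw [rp, Ideal.span_le]; intro x hx
    simp only [Set.mem_insert_iff, Set.mem_singleton_iff] at hx
    rcases hx with rfl | rfl <;> assumption
  exact (((rp_prime hp hab h1).isMaximal (rp_ne hp hab h1)).eq_of_le hP.ne_top hle).symm

end ram
end S4

namespace S4
open nonZeroDivisors

section quad
variable {K L : Type} [Field K] [Field L] [NumberField K] [NumberField L] [Algebra K L]
variable [Algebra.IsQuadraticExtension K L]

theorem exists_sigma (K L : Type) [Field K] [Field L] [NumberField K] [NumberField L] [Algebra K L]
    [Algebra.IsQuadraticExtension K L] : ∃ σ : L ≃ₐ[K] L, σ ≠ 1 := by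
  haveI : IsGalois K L := inferInstance
  have h : Nat.card (L ≃ₐ[K] L) = 2 := by
    rw [IsGalois.card_aut_eq_finrank, Algebra.IsQuadraticExtension.finrank_eq_two]
  haveI : Nontrivial (L ≃ₐ[K] L) := by
    rw [← Finite.one_lt_card_iff_nontrivial]; omega
  exact exists_ne 1

theorem sigma_neg (σ : L ≃ₐ[K] L) (hσ : σ ≠ 1) {α : L} {c : K} (h : α ^ 2 = algebraMap K L c)
    (hn : ∀ y, algebraMap K L y ≠ α) : σ α = -α := by
  have h1 : (σ α) ^ 2 = α ^ 2 := by rw [← map_pow, h, AlgEquiv.commutes]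
  rcases sq_eq_sq_iff_eq_or_eq_neg.1 h1 with h | h
  · obtain ⟨y, hy⟩ := fix_field σ hσ h
    exact absurd hy (hn y)
  · exact h

/-- packaged Chevalley bound -/
theorem chev_bound (σ : L ≃ₐ[K] L) (hσ : σ ≠ 1) [IsTotallyReal K] [IsTotallyReal L]
    {ι : Type} (T : Finset ι) (R : ι → (Ideal (𝓞 L))⁰) (α : 𝓞 L) (hα : σ α = -α)
    (hst : ∀ i ∈ T, (R i : Ideal (𝓞 L)).map (sI σ) = R i)
    (hR : ∀ P : Ideal (𝓞 L), P.IsPrime → P ≠ ⊥ → 2 * α ∈ P → ∃ i ∈ T, P = R i) :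
    ∃ m, Nat.card (fixS (sC σ)) * (2*m) ∣ 2^T.card * Nat.card (ClassGroup (𝓞 K)) ∧
      ((∀ a : L, a * σ a ≠ -1) → 2 ∣ m) := by
  classical
  obtain ⟨m, hm, hm'⟩ := chevalley σ hσ (T.image R) (by
    intro P hP hs
    rcases stable_prime_ram σ hσ hP (ideal_ne_zero P) hs α hα with h | h
    · right; exact h
    · left
      obtain ⟨i, hi, h⟩ := hR P hP (ideal_ne_zero P) h
      exact Finset.mem_image.2 ⟨i, hi, Subtype.ext h.symm⟩) (by
    intro P hP
    obtain ⟨i, hi, rfl⟩ := Finset.mem_image.1 hP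
    exact hst i hi)
  refine ⟨m, hm.trans (Nat.mul_dvd_mul (pow_dvd_pow 2 Finset.card_image_le) dvd_rfl), hm'⟩

end quad

section overQ
variable {F : Type} [Field F] [NumberField F] [Algebra.IsQuadraticExtension ℚ F]
variable (σ : F ≃ₐ[ℚ] F) (hσ : σ ≠ 1) 

include hσ in
theorem int_fixed {x : 𝓞 F} (h : sI σ x = x) : ∃ n : ℤ, x = n := by
  obtain ⟨y, rfl⟩ := fix_int σ hσ h
  refine ⟨Rat.ringOfIntegersEquiv y, ?_⟩
  conv_lhs => rw [← Rat.ringOfIntegersEquiv.symm_apply_apply y]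
  rw [← map_intCast (algebraMap (𝓞 ℚ) (𝓞 F)), ← map_intCast Rat.ringOfIntegersEquiv.symm]
  simp

theorem cl_rat (c : ClassGroup (𝓞 ℚ)) : c = 1 := by
  have h : Fintype.card (ClassGroup (𝓞 ℚ)) = 1 := Rat.classNumber_eq
  haveI := Fintype.card_le_one_iff_subsingleton.1 h.le
  exact Subsingleton.elim _ _

include hσ in
theorem mem_fix_iff (c : ClassGroup (𝓞 F)) : c ∈ fixS (sC σ) ↔ c ^ 2 = 1 := by
  have h := jC_rC σ hσ c
  rw [cl_rat (rC ℚ F c), map_one] at h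
  rw [mem_fixS]
  constructor
  · intro h'; rw [h'] at h; rw [pow_two, h]
  · intro h'; rw [pow_two, h] at h'; exact (mul_left_cancel h').symm

variable {D : ℕ} {θ : 𝓞 F} (hθ : θ ^ 2 = (D : 𝓞 F)) (hsf : Squarefree D) (hD : D % 4 = 2 ∨ D % 4 = 3)
include hθ hD

theorem D_not_sq (n : ℤ) : n ^ 2 ≠ D := by
  intro h
  have : n ^ 2 % 4 = 0 ∨ n ^ 2 % 4 = 1 := by
    rcases Int.emod_two_eq_zero_or_one n with h | h
    · left; obtain ⟨k, rfl⟩ := Int.dvd_of_emod_eq_zero h; ring_nf; omega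
    · right; obtain ⟨k, hk⟩ : ∃ k, n = 2 * k + 1 := ⟨n / 2, by omega⟩
      subst hk; ring_nf; omega
  omega

include hσ in
theorem sI_theta : sI σ θ = -θ := by
  have h1 : (sI σ θ) ^ 2 = θ ^ 2 := by rw [← map_pow, hθ, map_natCast]
  rcases sq_eq_sq_iff_eq_or_eq_neg.1 h1 with h | h
  · obtain ⟨n, hn⟩ := int_fixed σ hσ h
    exfalso
    rw [hn] at hθ
    exact D_not_sq (θ := θ) (by rw [hn]; exact hθ) hD n (by exact_mod_cast hθ)
  · exact h

include hσ hsf in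
theorem int_repr (a : 𝓞 F) : ∃ x y : ℤ, a = x + y * θ := by
  have hs := sI_theta σ hσ hθ hD
  obtain ⟨t, ht⟩ := int_fixed σ hσ (x := a + sI σ a) (by rw [map_add, sI_sI σ hσ, add_comm])
  obtain ⟨N, hN⟩ := int_fixed σ hσ (x := a * sI σ a) (by rw [map_mul, sI_sI σ hσ, mul_comm])
  obtain ⟨u, hu⟩ := int_fixed σ hσ (x := (a - sI σ a) * θ) (by rw [map_mul, map_sub, sI_sI σ hσ, hs]; ring)
  have h1 : u ^ 2 = (t ^ 2 - 4 * N) * D := by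
    have : ((u ^ 2 : ℤ) : 𝓞 F) = (((t ^ 2 - 4 * N) * D : ℤ) : 𝓞 F) := by
      push_cast
      rw [← hu, ← ht, ← hN, ← hθ]; ring
    exact_mod_cast this
  have h2 : (D : ℤ) ∣ u := by
    have hsf' : Squarefree (D : ℤ) := Int.squarefree_natCast.2 hsf
    exact (hsf'.dvd_pow_iff_dvd two_ne_zero).1 ⟨t ^ 2 - 4 * N, by rw [h1]; ring⟩
  obtain ⟨w, rfl⟩ := h2
  have hD0 : (D : ℤ) ≠ 0 := by omega
  have hDF : (D : 𝓞 F) ≠ 0 := by exact_mod_cast hD0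
  have h3 : D * w ^ 2 = t ^ 2 - 4 * N := by
    apply mul_left_cancel₀ hD0
    linarith
  have hθ0 : θ ≠ 0 := by rintro rfl; apply hDF; rw [← hθ]; ring
  have h4 : a - sI σ a = w * θ := by
    apply mul_right_cancel₀ hθ0
    rw [hu, mul_assoc, ← pow_two, hθ]; push_cast; ring
  have h5 : w % 2 = 0 ∧ t % 2 = 0 := by
    have key : ((D : ℤ) * w ^ 2 - t ^ 2) % 4 = 0 := by rw [h3]; omega
    obtain ⟨D', e, hD', heD⟩ : ∃ D' e : ℤ, (e = 2 ∨ e = 3) ∧ (D : ℤ) = 4 * D' + e := by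
      rcases hD with h | h
      · exact ⟨D / 4, 2, Or.inl rfl, by omega⟩
      · exact ⟨D / 4, 3, Or.inr rfl, by omega⟩
    obtain ⟨w', i, hi, rfl⟩ : ∃ w' i : ℤ, (i = 0 ∨ i = 1) ∧ w = 2 * w' + i := ⟨w / 2, w % 2, by omega, by omega⟩
    obtain ⟨t', j, hj, rfl⟩ : ∃ w' i : ℤ, (i = 0 ∨ i = 1) ∧ t = 2 * w' + i := ⟨t / 2, t % 2, by omega, by omega⟩
    rw [heD] at key
    have e1 : (4 * D' + e) * (2 * w' + i) ^ 2 - (2 * t' + j) ^ 2 =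
      4 * (D' * (2 * w' + i) ^ 2 + e * w' ^ 2 + e * w' * i - t' ^ 2 - t' * j) + (e * i ^ 2 - j ^ 2) := by ring
    rw [e1] at key
    generalize (D' * (2 * w' + i) ^ 2 + e * w' ^ 2 + e * w' * i - t' ^ 2 - t' * j) = z at key
    rcases hD' with rfl | rfl <;> rcases hi with rfl | rfl <;> rcases hj with rfl | rfl <;> omega
  obtain ⟨y, rfl⟩ := Int.dvd_of_emod_eq_zero h5.1
  obtain ⟨x, rfl⟩ := Int.dvd_of_emod_eq_zero h5.2
  refine ⟨x, y, ?_⟩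
  have h20 : (2 : 𝓞 F) ≠ 0 := two_ne_zero
  apply mul_left_cancel₀ h20
  push_cast at ht h4
  linear_combination ht + h4

include hσ in
theorem norm_repr (x y : ℤ) : Algebra.norm ℤ ((x : 𝓞 F) + y * θ) = x ^ 2 - D * y ^ 2 := by
  have h := norm_eq_mul σ hσ (((x : 𝓞 F) + y * θ : 𝓞 F) : F)
  rw [← Algebra.coe_norm_int] at h
  have hs := congrArg (fun z : 𝓞 F => (z : F)) (sI_theta σ hσ hθ hD)
  have hs' : σ (θ : F) = -(θ : F) := by simpa using hs
  have hθ' : (θ : F) ^ 2 = D := by exact_mod_cast congrArg (fun z : 𝓞 F => (z : F)) hθ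
  have e : (algebraMap ℚ F) ((Algebra.norm ℤ ((x : 𝓞 F) + y * θ) : ℤ) : ℚ) = (algebraMap ℚ F) ((x ^ 2 - D * y ^ 2 : ℤ) : ℚ) := by
    rw [h]
    push_cast
    simp only [map_add, map_mul, map_intCast, hs', map_sub, map_pow, map_natCast]
    linear_combination (- (y : F) ^ 2) * hθ'
  exact_mod_cast (algebraMap ℚ F).injective e

theorem repr_inj {x y x' y' : ℤ} (h : (x : 𝓞 F) + y * θ = x' + y' * θ) : x = x' ∧ y = y' := by
  have h1 : (((x - x') ^ 2 : ℤ) : 𝓞 F) = ((D * (y' - y) ^ 2 : ℤ) : 𝓞 F) := by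
    push_cast
    rw [← hθ, show ((x : 𝓞 F) - x') = (y' - y) * θ by linear_combination h]; ring
  have h2 : (x - x') ^ 2 = D * (y' - y) ^ 2 := by exact_mod_cast h1
  have hy : y' - y = 0 := by
    by_contra hne
    have hdv : (y' - y) ^ 2 ∣ (x - x') ^ 2 := ⟨D, by rw [h2]; ring⟩
    obtain ⟨z, hz⟩ := (Int.pow_dvd_pow_iff two_ne_zero).1 hdv
    rw [hz] at h2
    apply D_not_sq hθ hD z
    apply mul_left_cancel₀ (pow_ne_zero 2 hne)
    linarith
  have hx : x - x' = 0 := by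
    rw [hy] at h2; simpa using h2
  exact ⟨by linarith, by linarith⟩

include hσ hsf in
theorem genus_char (l : ℕ) [hl : Fact l.Prime] (hl4 : l % 4 = 1) (d : ℕ) (hDl : D = l * d) :
    ∃ χ : ClassGroup (𝓞 F) →* ℤˣ, ∀ I : (Ideal (𝓞 F))⁰,
      ((χ (ClassGroup.mk0 I) : ℤˣ) : ℤ) = gf l d (Ideal.absNorm (I : Ideal (𝓞 F))) := by
  have hd : ¬ (l : ℤ) ∣ (d : ℤ) := by
    rw [Int.natCast_dvd_natCast]
    rintro ⟨e, rfl⟩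
    have := hsf l ⟨e, by rw [hDl]; ring⟩
    exact hl.out.one_lt.ne' (Nat.isUnit_iff.1 this)
  have hne : ∀ I : (Ideal (𝓞 F))⁰, Ideal.absNorm (I : Ideal (𝓞 F)) ≠ 0 := fun I => by
    rw [Ne, Ideal.absNorm_eq_zero_iff]; exact ideal_ne_zero I
  let f : (Ideal (𝓞 F))⁰ →* ℤˣ :=
    { toFun := fun I => ⟨gf l d (Ideal.absNorm (I : Ideal (𝓞 F))), gf l d (Ideal.absNorm (I : Ideal (𝓞 F))),
        gf_sq l d hd (hne I), gf_sq l d hd (hne I)⟩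
      map_one' := by
        ext
        simp [gf, legendreSym.at_one]
      map_mul' := fun I J => by
        ext
        simp only [Submonoid.coe_mul, map_mul, Units.val_mul]
        exact gf_mul l d (hne I) (hne J) }
  refine ⟨clLift f ?_, fun I => by rw [clLift_mk0]; rfl⟩
  intro a ha
  have ha0 : a ≠ 0 := by
    rintro rfl
    exact ideal_ne_zero ⟨_, ha⟩ (by simp)
  ext
  change gf l d (Ideal.absNorm (Ideal.span {a})) = 1
  rw [Ideal.absNorm_span_singleton]
  obtain ⟨x, y, rfl⟩ := int_repr σ hσ hθ hsf hD a
  rw [norm_repr σ hσ hθ hD, hDl]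
  have := (gf_norm l d hd hl4 _ x y le_rfl (by
    by_contra hc
    push Not at hc
    apply ha0; rw [hc.1, hc.2]; simp)).2
  push_cast
  exact this

omit hD in
include hsf in
omit hsf [Algebra.IsQuadraticExtension ℚ F] in
theorem rp_data_odd {p d : ℕ} (hDp : D = p * d) (hcop : Nat.Coprime p d) :
    ∃ a b u v w : 𝓞 F, a ^ 2 = p * b ∧ u * p + v * a + w * b = 1 := by
  have hb := Nat.gcd_eq_gcd_ab p d
  rw [hcop] at hb
  refine ⟨θ, d, Nat.gcdA p d, 0, Nat.gcdB p d, by rw [hθ, hDp]; push_cast; ring, ?_⟩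
  have : ((p * Nat.gcdA p d + d * Nat.gcdB p d : ℤ) : 𝓞 F) = ((1 : ℤ) : 𝓞 F) := by
    rw [← hb]; rfl
  push_cast at this
  linear_combination this

include hsf in
theorem exists_rp (p : ℕ) (hp : p.Prime) (hpD : p ∣ 2 * D) : ∃ P : (Ideal (𝓞 F))⁰,
    (P : Ideal (𝓞 F)).IsPrime ∧ Ideal.absNorm (P : Ideal (𝓞 F)) = p ∧
    (P : Ideal (𝓞 F)) ^ 2 = Ideal.span {(p : 𝓞 F)} ∧
    ∀ Q : Ideal (𝓞 F), Q.IsPrime → (p : 𝓞 F) ∈ Q → Q = P := by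
  obtain ⟨a, b, u, v, w, hab, h1⟩ : ∃ a b u v w : 𝓞 F, a ^ 2 = p * b ∧ u * p + v * a + w * b = 1 := by
    by_cases h : p ∣ D
    · obtain ⟨d, hd⟩ := h
      refine rp_data_odd hθ hd ?_
      rw [hd] at hsf
      exact Nat.coprime_of_squarefree_mul hsf
    · have hp2 : p = 2 := by
        rcases (hp.dvd_mul.1 hpD) with h' | h'
        · exact (Nat.prime_dvd_prime_iff_eq hp Nat.prime_two).1 h'
        · exact absurd h' h
      subst hp2
      have hD3 : D % 4 = 3 := by omega
      obtain ⟨k, hk⟩ : ∃ k, D = 4 * k + 3 := ⟨D / 4, by omega⟩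
      refine ⟨1 + θ, (2 * k + 2 : ℕ) + θ, -k, -1, 1, ?_, ?_⟩
      · rw [add_sq, hθ, hk]; push_cast; ring
      · push_cast; ring
  exact ⟨⟨rp p a, mem_nonZeroDivisors_of_ne_zero (rp_ne hp hab h1)⟩, rp_prime hp hab h1, rp_norm hab h1,
    rp_sq hab h1, fun Q hQ h => rp_unique hp hab h1 hQ h⟩

end overQ
end S4

namespace S4
open nonZeroDivisors

theorem sum_sq_descent {q d : ℕ} [hq : Fact q.Prime] (hq4 : q % 4 = 3) (hd : ¬ q ∣ d) (N : ℕ) :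
    ∀ x y c : ℤ, x.natAbs + y.natAbs + c.natAbs ≤ N → x ^ 2 + c ^ 2 = (q * d : ℕ) * y ^ 2 → c = 0 := by
  have hlp : Prime (q : ℤ) := Nat.prime_iff_prime_int.1 hq.out
  have hq1 : 1 < q := hq.out.one_lt
  have key : ∀ x c : ℤ, (q : ℤ) ∣ x ^ 2 + c ^ 2 → (q : ℤ) ∣ c := by
    intro x c h
    rw [← ZMod.intCast_zmod_eq_zero_iff_dvd] at h ⊢
    by_contra hc
    push_cast at h
    exact ZMod.mod_four_ne_three_of_sq_eq_neg_sq' (p := q) hc (x := x) (eq_neg_of_add_eq_zero_left h) hq4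
  induction N with
  | zero => intro x y c h _; omega
  | succ N ih =>
    intro x y c hN h
    have h1 : (q : ℤ) ∣ x ^ 2 + c ^ 2 := ⟨d * y ^ 2, by rw [h]; push_cast; ring⟩
    obtain ⟨c', rfl⟩ := key x c h1
    obtain ⟨x', rfl⟩ := key (q * c') x (by rw [add_comm]; exact h1)
    have hq0 : (q : ℤ) ≠ 0 := hlp.ne_zero
    have h2 : (q : ℤ) * (x' ^ 2 + c' ^ 2) = d * y ^ 2 := by
      apply mul_left_cancel₀ hq0; push_cast at h; linarith
    have h3 : (q : ℤ) ∣ d * y ^ 2 := ⟨_, h2.symm⟩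
    obtain ⟨y', rfl⟩ : (q : ℤ) ∣ y := by
      rcases hlp.dvd_or_dvd h3 with h | h
      · exact absurd (Int.natCast_dvd_natCast.1 h) hd
      · exact hlp.dvd_of_dvd_pow h
    by_contra hne
    have hc' : c' ≠ 0 := by rintro rfl; simp at hne
    apply hc'
    apply ih x' y' c'
    · rw [Int.natAbs_mul, Int.natAbs_mul, Int.natAbs_mul, Int.natAbs_natCast] at hN
      have : 0 < x'.natAbs + y'.natAbs + c'.natAbs := by omega
      nlinarith
    · apply mul_left_cancel₀ hq0; rw [h2]; push_cast; ring

section overQ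
variable {F : Type} [Field F] [NumberField F] [Algebra.IsQuadraticExtension ℚ F]
variable (σ : F ≃ₐ[ℚ] F) (hσ : σ ≠ 1) 
variable {D : ℕ} {θ : 𝓞 F} (hθ : θ ^ 2 = (D : 𝓞 F)) (hsf : Squarefree D) (hD : D % 4 = 2 ∨ D % 4 = 3)
include hθ hD hσ hsf

theorem not_norm {q d : ℕ} [hq : Fact q.Prime] (hq4 : q % 4 = 3) (hDq : D = q * d) (a : F) :
    a * σ a ≠ -1 := by
  intro h
  have hd : ¬ q ∣ d := by
    rintro ⟨e, rfl⟩
    have := hsf q ⟨e, by rw [hDq]; ring⟩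
    exact hq.out.one_lt.ne' (Nat.isUnit_iff.1 this)
  obtain ⟨c, hc, b, hb⟩ : ∃ c : ℤ, c ≠ 0 ∧ ∃ b : 𝓞 F, (c : F) * a = b := by
    obtain ⟨⟨b, c⟩, hbc⟩ := IsLocalization.surj (Algebra.algebraMapSubmonoid (𝓞 F) (nonZeroDivisors ℤ)) a
    obtain ⟨c, c', hc', rfl⟩ := c
    refine ⟨c', nonZeroDivisors.ne_zero hc', b, ?_⟩
    have h' : a * (algebraMap (𝓞 F) F) (algebraMap ℤ (𝓞 F) c') = (algebraMap (𝓞 F) F) b := hbc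
    simpa [mul_comm] using h'
  obtain ⟨x, y, rfl⟩ := int_repr σ hσ hθ hsf hD b
  have hn := norm_repr σ hσ hθ hD x y
  have h2 := norm_eq_mul σ hσ (((x : 𝓞 F) + y * θ : 𝓞 F) : F)
  rw [← Algebra.coe_norm_int, hn, ← hb, map_mul σ, map_intCast σ] at h2
  have h3 : (algebraMap ℚ F) ((x ^ 2 - D * y ^ 2 : ℤ) : ℚ) = (algebraMap ℚ F) ((- c ^ 2 : ℤ) : ℚ) := by
    rw [h2, map_intCast]; push_cast
    linear_combination (c : F) ^ 2 * h
  have h4 : x ^ 2 - D * y ^ 2 = - c ^ 2 := by exact_mod_cast (algebraMap ℚ F).injective h3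
  exact hc (sum_sq_descent hq4 hd _ x y c le_rfl (by rw [← hDq]; linarith))

theorem fix_card [IsTotallyReal F] : ∃ m, Nat.card (fixS (sC σ)) * (2*m) ∣ 2 ^ (2 * D).primeFactors.card ∧
      ((∀ a : F, a * σ a ≠ -1) → 2 ∣ m) := by
  classical
  have hD0 : D ≠ 0 := by omega
  choose R hR1 hR2 hR3 hR4 using exists_rp hθ hsf hD
  let R' : ℕ → (Ideal (𝓞 F))⁰ := fun p => if h : p.Prime ∧ p ∣ 2 * D then R p h.1 h.2 else 1
  have hR' : ∀ p (h1 : p.Prime) (h2 : p ∣ 2 * D), R' p = R p h1 h2 := fun p h1 h2 => dif_pos ⟨h1, h2⟩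
  obtain ⟨m, hm, hm'⟩ := chev_bound σ hσ (2 * D).primeFactors R' θ
    (by simpa using congrArg (fun z : 𝓞 F => (z : F)) (sI_theta σ hσ hθ hD))
    (by
      intro p hp
      have h1 := Nat.prime_of_mem_primeFactors hp
      have h2 := Nat.dvd_of_mem_primeFactors hp
      rw [hR' p h1 h2]
      haveI := hR1 p h1 h2
      apply hR4 p h1 h2
      · exact isPrime_map_sI σ _
      · rw [mem_map_sI, map_natCast]
        have : (p : 𝓞 F) ∈ (R p h1 h2 : Ideal (𝓞 F)) ^ 2 := by
          rw [hR3 p h1 h2]; exact Ideal.mem_span_singleton_self _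
        exact Ideal.pow_le_self two_ne_zero this)
    (by
      intro P hP hP0 h
      have h4 : (((2 * 2) * D : ℕ) : 𝓞 F) ∈ P := by
        have : (((2 * 2) * D : ℕ) : 𝓞 F) = (2 * θ) * (2 * θ) := by
          push_cast; rw [← hθ]; ring
        rw [this]; exact Ideal.mul_mem_left _ _ h
      obtain ⟨p, hp, hpd, hpP⟩ : ∃ p, p.Prime ∧ p ∣ (2 * 2) * D ∧ (p : 𝓞 F) ∈ P := by
        have hgen : ∀ n : ℕ, n ≠ 0 → (n : 𝓞 F) ∈ P → ∃ p, p.Prime ∧ p ∣ n ∧ (p : 𝓞 F) ∈ P := by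
          intro n
          induction n using Nat.recOnMul with
          | zero => intro h; exact absurd rfl h
          | one => intro _ h; exact absurd ((Ideal.eq_top_iff_one P).2 (by simpa using h)) hP.ne_top
          | prime p hp => intro _ h; exact ⟨p, hp, dvd_rfl, h⟩
          | mul a b iha ihb =>
            intro h0 h
            push_cast at h
            rcases hP.mem_or_mem h with h | h
            · obtain ⟨p, h1, h2, h3⟩ := iha (left_ne_zero_of_mul h0) h
              exact ⟨p, h1, h2.mul_right _, h3⟩
            · obtain ⟨p, h1, h2, h3⟩ := ihb (right_ne_zero_of_mul h0) h
              exact ⟨p, h1, h2.mul_left _, h3⟩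
        exact hgen _ (by positivity) h4
      have hpd' : p ∣ 2 * D := by
        rcases hp.dvd_mul.1 hpd with h | h
        · rcases hp.dvd_mul.1 h with h | h <;> exact h.mul_right _
        · exact h.mul_left _
      refine ⟨p, Nat.mem_primeFactors.2 ⟨hp, hpd', by positivity⟩, ?_⟩
      rw [hR' p hp hpd']
      exact hR4 p hp hpd' P hP hpP)
  have hQ : Nat.card (ClassGroup (𝓞 ℚ)) = 1 := by
    haveI : Subsingleton (ClassGroup (𝓞 ℚ)) := ⟨fun a b => by rw [cl_rat a, cl_rat b]⟩
    exact Nat.card_of_subsingleton 1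
  rw [hQ, mul_one] at hm
  exact ⟨m, hm, hm'⟩

end overQ
end S4

namespace S4
open nonZeroDivisors

section pell
variable {η q r s : ℕ} [hq : Fact q.Prime] [hr : Fact r.Prime] [hs : Fact s.Prime]
    (hη : η = 1 ∨ η = 2)
    (hq4 : q % 4 = 3) (hr8 : r % 8 = 5) (hs8 : s % 8 = 5)

include hη hq4 in
theorem m_sqf : Squarefree (η * q) := by
  rcases hη with rfl | rfl
  · rw [one_mul]; exact hq.out.squarefree
  · rw [Nat.squarefree_mul ((Nat.coprime_primes Nat.prime_two hq.out).2 (by omega))]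
    exact ⟨Nat.prime_two.squarefree, hq.out.squarefree⟩

include hη hq4 in
theorem m_not_sq (x : ℤ) : x ^ 2 ≠ (η * q : ℕ) := by
  intro h
  have h1 : ((η * q : ℕ) : ℤ) ∣ x :=
    ((Int.squarefree_natCast.2 (m_sqf hη hq4)).dvd_pow_iff_dvd two_ne_zero).1 ⟨1, by rw [h, mul_one]⟩
  obtain ⟨z, rfl⟩ := h1
  have hm : ((η * q : ℕ) : ℤ) ≠ 0 := by
    have := hq.out.ne_zero
    rcases hη with rfl | rfl <;> simpa
  have h2 : ((η * q : ℕ) : ℤ) * z ^ 2 = 1 := by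
    apply mul_left_cancel₀ hm; linear_combination h
  have h3 := Int.isUnit_iff.1 (IsUnit.of_mul_eq_one _ h2)
  have := hq.out.two_le
  rcases hη with rfl | rfl <;> push_cast at h3 <;> omega

variable (hqrs : legendreSym r q * legendreSym s q = 1)
    {γ γ' : ℤ} (hγ : 0 < γ) (hγ' : 0 < γ')
    (hPell : γ ^ 2 - (η * q * r * s : ℕ) * γ' ^ 2 = 1)
    (hfund : ∀ a b : ℤ, 0 < a → 0 < b → a ^ 2 - (η * q * r * s : ℕ) * b ^ 2 = 1 → γ ≤ a)
    (hnsq : ¬ ∃ t : ℤ, 2 ^ (if η = 1 then 1 else 0) * (q : ℤ) * (γ - 1) = t ^ 2)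

include hη hq4 hr8 in
theorem pell_even (x y : ℤ) (h1 : x ^ 2 + (η * q * r * s : ℕ) * y ^ 2 = (η * q : ℕ)) (h2 : x * y = 0) : False := by
  rcases mul_eq_zero.1 h2 with rfl | rfl
  · have hm : ((η * q : ℕ) : ℤ) ≠ 0 := by
      have := hq.out.ne_zero
      rcases hη with rfl | rfl <;> simpa
    have h3 : (r : ℤ) * (s * y ^ 2) = 1 := by
      apply mul_left_cancel₀ hm; push_cast at h1 ⊢; linear_combination h1
    have := Int.isUnit_iff.1 (IsUnit.of_mul_eq_one _ h3)
    omega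
  · exact m_not_sq hη hq4 x (by linarith)

include hη hq4 hr8 hs8 hqrs hPell hnsq in
theorem pell_odd (x y : ℤ) (h1 : x ^ 2 + (η * q * r * s : ℕ) * y ^ 2 = (η * q : ℕ) * γ)
    (h2 : 2 * (x * y) = (η * q : ℕ) * γ') : False := by
  have hm : ((η * q : ℕ) : ℤ) ≠ 0 := by
    have := hq.out.ne_zero
    rcases hη with rfl | rfl <;> simpa
  have h3 : (x ^ 2 - (η * q * r * s : ℕ) * y ^ 2) ^ 2 = ((η * q : ℕ) : ℤ) ^ 2 := by
    have e1 : (x ^ 2 - (η * q * r * s : ℕ) * y ^ 2) ^ 2 = (x ^ 2 + (η * q * r * s : ℕ) * y ^ 2) ^ 2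
      - (η * q * r * s : ℕ) * (2 * (x * y)) ^ 2 := by ring
    rw [e1, h1, h2]
    linear_combination ((η * q : ℕ) : ℤ) ^ 2 * hPell
  rcases sq_eq_sq_iff_eq_or_eq_neg.1 h3 with h | h
  · -- plus
    obtain ⟨z, rfl⟩ : ((η * q : ℕ) : ℤ) ∣ x := by
      apply ((Int.squarefree_natCast.2 (m_sqf hη hq4)).dvd_pow_iff_dvd two_ne_zero).1
      exact ⟨1 + r * s * y ^ 2, by push_cast at h ⊢; linear_combination h⟩
    have h4 : ((η * q : ℕ) : ℤ) * z ^ 2 - r * s * y ^ 2 = 1 := by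
      apply mul_left_cancel₀ hm; push_cast at h ⊢; linear_combination h
    have h5 : (-(r * s : ℤ) * y ^ 2 : ZMod q) = 1 := by
      have := congrArg (fun z : ℤ => (z : ZMod q)) h4
      push_cast at this
      simp only [CharP.cast_eq_zero, mul_zero, zero_mul, zero_sub] at this
      push_cast
      linear_combination this
    have h6 : legendreSym q (-(r * s) * y ^ 2) = 1 := by
      rw [legendreSym]; push_cast; push_cast at h5; rw [h5]; simp
    have hq2 : q ≠ 2 := by omega
    rw [legendreSym.mul, legendreSym.at_neg hq2, ZMod.χ₄_nat_three_mod_four hq4, legendreSym.mul,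
      legendreSym.quadratic_reciprocity_one_mod_four (by omega : r % 4 = 1) hq2,
      legendreSym.quadratic_reciprocity_one_mod_four (by omega : s % 4 = 1) hq2, hqrs, pow_two,
      legendreSym.mul] at h6
    nlinarith [mul_self_nonneg (legendreSym q y)]
  · have h4 : 2 * x ^ 2 = (η * q : ℕ) * (γ - 1) := by linear_combination h1 + h
    apply hnsq
    rcases hη with rfl | rfl
    · refine ⟨2 * x, ?_⟩
      simp only [if_true]; push_cast at h4 ⊢; linear_combination (-2) * h4
    · refine ⟨x, ?_⟩
      norm_num at h4 ⊢; linarith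

variable {F : Type} [Field F] [NumberField F] [Algebra.IsQuadraticExtension ℚ F]
variable (σ : F ≃ₐ[ℚ] F) (hσ : σ ≠ 1) 
variable {θ : 𝓞 F} (hθ : θ ^ 2 = ((η * q * r * s : ℕ) : 𝓞 F)) (hsf : Squarefree (η * q * r * s))
   (hD : (η * q * r * s) % 4 = 2 ∨ (η * q * r * s) % 4 = 3)

include hσ hsf hη hq4 hr8 hs8 hqrs hPell hnsq hθ hD hγ hγ' hfund in
theorem pell_np (a u : 𝓞 F) (hu : IsUnit u) (h : a ^ 2 = (η * q : ℕ) * u) : False := by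
  have hDpos : 0 < η * q * r * s := by omega
  obtain ⟨X, Y, rfl⟩ := int_repr σ hσ hθ hsf hD u
  have hXY : X ^ 2 - (η * q * r * s : ℕ) * Y ^ 2 = 1 := by
    have h1 := norm_repr σ hσ hθ hD X Y
    have h2 := hu.map (Algebra.norm ℤ)
    rw [h1, Int.isUnit_iff] at h2
    rcases h2 with h2 | h2
    · exact h2
    · exfalso
      have hd : ¬ q ∣ η * r * s := by
        rintro ⟨e, he⟩
        have := hsf q ⟨e, by rw [show η * q * r * s = q * (η * r * s) by ring, he]; ring⟩
        exact hq.out.one_lt.ne' (Nat.isUnit_iff.1 this)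
      have := sum_sq_descent hq4 hd _ X Y 1 le_rfl (by
        rw [show q * (η * r * s) = η * q * r * s by ring]; linarith)
      exact one_ne_zero this
  let ε : Pell.Solution₁ ((η * q * r * s : ℕ) : ℤ) := Pell.Solution₁.mk γ γ' hPell
  have hε : Pell.IsFundamental ε := by
    refine ⟨?_, hγ', ?_⟩
    · change 1 < γ
      by_contra hc
      have : γ = 1 := by omega
      rw [this] at hPell
      have : 0 < ((η * q * r * s : ℕ) : ℤ) * γ' ^ 2 := by positivity
      linarith
    · intro b hb
      change γ ≤ b.x
      have hy := Pell.Solution₁.y_ne_zero_of_one_lt_x hb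
      refine hfund b.x |b.y| (by linarith) (abs_pos.2 hy) ?_
      rw [sq_abs]; exact b.prop
  let φ : Pell.Solution₁ ((η * q * r * s : ℕ) : ℤ) → 𝓞 F := fun z => (z.x : 𝓞 F) + z.y * θ
  have φmul : ∀ z w, φ (z * w) = φ z * φ w := by
    intro z w
    simp only [φ, Pell.Solution₁.x_mul, Pell.Solution₁.y_mul]
    push_cast at hθ ⊢
    linear_combination (-(z.y : 𝓞 F) * w.y) * hθ
  have key : ∀ (j : ℤ) (z w : Pell.Solution₁ ((η * q * r * s : ℕ) : ℤ)), a ^ 2 = (η * q : ℕ) * φ z →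
      z = w * (ε ^ j) ^ 2 → ∃ x y : ℤ, x ^ 2 + (η * q * r * s : ℕ) * y ^ 2 = (η * q : ℕ) * w.x ∧
        2 * (x * y) = (η * q : ℕ) * w.y := by
    intro j z w hz hw
    obtain ⟨x, y, hxy⟩ := int_repr σ hσ hθ hsf hD (a * φ (ε ^ (-j)))
    refine ⟨x, y, ?_⟩
    have e1 : ((x : 𝓞 F) + y * θ) ^ 2 = (η * q : ℕ) * φ w := by
      rw [← hxy, mul_pow, hz, mul_assoc, pow_two (φ (ε ^ (-j))), ← φmul, ← φmul]
      congr 2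
      rw [hw, zpow_neg]; group
    have e2 : ((x ^ 2 + (η * q * r * s : ℕ) * y ^ 2 : ℤ) : 𝓞 F) + ((2 * (x * y) : ℤ) : 𝓞 F) * θ =
        (((η * q : ℕ) * w.x : ℤ) : 𝓞 F) + (((η * q : ℕ) * w.y : ℤ) : 𝓞 F) * θ := by
      simp only [φ] at e1
      push_cast at e1 hθ ⊢
      linear_combination e1 - (y : 𝓞 F) ^ 2 * hθ
    exact repr_inj hθ hD e2
  have hz : a ^ 2 = (η * q : ℕ) * φ (Pell.Solution₁.mk X Y hXY) := h
  have hmpos : (0 : ℤ) < (η * q : ℕ) := by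
    have := hq.out.pos
    rcases hη with rfl | rfl <;> positivity
  have hpos : ∀ (x y : ℤ), 0 ≤ x ^ 2 + (η * q * r * s : ℕ) * y ^ 2 := fun x y => by positivity
  obtain ⟨k, hk⟩ := hε.eq_zpow_or_neg_zpow (Pell.Solution₁.mk X Y hXY)
  rcases Int.even_or_odd' k with ⟨j, hj | hj⟩
  · rcases hk with hk | hk
    · obtain ⟨x, y, h1, h2⟩ := key j _ 1 hz (by rw [hk, hj, one_mul, ← zpow_natCast, ← zpow_mul]; congr 1; push_cast; ring)
      rw [Pell.Solution₁.x_one, mul_one] at h1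
      rw [Pell.Solution₁.y_one, mul_zero] at h2
      exact pell_even hη hq4 hr8 x y h1 (by linarith)
    · obtain ⟨x, y, h1, h2⟩ := key j _ (-1) hz (by
        rw [hk, hj, neg_mul, one_mul, ← zpow_natCast, ← zpow_mul]; congr 2; push_cast; ring)
      rw [Pell.Solution₁.x_neg, Pell.Solution₁.x_one] at h1
      have := hpos x y
      linarith
  · rcases hk with hk | hk
    · obtain ⟨x, y, h1, h2⟩ := key j _ ε hz (by
        rw [hk, hj, ← zpow_natCast, ← zpow_mul, zpow_add, zpow_one, mul_comm _ ε]; congr 2; push_cast; ring)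
      exact pell_odd hη hq4 hr8 hs8 hqrs hPell hnsq x y h1 h2
    · obtain ⟨x, y, h1, h2⟩ := key j _ (-ε) hz (by
        rw [hk, hj, neg_mul, ← zpow_natCast, ← zpow_mul, zpow_add, zpow_one, mul_comm _ ε]; congr 3; push_cast; ring)
      rw [Pell.Solution₁.x_neg] at h1
      change _ = _ * (-γ) at h1
      have := hpos x y
      nlinarith
end pell
end S4

namespace S4
open nonZeroDivisors

section grp
variable {G : Type*} [CommGroup G] [Finite G] (χ₁ χ₂ : G →* ℤˣ) (T : Subgroup G) (hT : ∀ x, x ∈ T ↔ x ^ 2 = 1)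

theorem card_pm : Nat.card (ℤˣ × ℤˣ) = 4 := by
  rw [Nat.card_eq_fintype_card]; rfl

include hT in
theorem T_le_A2 : T ≤ A2 G := fun x hx => ⟨1, by simpa using (hT x).1 hx⟩

include hT in
theorem grp_one (hc : Nat.card T ∣ 4) {a b : G} (ha : a ^ 2 = 1) (hb : b ^ 2 = 1)
    (ha1 : χ₁ a = -1) (ha2 : χ₂ a = 1) (hb1 : χ₁ b = 1) (hb2 : χ₂ b = -1) :
    (∀ x, x ^ 2 = 1 → χ₁ x = 1 → χ₂ x = 1 → x = 1) ∧ Nat.card (A2 G) ∣ 4 := by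
  let χ : T → ℤˣ × ℤˣ := fun x => (χ₁ x, χ₂ x)
  have hs : Function.Surjective χ := by
    rintro ⟨e1, e2⟩
    rcases Int.units_eq_one_or e1 with rfl | rfl <;> rcases Int.units_eq_one_or e2 with rfl | rfl
    · exact ⟨1, by simp [χ]⟩
    · exact ⟨⟨b, (hT b).2 hb⟩, by simp [χ, hb1, hb2]⟩
    · exact ⟨⟨a, (hT a).2 ha⟩, by simp [χ, ha1, ha2]⟩
    · exact ⟨⟨a * b, T.mul_mem ((hT a).2 ha) ((hT b).2 hb)⟩, by simp [χ, ha1, ha2, hb1, hb2]⟩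
  have hb' := hs.bijective_of_nat_card_le (by rw [card_pm]; exact Nat.le_of_dvd (by norm_num) hc)
  have h1 : ∀ x, x ^ 2 = 1 → χ₁ x = 1 → χ₂ x = 1 → x = 1 := by
    intro x hx h1 h2
    have : (⟨x, (hT x).2 hx⟩ : T) = 1 := hb'.1 (by simp [χ, h1, h2])
    exact congrArg Subtype.val this
  refine ⟨h1, ?_⟩
  have h2 : A2 G = T := by
    apply le_antisymm _ (T_le_A2 T hT)
    have key : ∀ k : ℕ, ∀ x : G, x ^ (2 ^ (k + 1)) = 1 → x ^ 2 = 1 := by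
      intro k
      induction k with
      | zero => intro x hx; simpa using hx
      | succ k ih =>
        intro x hx
        have h3 := ih (x ^ 2) (by rw [← pow_mul, ← pow_succ']; exact hx)
        exact h1 _ h3 (by rw [map_pow]; exact Int.units_sq _) (by rw [map_pow]; exact Int.units_sq _)
    rintro x ⟨k, hk⟩
    rw [hT]
    exact key k x (by rw [pow_succ, pow_mul, hk, one_pow])
  rw [h2]; exact hc

include hT in
theorem grp_two (hc : Nat.card T ∣ 4) {a b : G} (ha : a ^ 2 = 1) (hb : b ^ 2 = 1)
    (ha1 : χ₁ a = -1) (hb1 : χ₁ b = 1) (hbne : b ≠ 1) :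
    Nat.card T = 4 ∧ (∀ x, x ^ 2 = 1 → x = 1 ∨ x = a ∨ x = b ∨ x = a * b) := by
  have hane : a ≠ 1 := by rintro rfl; simp at ha1
  let f : ZMod 2 × ZMod 2 → T := fun z =>
    ⟨a ^ z.1.val * b ^ z.2.val, T.mul_mem (T.pow_mem ((hT a).2 ha) _) (T.pow_mem ((hT b).2 hb) _)⟩
  have hf : Function.Injective f := by
    have hab : a ≠ b := by rintro rfl; rw [ha1] at hb1; exact absurd hb1 (by decide)
    have e1 : a * b ≠ 1 := by
      intro h; have := congrArg χ₁ h; rw [map_mul, ha1, hb1, map_one] at this; exact absurd this (by decide)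
    rintro ⟨i, j⟩ ⟨i', j'⟩ h
    have h := congrArg Subtype.val h
    simp only [f] at h
    fin_cases i <;> fin_cases j <;> fin_cases i' <;> fin_cases j' <;> simp [ZMod.val] at h ⊢ <;>
      (exfalso; revert h; simp [hane, hbne, hab, e1, hane.symm, hbne.symm, hab.symm, e1.symm])
  have hcz : Nat.card (ZMod 2 × ZMod 2) = 4 := by simp
  have hb' := hf.bijective_of_nat_card_le (by rw [hcz]; exact Nat.le_of_dvd (by norm_num) hc)
  refine ⟨by rw [← Nat.card_eq_of_bijective f hb', hcz], ?_⟩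
  intro x hx
  obtain ⟨⟨i, j⟩, hij⟩ := hb'.2 ⟨x, (hT x).2 hx⟩
  have hij := congrArg Subtype.val hij
  simp only [f] at hij
  rw [← hij]
  fin_cases i <;> fin_cases j <;> simp [ZMod.val]

include hT in
theorem grp_three (hc : Nat.card T = 4) (h8 : Nat.card (A2 G) = 8) (N : Subgroup G) (hN : N ≤ A2 G)
    (hs : ∀ e₁ e₂ : ℤˣ, ∃ x ∈ N, χ₁ x = e₁ ∧ χ₂ x = e₂) : N = A2 G := by
  let χ : A2 G →* ℤˣ × ℤˣ := (χ₁.prod χ₂).comp (A2 G).subtype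
  have hχ : Function.Surjective χ := by
    rintro ⟨e1, e2⟩
    obtain ⟨x, hx, h1, h2⟩ := hs e1 e2
    exact ⟨⟨x, hN hx⟩, by simp [χ, h1, h2]⟩
  have hker : Nat.card χ.ker = 2 := by
    have h1 := Subgroup.card_mul_index χ.ker
    rw [Subgroup.index_ker, MonoidHom.range_eq_top.2 hχ, Subgroup.card_top, card_pm, h8] at h1
    omega
  let sqh : A2 G →* A2 G := powMonoidHom 2
  have hkT : Nat.card sqh.ker = 4 := by
    rw [← hc]
    refine Nat.card_congr ⟨fun x => ⟨x.1.1, (hT _).2 ?_⟩, fun x => ⟨⟨x.1, T_le_A2 T hT x.2⟩, ?_⟩, fun x => rfl, fun x => rfl⟩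
    · exact congrArg Subtype.val (x.2 : sqh x.1 = 1)
    · exact Subtype.ext ((hT _).1 x.2)
  have hran : Nat.card sqh.range = 2 := by
    have h1 := Subgroup.card_mul_index sqh.ker
    rw [Subgroup.index_ker, hkT, h8] at h1
    omega
  have hle : sqh.range ≤ χ.ker := by
    rintro _ ⟨y, rfl⟩
    rw [MonoidHom.mem_ker]
    change χ (y ^ 2) = 1
    rw [map_pow]
    exact Prod.ext (Int.units_sq _) (Int.units_sq _)
  have heq : sqh.range = χ.ker := Subgroup.eq_of_le_of_card_ge hle (by rw [hker, hran])
  have hA : ∀ x : A2 G, x ^ (2 ^ 3) = 1 := fun x => by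
    rw [show 2 ^ 3 = Nat.card (A2 G) by rw [h8]; norm_num]; exact pow_card_eq_one'
  have hfr := frattini hA (N.subgroupOf (A2 G)) (by
    intro x
    obtain ⟨y, hy, h1, h2⟩ := hs (χ₁ x) (χ₂ x)
    refine ⟨⟨y, hN hy⟩, Subgroup.mem_subgroupOf.2 hy, ?_⟩
    have hk : x * (⟨y, hN hy⟩ : A2 G)⁻¹ ∈ χ.ker := by
      rw [MonoidHom.mem_ker, map_mul, map_inv, mul_inv_eq_one]
      simp [χ, h1, h2]
    rw [← heq] at hk
    obtain ⟨z, hz⟩ := hk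
    refine ⟨z, ?_⟩
    change z ^ 2 = _ at hz
    rw [hz, mul_comm, inv_mul_cancel_right])
  exact le_antisymm hN (Subgroup.subgroupOf_eq_top.1 hfr)

end grp
end S4

namespace S4
open nonZeroDivisors

section arith
variable {e q r s : ℕ} [hq : Fact q.Prime] [hr : Fact r.Prime] [hs : Fact s.Prime]
    (he : e = 1 ∨ e = 2)
    (hq4 : q % 4 = 3) (hr8 : r % 8 = 5) (hs8 : s % 8 = 5) (hrs : legendreSym s r = 1)

include hrs in
theorem r_ne_s : r ≠ s := by
  rintro rfl
  rw [(legendreSym.eq_zero_iff r r).2 (by simp)] at hrs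
  exact zero_ne_one hrs

theorem leg_two {l : ℕ} [hl : Fact l.Prime] (h : l % 8 = 5) : legendreSym l 2 = -1 := by
  rw [legendreSym.at_two (by omega), ZMod.χ₈_nat_eq_if_mod_eight, if_neg (by omega), if_neg (by omega)]

include hq4 hr8 hs8 hrs he in
theorem D_sqf : Squarefree (e * q * r * s) := by
  have hne := r_ne_s hrs
  have h1 : Nat.Coprime q r := (Nat.coprime_primes hq.out hr.out).2 (by rintro rfl; omega)
  have h2 : Nat.Coprime q s := (Nat.coprime_primes hq.out hs.out).2 (by rintro rfl; omega)
  have h3 : Nat.Coprime r s := (Nat.coprime_primes hr.out hs.out).2 hne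
  have he' : Nat.Coprime e r := by
    rcases he with rfl | rfl
    · simp
    · exact (Nat.coprime_primes Nat.prime_two hr.out).2 (by omega)
  have he'' : Nat.Coprime e s := by
    rcases he with rfl | rfl
    · simp
    · exact (Nat.coprime_primes Nat.prime_two hs.out).2 (by omega)
  rw [Nat.squarefree_mul ((h2.mul_left he''.symm.symm |> fun _ => (he''.mul_left h2).mul_left h3)),
    Nat.squarefree_mul (he'.mul_left h1)]
  exact ⟨⟨m_sqf he hq4, hr.out.squarefree⟩, hs.out.squarefree⟩

include hq4 hr8 hs8 he in
theorem D_mod : (e * q * r * s) % 4 = 2 ∨ (e * q * r * s) % 4 = 3 := by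
  obtain ⟨a, ha⟩ : ∃ a, q = 4 * a + 3 := ⟨q / 4, by omega⟩
  obtain ⟨b, hb⟩ : ∃ a, r = 4 * a + 1 := ⟨r / 4, by omega⟩
  obtain ⟨c, hc⟩ : ∃ a, s = 4 * a + 1 := ⟨s / 4, by omega⟩
  have h1 : (q * r * s) % 4 = 3 := by
    rw [Nat.mul_mod, Nat.mul_mod q r, ha, hb, hc]; simp [Nat.add_mod]
  rcases he with rfl | rfl
  · right; simpa using h1
  · left; rw [show 2 * q * r * s = 2 * (q * r * s) by ring]; omega

include he in
theorem D_pf : (2 * (e * q * r * s)).primeFactors.card ≤ 4 := by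
  have h : (2 * (e * q * r * s)).primeFactors ⊆ {2, q, r, s} := by
    intro p hp
    have h1 := Nat.prime_of_mem_primeFactors hp
    have h2 := Nat.dvd_of_mem_primeFactors hp
    have hh : ∀ l : ℕ, l.Prime → p ∣ l → p = l := fun l hl h => (Nat.prime_dvd_prime_iff_eq h1 hl).1 h
    simp only [Finset.mem_insert, Finset.mem_singleton]
    rcases h1.dvd_mul.1 h2 with h | h
    · left; exact hh 2 Nat.prime_two h
    rcases h1.dvd_mul.1 h with h | h
    · rcases h1.dvd_mul.1 h with h | h
      · rcases h1.dvd_mul.1 h with h | h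
        · rcases he with rfl | rfl
          · exact absurd (Nat.dvd_one.1 h) h1.one_lt.ne'
          · left; exact hh 2 Nat.prime_two h
        · right; left; exact hh q hq.out h
      · right; right; left; exact hh r hr.out h
    · right; right; right; exact hh s hs.out h
  exact (Finset.card_le_card h).trans Finset.card_le_four

variable {F : Type} [Field F] [NumberField F] [Algebra.IsQuadraticExtension ℚ F]
variable (σ : F ≃ₐ[ℚ] F) (hσ : σ ≠ 1) 
variable {θ : 𝓞 F} (hθ : θ ^ 2 = ((e * q * r * s : ℕ) : 𝓞 F))
include he hq4 hr8 hs8 hrs hσ hθ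

theorem fix_card_four [IsTotallyReal F] : Nat.card (fixS (sC σ)) ∣ 4 := by
  have hsf := D_sqf he hq4 hr8 hs8 hrs
  have hD := D_mod he hq4 hr8 hs8
  obtain ⟨m, h1, h2⟩ := fix_card σ hσ hθ hsf hD
  obtain ⟨m', rfl⟩ := h2 (not_norm σ hσ hθ hsf hD (d := e * r * s) hq4 (by ring))
  have h3 : Nat.card (fixS (sC σ)) * 4 ∣ 4 * 4 := by
    have h4 : 2 ^ (2 * (e * q * r * s)).primeFactors.card ∣ 4 * 4 :=
      pow_dvd_pow 2 (D_pf he)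
    exact (Dvd.intro m' (by ring)).trans (h1.trans h4)
  exact Nat.dvd_of_mul_dvd_mul_right (by norm_num) h3

omit hσ in
theorem exists_M {η : ℕ} (hη : η = 1 ∨ η = 2) : ∃ M : (Ideal (𝓞 F))⁰,
    Ideal.absNorm (M : Ideal (𝓞 F)) = η * q ∧ (M : Ideal (𝓞 F)) ^ 2 = Ideal.span {((η * q : ℕ) : 𝓞 F)} := by
  have hsf := D_sqf he hq4 hr8 hs8 hrs
  have hD := D_mod he hq4 hr8 hs8
  obtain ⟨Q, -, hQ1, hQ2, -⟩ := exists_rp hθ hsf hD q hq.out ⟨2 * (e * r * s), by ring⟩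
  rcases hη with rfl | rfl
  · exact ⟨Q, by rw [hQ1, one_mul], by rw [hQ2, one_mul]⟩
  · obtain ⟨P, -, hP1, hP2, -⟩ := exists_rp hθ hsf hD 2 Nat.prime_two ⟨e * q * r * s, rfl⟩
    refine ⟨P * Q, ?_, ?_⟩
    · rw [Submonoid.coe_mul, map_mul, hP1, hQ1]
    · rw [Submonoid.coe_mul, mul_pow, hP2, hQ2, Ideal.span_singleton_mul_span_singleton, Nat.cast_mul]

omit he hq4 hr8 hs8 hrs hσ hθ hq hr hs [Algebra.IsQuadraticExtension ℚ F] in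
theorem mk0_sq {P : (Ideal (𝓞 F))⁰} {n : 𝓞 F} (h : (P : Ideal (𝓞 F)) ^ 2 = Ideal.span {n}) :
    ClassGroup.mk0 P ^ 2 = 1 := by
  rw [← map_pow, ClassGroup.mk0_eq_one_iff]
  rw [SubmonoidClass.coe_pow, h]
  exact ⟨⟨n, rfl⟩⟩

theorem exists_chars : ∃ χ₁ χ₂ : ClassGroup (𝓞 F) →* ℤˣ,
    (∀ I : (Ideal (𝓞 F))⁰, ((χ₁ (ClassGroup.mk0 I) : ℤˣ) : ℤ) = gf r (e * q * s : ℕ) (Ideal.absNorm (I : Ideal (𝓞 F)))) ∧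
    (∀ I : (Ideal (𝓞 F))⁰, ((χ₂ (ClassGroup.mk0 I) : ℤˣ) : ℤ) = gf s (e * q * r : ℕ) (Ideal.absNorm (I : Ideal (𝓞 F)))) := by
  have hsf := D_sqf he hq4 hr8 hs8 hrs
  have hD := D_mod he hq4 hr8 hs8
  obtain ⟨χ₁, h1⟩ := genus_char σ hσ hθ hsf hD r (by omega) (e * q * s) (by ring)
  obtain ⟨χ₂, h2⟩ := genus_char σ hσ hθ hsf hD s (by omega) (e * q * r) (by ring)
  exact ⟨χ₁, χ₂, h1, h2⟩

omit hσ hθ hrs he [Algebra.IsQuadraticExtension ℚ F] in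
theorem gf_m {η l : ℕ} [hl : Fact l.Prime] (hl8 : l % 8 = 5) (hη : η = 1 ∨ η = 2) (d : ℤ) :
    gf l d (η * q) = legendreSym l (η * q : ℕ) := by
  apply gf_not_dvd
  intro h
  rcases hl.out.dvd_mul.1 h with h | h
  · rcases hη with rfl | rfl
    · exact hl.out.one_lt.ne' (Nat.dvd_one.1 h)
    · have := (Nat.prime_dvd_prime_iff_eq hl.out Nat.prime_two).1 h; omega
  · have := (Nat.prime_dvd_prime_iff_eq hl.out hq.out).1 h; omega

/-- the other field -/
theorem F'_struct [IsTotallyReal F] {η : ℕ} (hη : η = 1 ∨ η = 2)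
    (h1 : legendreSym r (η * q : ℕ) = 1) (h2 : legendreSym s (η * q : ℕ) = 1)
    (h3 : legendreSym r (e * q : ℕ) = -1) (h4 : legendreSym s (e * q : ℕ) = -1) :
    Nat.card (A2 (ClassGroup (𝓞 F))) ∣ 4 ∧ ∃ μ : 𝓞 F, Ideal.span {μ} ^ 2 = Ideal.span {((η * q : ℕ) : 𝓞 F)} := by
  have hsf := D_sqf he hq4 hr8 hs8 hrs
  have hD := D_mod he hq4 hr8 hs8
  have hne := r_ne_s hrs
  obtain ⟨χ₁, χ₂, hχ₁, hχ₂⟩ := exists_chars he hq4 hr8 hs8 hrs σ hσ hθ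
  have hsr : legendreSym r s = 1 := by
    rw [← legendreSym.quadratic_reciprocity_one_mod_four (by omega : r % 4 = 1) (by omega : s ≠ 2)]; exact hrs
  obtain ⟨R, -, hR1, hR2, -⟩ := exists_rp hθ hsf hD r hr.out ⟨2 * (e * q * s), by ring⟩
  obtain ⟨S, -, hS1, hS2, -⟩ := exists_rp hθ hsf hD s hs.out ⟨2 * (e * q * r), by ring⟩
  obtain ⟨M, hM1, hM2⟩ := exists_M he hq4 hr8 hs8 hrs hθ hη
  have hrs' : ¬ s ∣ r := fun h => hne ((Nat.prime_dvd_prime_iff_eq hs.out hr.out).1 h).symm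
  have hsr' : ¬ r ∣ s := fun h => hne ((Nat.prime_dvd_prime_iff_eq hr.out hs.out).1 h)
  obtain ⟨g1, g2⟩ := grp_one χ₁ χ₂ (fixS (sC σ)) (mem_fix_iff σ hσ) (fix_card_four he hq4 hr8 hs8 hrs σ hσ hθ)
    (a := ClassGroup.mk0 R) (b := ClassGroup.mk0 S) (mk0_sq hR2) (mk0_sq hS2)
    (Units.ext (by rw [hχ₁, hR1, gf_self, Nat.cast_mul, legendreSym.mul, h3, hsr]; rfl))
    (Units.ext (by rw [hχ₂, hR1, gf_not_dvd _ _ hrs', hrs]; rfl))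
    (Units.ext (by rw [hχ₁, hS1, gf_not_dvd _ _ hsr', hsr]; rfl))
    (Units.ext (by rw [hχ₂, hS1, gf_self, Nat.cast_mul, legendreSym.mul, h4, hrs]; rfl))
  refine ⟨g2, ?_⟩
  have := g1 (ClassGroup.mk0 M) (mk0_sq hM2)
    (Units.ext (by rw [hχ₁, hM1, gf_m hq4 hr8 hs8 hr8 hη, h1]; rfl))
    (Units.ext (by rw [hχ₂, hM1, gf_m hq4 hr8 hs8 hs8 hη, h2]; rfl))
  rw [ClassGroup.mk0_eq_one_iff] at this
  obtain ⟨μ, hμ⟩ := this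
  refine ⟨μ, ?_⟩
  rw [← hM2, hμ]

/-- the field itself -/
theorem F_struct [IsTotallyReal F]
    (h1 : legendreSym r (e * q : ℕ) = 1)
    (hnp : ∀ a u : 𝓞 F, IsUnit u → a ^ 2 = (e * q : ℕ) * u → False) :
    Nat.card (fixS (sC σ)) = 4 ∧ ∃ P M : (Ideal (𝓞 F))⁰,
      (P : Ideal (𝓞 F)) ^ 2 = Ideal.span {(2 : 𝓞 F)} ∧
      (M : Ideal (𝓞 F)) ^ 2 = Ideal.span {((e * q : ℕ) : 𝓞 F)} ∧
      ∀ c : ClassGroup (𝓞 F), c ^ 2 = 1 → c = 1 ∨ c = ClassGroup.mk0 P ∨ c = ClassGroup.mk0 M ∨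
        c = ClassGroup.mk0 P * ClassGroup.mk0 M := by
  have hsf := D_sqf he hq4 hr8 hs8 hrs
  have hD := D_mod he hq4 hr8 hs8
  obtain ⟨χ₁, χ₂, hχ₁, hχ₂⟩ := exists_chars he hq4 hr8 hs8 hrs σ hσ hθ
  obtain ⟨P, -, hP1, hP2, -⟩ := exists_rp hθ hsf hD 2 Nat.prime_two ⟨e * q * r * s, rfl⟩
  obtain ⟨M, hM1, hM2⟩ := exists_M he hq4 hr8 hs8 hrs hθ he
  have hr2 : ¬ r ∣ 2 := by
    intro h; have := (Nat.prime_dvd_prime_iff_eq hr.out Nat.prime_two).1 h; omega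
  obtain ⟨g1, g2⟩ := grp_two χ₁ (fixS (sC σ)) (mem_fix_iff σ hσ) (fix_card_four he hq4 hr8 hs8 hrs σ hσ hθ)
    (a := ClassGroup.mk0 P) (b := ClassGroup.mk0 M) (mk0_sq hP2) (mk0_sq hM2)
    (Units.ext (by rw [hχ₁, hP1, gf_not_dvd _ _ hr2]; exact leg_two hr8))
    (Units.ext (by rw [hχ₁, hM1, gf_m hq4 hr8 hs8 hr8 he, h1]; rfl))
    (by
      intro h
      rw [ClassGroup.mk0_eq_one_iff] at h
      obtain ⟨μ, hμ⟩ := h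
      have hμ' : (M : Ideal (𝓞 F)) = Ideal.span {μ} := hμ
      rw [hμ', Ideal.span_singleton_pow, Ideal.span_singleton_eq_span_singleton] at hM2
      obtain ⟨u, hu⟩ := hM2.symm
      exact hnp μ u u.isUnit hu.symm)
  exact ⟨g1, P, M, by exact_mod_cast hP2, hM2, g2⟩

end arith
end S4

namespace S4
open nonZeroDivisors

/-- `x` is an iterated square root `√(2+√(2+⋯))` of level `n` (up to conjugation). -/
def IsB {R : Type*} [CommRing R] : ℕ → R → Prop
  | 0, x => x = 0
  | n + 1, x => IsB n (x ^ 2 - 2)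

section isB

theorem IsB.map {R S : Type*} [CommRing R] [CommRing S] (f : R →+* S) {n : ℕ} {x : R} (h : IsB n x) :
    IsB n (f x) := by
  induction n generalizing x with
  | zero => change f x = 0; rw [show x = 0 from h, map_zero]
  | succ n ih =>
    have := ih (x := x ^ 2 - 2) h
    rw [map_sub, map_pow, map_ofNat] at this
    exact this

theorem IsB.of_map {R S : Type*} [CommRing R] [CommRing S] (f : R →+* S) (hf : Function.Injective f)
    {n : ℕ} {x : R} (h : IsB n (f x)) : IsB n x := by
  induction n generalizing x with
  | zero => exact (map_eq_zero_iff f hf).1 h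
  | succ n ih =>
    apply ih (x := x ^ 2 - 2)
    rw [map_sub, map_pow, map_ofNat]
    exact h

theorem IsB.integral {K : Type*} [Field K] {n : ℕ} {x : K} (h : IsB n x) : IsIntegral ℤ x := by
  induction n generalizing x with
  | zero => rw [show x = 0 from h]; exact isIntegral_zero
  | succ n ih =>
    have h1 := ih (x := x ^ 2 - 2) h
    have h2 : IsIntegral ℤ (2 : K) := by
      have := isIntegral_algebraMap (R := ℤ) (A := K) (x := 2); simpa using this
    apply IsIntegral.of_pow (n := 2) (by norm_num)
    have := h1.add h2
    rwa [sub_add_cancel] at this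

theorem IsB.mem {R : Type*} [CommRing R] {I : Ideal R} {n : ℕ} {x : R} (h : IsB n x)
    (hx : x + 2 ∈ I ∨ x - 2 ∈ I) : (2 : R) ∈ I := by
  induction n generalizing x with
  | zero =>
    rw [show x = 0 from h] at hx
    rcases hx with h | h
    · simpa using h
    · simpa using h
  | succ n ih =>
    apply ih h
    right
    rcases hx with h | h
    · rw [show x ^ 2 - 2 - 2 = (x - 2) * (x + 2) by ring]; exact I.mul_mem_left _ h
    · rw [show x ^ 2 - 2 - 2 = (x + 2) * (x - 2) by ring]; exact I.mul_mem_left _ h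

theorem IsB.two_mem {R : Type*} [CommRing R] {I : Ideal R} {n : ℕ} {x : R} (h : IsB (n + 1) x)
    (hx : x ∈ I) : (2 : R) ∈ I := by
  apply IsB.mem (n := n) (x := x ^ 2 - 2) h
  left
  rw [show x ^ 2 - 2 + 2 = x * x by ring]; exact I.mul_mem_left _ hx

theorem IsB.ne_zero {K : Type*} [Field K] [CharZero K] {n : ℕ} {x : K} (h : IsB (n + 1) x) : x ≠ 0 := by
  rintro rfl
  have := IsB.two_mem (I := (⊥ : Ideal K)) h (by simp)
  simp at this

theorem IsB.pow_eq_aux {E : Type*} [Field E] [IsAlgClosed E] (l : ℕ) [hl : Fact l.Prime] [CharP E l] {n : ℕ} {y : E}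
    (hE : IsB n y) (hmod : l % 2 ^ (n + 2) = 1) : y ^ l = y := by
  obtain ⟨z, hz⟩ : ∃ z : E, z ^ 2 - y * z + 1 = 0 := by
    obtain ⟨z, hz⟩ := IsAlgClosed.exists_root (Polynomial.C 1 * Polynomial.X ^ 2 + Polynomial.C (-y) * Polynomial.X + Polynomial.C 1 : Polynomial E)
      (by rw [Polynomial.degree_quadratic one_ne_zero]; norm_num)
    refine ⟨z, ?_⟩
    simp [Polynomial.IsRoot] at hz
    linear_combination hz
  have hz0 : z ≠ 0 := by rintro rfl; simp at hz
  have hy : y = z + z⁻¹ := by field_simp; linear_combination -hz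
  have key : ∀ (m : ℕ) (w : E), w ≠ 0 → IsB m (w + w⁻¹) → w ^ (2 ^ (m + 2)) = 1 := by
    intro m
    induction m with
    | zero =>
      intro w hw h
      have h1 : w + w⁻¹ = 0 := h
      have h2 : w ^ 2 = -1 := by field_simp at h1; linear_combination h1
      rw [zero_add, show 2 ^ 2 = 2 * 2 by norm_num, pow_mul, h2]; ring
    | succ m ih =>
      intro w hw h
      have h1 : IsB m ((w + w⁻¹) ^ 2 - 2) := h
      have h2 : (w + w⁻¹) ^ 2 - 2 = w ^ 2 + (w ^ 2)⁻¹ := by field_simp; ring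
      rw [h2] at h1
      have := ih _ (pow_ne_zero 2 hw) h1
      rw [← pow_mul, ← pow_succ'] at this
      exact this
  rw [hy] at hE
  have h1 := key n z hz0 hE
  have h2 : z ^ l = z := by
    conv_lhs => rw [← Nat.div_add_mod l (2 ^ (n + 2)), hmod, pow_add, pow_mul, h1, one_pow, one_mul, pow_one]
  rw [hy, add_pow_char, inv_pow, h2]

theorem IsB.pow_eq {κ : Type*} [Field κ] (l : ℕ) [hl : Fact l.Prime] [CharP κ l] {n : ℕ} {x : κ} (h : IsB n x)
    (hmod : l % 2 ^ (n + 2) = 1) : x ^ l = x := by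
  haveI : CharP (AlgebraicClosure κ) l := charP_of_injective_algebraMap (algebraMap κ (AlgebraicClosure κ)).injective l
  apply (algebraMap κ (AlgebraicClosure κ)).injective
  rw [map_pow]
  exact IsB.pow_eq_aux l (h.map (algebraMap κ (AlgebraicClosure κ))) hmod

theorem IsB.exists_c {K : Type*} [Field K] [CharZero K] {n : ℕ} {x : K} (h : IsB n x) :
    ∃ c : K, c ^ 2 = 4 - x ^ 2 ∧ ∀ g : K →+* K, g x = x → g c = c := by
  induction n generalizing x with
  | zero =>
    refine ⟨2, by rw [show x = 0 from h]; norm_num, fun g _ => map_ofNat g 2⟩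
  | succ n ih =>
    have hx := IsB.ne_zero h
    obtain ⟨c, hc, hg⟩ := ih (x := x ^ 2 - 2) h
    refine ⟨c / x, ?_, fun g hgx => ?_⟩
    · rw [div_pow, hc]; field_simp; ring
    · rw [map_div₀, hgx, hg g (by rw [map_sub, map_pow, hgx, map_ofNat])]

theorem IsB.gg {K : Type*} [Field K] [CharZero K] {n : ℕ} {y : K} (h : IsB (n + 2) y) (g : K →+* K)
    (hg : g (y ^ 2 - 2) = - (y ^ 2 - 2)) : g (g y) = - y := by
  have h1 : IsB (n + 1) (y ^ 2 - 2) := h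
  have hy0 := IsB.ne_zero h
  have hx0 := IsB.ne_zero h1
  set x := y ^ 2 - 2 with hx
  have h2 : IsB n (x ^ 2 - 2) := h1
  obtain ⟨c, hc, hcg⟩ := h2.exists_c
  have hgc := hcg g (by rw [map_sub, map_pow, hg, map_ofNat, neg_sq])
  have hy2 : y ^ 2 = 2 + x := by rw [hx]; ring
  have hgy2 : (g y) ^ 2 = 2 - x := by rw [← map_pow, hy2, map_add, hg, map_ofNat]; ring
  have h3 : (y * g y * x) ^ 2 = c ^ 2 := by
    rw [hc, mul_pow, mul_pow, hy2, hgy2]; ring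
  have h4 : g (y * g y * x) = y * g y * x := by
    rcases sq_eq_sq_iff_eq_or_eq_neg.1 h3 with h | h
    · rw [h, hgc]
    · rw [h, map_neg, hgc]
  rw [map_mul, map_mul, hg] at h4
  have hgy0 : g y ≠ 0 := (map_ne_zero g).2 hy0
  have h5 : (g y * x) * (g (g y) + y) = 0 := by linear_combination -h4
  rcases mul_eq_zero.1 h5 with h | h
  · exact absurd h (mul_ne_zero hgy0 hx0)
  · exact eq_neg_of_add_eq_zero_left h

end isB

section quad
variable {K L : Type} [Field K] [Field L] [NumberField K] [NumberField L] [Algebra K L]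
variable [Algebra.IsQuadraticExtension K L] (σ : L ≃ₐ[K] L) (hσ : σ ≠ 1)
include hσ

theorem quad_repr {β : 𝓞 L} (hβ : sI σ β = -β) (x : 𝓞 L) : ∃ a b : 𝓞 K,
    2 * β * x = algebraMap (𝓞 K) (𝓞 L) a * β + algebraMap (𝓞 K) (𝓞 L) b := by
  obtain ⟨a, ha⟩ := fix_int σ hσ (x := x + sI σ x) (by rw [map_add, sI_sI σ hσ, add_comm])
  obtain ⟨b, hb⟩ := fix_int σ hσ (x := (x - sI σ x) * β) (by rw [map_mul, map_sub, sI_sI σ hσ, hβ]; ring)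
  exact ⟨a, b, by rw [ha, hb]; ring⟩

theorem field_repr {β : L} (hβ : σ β = -β) (hβ0 : β ≠ 0) (x : L) : ∃ a b : K,
    x = algebraMap K L a * β + algebraMap K L b := by
  obtain ⟨b, hb⟩ := fix_field σ hσ (x := x + σ x) (by rw [map_add, sig_sig σ hσ, add_comm])
  obtain ⟨a, ha⟩ := fix_field σ hσ (x := (x - σ x) / β) (by
    rw [map_div₀, map_sub, sig_sig σ hσ, hβ]; field_simp; ring)
  refine ⟨a / 2, b / 2, ?_⟩
  rw [map_div₀, map_div₀, ha, hb, map_ofNat]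
  field_simp; ring

theorem totally_real_step (hK : IsTotallyReal K) {β : L} (hβ : σ β = -β) (hβ0 : β ≠ 0)
    (h : ∀ φ : L →+* ℂ, (starRingEnd ℂ) (φ β) = φ β) : IsTotallyReal L := by
  refine ⟨fun v => ?_⟩
  rw [← InfinitePlace.mk_embedding v, InfinitePlace.isReal_mk_iff]
  rw [ComplexEmbedding.isReal_iff]
  ext x
  obtain ⟨a, b, rfl⟩ := field_repr σ hσ hβ hβ0 x
  have hr : ∀ a : K, (starRingEnd ℂ) (v.embedding (algebraMap K L a)) = v.embedding (algebraMap K L a) := by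
    intro a
    have := IsTotallyReal.complexEmbedding_isReal (v.embedding.comp (algebraMap K L))
    rw [ComplexEmbedding.isReal_iff] at this
    exact RingHom.congr_fun this a
  change (starRingEnd ℂ) (v.embedding _) = _
  rw [map_add, map_add, map_mul, map_mul, hr, hr, h]

end quad

section good

/-- `p` splits completely (weak form). -/
def Good (l : ℕ) (L : Type) [Field L] [NumberField L] : Prop :=
  ∀ P : Ideal (𝓞 L), P.IsPrime → (l : 𝓞 L) ∈ P → ∀ x : 𝓞 L, x ^ l - x ∈ P

theorem good_rat (l : ℕ) [hl : Fact l.Prime] : Good l ℚ := by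
  intro P hP hl' x
  obtain ⟨n, rfl⟩ : ∃ n : ℤ, x = n := ⟨Rat.ringOfIntegersEquiv x, by
    apply Rat.ringOfIntegersEquiv.injective; simp⟩
  have h1 : (l : ℤ) ∣ n ^ l - n := by
    rw [← ZMod.intCast_zmod_eq_zero_iff_dvd]; push_cast
    rw [ZMod.pow_card, sub_self]
  obtain ⟨k, hk⟩ := h1
  have : ((n : 𝓞 ℚ) ^ l - n) = l * k := by exact_mod_cast congrArg (fun z : ℤ => (z : 𝓞 ℚ)) hk
  rw [this]
  exact Ideal.mul_mem_right _ _ hl'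

variable {K L : Type} [Field K] [Field L] [NumberField K] [NumberField L] [Algebra K L]
variable [Algebra.IsQuadraticExtension K L] (σ : L ≃ₐ[K] L) (hσ : σ ≠ 1)
include hσ

theorem good_step {l : ℕ} [hl : Fact l.Prime] (hK : Good l K) {β : 𝓞 L} (hβ : sI σ β = -β)
    (h1 : ∀ P : Ideal (𝓞 L), P.IsPrime → (l : 𝓞 L) ∈ P → β ^ l - β ∈ P)
    (h2 : ∀ P : Ideal (𝓞 L), P.IsPrime → (l : 𝓞 L) ∈ P → 2 * β ∉ P) : Good l L := by
  intro P hP hlP x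
  haveI := hP
  obtain ⟨a, b, hab⟩ := quad_repr σ hσ hβ x
  haveI : CharP (𝓞 L ⧸ P) l := by
    have h0 : (l : 𝓞 L ⧸ P) = 0 := by
      rw [← map_natCast (Ideal.Quotient.mk P)]; exact Ideal.Quotient.eq_zero_iff_mem.2 hlP
    exact (CharP.charP_iff_prime_eq_zero hl.out).2 h0
  have hf : ∀ z : 𝓞 L, z ^ l - z ∈ P ↔ (Ideal.Quotient.mk P z) ^ l = Ideal.Quotient.mk P z := by
    intro z; rw [← Ideal.Quotient.eq_zero_iff_mem, map_sub, map_pow, sub_eq_zero]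
  have hcom : ∀ a : 𝓞 K, (Ideal.Quotient.mk P (algebraMap (𝓞 K) (𝓞 L) a)) ^ l = Ideal.Quotient.mk P (algebraMap (𝓞 K) (𝓞 L) a) := by
    intro a
    rw [← hf]
    have := hK (P.comap (algebraMap (𝓞 K) (𝓞 L))) (Ideal.comap_isPrime _ _) (by
      rw [Ideal.mem_comap, map_natCast]; exact hlP) a
    rw [Ideal.mem_comap, map_sub, map_pow] at this
    exact this
  have hβ' := (hf β).1 (h1 P hP hlP)
  have h2' : Ideal.Quotient.mk P (2 * β) ≠ 0 := by
    rw [Ne, Ideal.Quotient.eq_zero_iff_mem]; exact h2 P hP hlP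
  rw [hf]
  have h3 := congrArg (fun z => (Ideal.Quotient.mk P z) ^ l) hab
  have h4 := congrArg (fun z => (Ideal.Quotient.mk P z)) hab
  simp only [map_add, map_mul] at h3 h4
  rw [add_pow_char, mul_pow (Ideal.Quotient.mk P _) (Ideal.Quotient.mk P β), hcom, hcom, hβ', ← h4, mul_pow, mul_pow, hβ'] at h3
  have h5 : (Ideal.Quotient.mk P 2) ^ l = Ideal.Quotient.mk P 2 := by
    have := hcom 2; rwa [map_ofNat] at this
  rw [h5] at h3
  rw [map_mul] at h2'
  exact mul_left_cancel₀ h2' h3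

end good
end S4

namespace S4
open nonZeroDivisors

section dirichlet

theorem exists_leg (p : ℕ) [hp : Fact p.Prime] (hp2 : p ≠ 2) (e : ℤˣ) :
    ∃ a : ℕ, a.Coprime p ∧ legendreSym p a = e := by
  rcases Int.units_eq_one_or e with rfl | rfl
  · exact ⟨1, by simp, by simp⟩
  · obtain ⟨a, ha⟩ := FiniteField.exists_nonsquare (F := ZMod p) (by rwa [ZMod.ringChar_zmod_n])
    have h1 : legendreSym p (a.val : ℕ) = -1 := by
      rw [legendreSym.eq_neg_one_iff]
      simpa using ha
    refine ⟨a.val, ?_, by simpa using h1⟩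
    rw [Nat.coprime_comm, hp.out.coprime_iff_not_dvd]
    intro hd
    rw [(legendreSym.eq_zero_iff p _).2 (by simpa using (ZMod.natCast_eq_zero_iff _ _).2 hd)] at h1
    norm_num at h1

theorem leg_modEq {p a b : ℕ} [hp : Fact p.Prime] (h : a ≡ b [MOD p]) :
    legendreSym p a = legendreSym p b := by
  rw [legendreSym.mod p a, legendreSym.mod p b]
  congr 1
  exact_mod_cast h

theorem exists_ell {e q r s : ℕ} [hq : Fact q.Prime] [hr : Fact r.Prime] [hs : Fact s.Prime]
    (he : e = 1 ∨ e = 2)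
    (hq4 : q % 4 = 3) (hr8 : r % 8 = 5) (hs8 : s % 8 = 5) (hrs : legendreSym s r = 1)
    (n : ℕ) (e₁ e₂ : ℤˣ) : ∃ l : ℕ, l.Prime ∧ l % 2 ^ (n + 3) = 1 ∧ r < l ∧ s < l ∧ e * q * r * s < l ∧
      legendreSym r l = e₁ ∧ legendreSym s l = e₂ ∧ ∀ _ : Fact l.Prime, legendreSym l (e * q * r * s : ℕ) = 1 := by
  have hne := r_ne_s hrs
  have h1 : Nat.Coprime q r := (Nat.coprime_primes hq.out hr.out).2 (by rintro rfl; omega)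
  have h2 : Nat.Coprime q s := (Nat.coprime_primes hq.out hs.out).2 (by rintro rfl; omega)
  have h3 : Nat.Coprime r s := (Nat.coprime_primes hr.out hs.out).2 hne
  have hc2 : ∀ p : ℕ, p % 2 = 1 → Nat.Coprime p (2 ^ (n + 3)) := by
    intro p hp
    exact Nat.Coprime.pow_right _ (Nat.coprime_two_right.2 (Nat.odd_iff.2 hp))
  obtain ⟨a, ha, hal⟩ := exists_leg r (by rintro rfl; omega) e₁
  obtain ⟨b, hb, hbl⟩ := exists_leg s (by rintro rfl; omega) e₂
  obtain ⟨c, hc, hcl⟩ := exists_leg q (by rintro rfl; omega) (e₁ * e₂)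
  obtain ⟨x, hx1, hx2⟩ := Nat.chineseRemainder h3 a b
  obtain ⟨y, hy1, hy2⟩ := Nat.chineseRemainder (h1.symm.mul_left h2.symm) x c
  obtain ⟨z, hz1, hz2⟩ := Nat.chineseRemainder (n := r * s * q) (m := 2 ^ (n + 3))
    (((hc2 r (by omega)).mul_left (hc2 s (by omega))).mul_left (hc2 q (by omega))) y 1
  have hzq : z ≡ c [MOD q] := (Nat.ModEq.of_mul_left _ hz1).trans hy2
  have hzrs : z ≡ x [MOD (r * s)] := (Nat.ModEq.of_mul_right _ hz1).trans hy1
  have hzr : z ≡ a [MOD r] := (Nat.ModEq.of_mul_right _ hzrs).trans hx1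
  have hzs : z ≡ b [MOD s] := (Nat.ModEq.of_mul_left _ hzrs).trans hx2
  have hcop : Nat.Coprime z (r * s * q * 2 ^ (n + 3)) := by
    refine Nat.Coprime.mul_right (Nat.Coprime.mul_right (Nat.Coprime.mul_right ?_ ?_) ?_) ?_
    · rw [Nat.Coprime, hzr.gcd_eq]; exact ha
    · rw [Nat.Coprime, hzs.gcd_eq]; exact hb
    · rw [Nat.Coprime, hzq.gcd_eq]; exact hc
    · rw [Nat.Coprime, hz2.gcd_eq]; simp
  obtain ⟨l, hlgt, hlp, hl⟩ := Nat.forall_exists_prime_gt_and_modEq (r + s + e * q * r * s) (q := r * s * q * 2 ^ (n + 3)) (a := z)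
    (by have := hr.out.pos; have := hs.out.pos; have := hq.out.pos; positivity) hcop
  have hl2 : l ≡ 1 [MOD 2 ^ (n + 3)] := (Nat.ModEq.of_mul_left _ hl).trans hz2
  have hl' : l ≡ z [MOD r * s * q] := Nat.ModEq.of_mul_right _ hl
  have hlq : l ≡ c [MOD q] := (Nat.ModEq.of_mul_left _ hl').trans hzq
  have hl'' : l ≡ z [MOD r * s] := Nat.ModEq.of_mul_right _ hl'
  have hlr : l ≡ a [MOD r] := (Nat.ModEq.of_mul_right _ hl'').trans hzr
  have hls : l ≡ b [MOD s] := (Nat.ModEq.of_mul_left _ hl'').trans hzs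
  have hmod : l % 2 ^ (n + 3) = 1 := by
    have := hl2
    rw [Nat.ModEq, Nat.mod_eq_of_lt (a := 1) (Nat.one_lt_two_pow (by omega))] at this
    exact this
  have hl8 : l % 8 = 1 := by
    have : l ≡ 1 [MOD 8] := hl2.of_dvd ⟨2 ^ n, by rw [pow_add]; ring⟩
    exact this
  have hLr : legendreSym r l = e₁ := by rw [leg_modEq hlr, hal]
  have hLs : legendreSym s l = e₂ := by rw [leg_modEq hls, hbl]
  have hLq : legendreSym q l = e₁ * e₂ := by rw [leg_modEq hlq, hcl]; push_cast; rfl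
  refine ⟨l, hlp, hmod, by omega, by omega, by omega, hLr, hLs, fun hF => ?_⟩
  haveI := hF
  have k1 : legendreSym l r = e₁ := by
    rw [← hLr]; exact (legendreSym.quadratic_reciprocity_one_mod_four (by omega) (by rintro rfl; omega)).symm
  have k2 : legendreSym l s = e₂ := by
    rw [← hLs]; exact (legendreSym.quadratic_reciprocity_one_mod_four (by omega) (by rintro rfl; omega)).symm
  have k3 : legendreSym l q = e₁ * e₂ := by
    rw [← hLq]; exact (legendreSym.quadratic_reciprocity_one_mod_four (by omega) (by rintro rfl; omega)).symm
  have k4 : legendreSym l e = 1 := by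
    rcases he with rfl | rfl
    · simp
    · have : legendreSym l 2 = 1 := by
        rw [legendreSym.at_two (by rintro rfl; omega), ZMod.χ₈_nat_eq_if_mod_eight, if_neg (by omega), if_pos (by omega)]
      simpa using this
  push_cast
  rw [legendreSym.mul, legendreSym.mul, legendreSym.mul, k1, k2, k3, k4]
  rcases Int.units_eq_one_or e₁ with rfl | rfl <;> rcases Int.units_eq_one_or e₂ with rfl | rfl <;> simp

end dirichlet

section surj

theorem nat_not_mem {L : Type} [Field L] [NumberField L] {P : Ideal (𝓞 L)} (hP : P.IsPrime) {l m : ℕ} (hc : Nat.Coprime l m)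
    (hl : (l : 𝓞 L) ∈ P) : (m : 𝓞 L) ∉ P := by
  intro hm
  apply hP.ne_top
  rw [Ideal.eq_top_iff_one]
  have hb := Nat.gcd_eq_gcd_ab l m
  rw [hc] at hb
  have : (1 : 𝓞 L) = l * (Nat.gcdA l m) + m * (Nat.gcdB l m) := by exact_mod_cast congrArg (fun z : ℤ => (z : 𝓞 L)) hb
  rw [this]
  exact P.add_mem (P.mul_mem_right _ hl) (P.mul_mem_right _ hm)

theorem good_base {F : Type} [Field F] [NumberField F] [Algebra.IsQuadraticExtension ℚ F]
    (σ : F ≃ₐ[ℚ] F) (hσ : σ ≠ 1) {D : ℕ} {θ : 𝓞 F} (hθ : θ ^ 2 = (D : 𝓞 F)) (hs : sI σ θ = - θ)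
    {l : ℕ} [hl : Fact l.Prime] (hlD : Nat.Coprime l (2 * D)) (hL : legendreSym l D = 1) : Good l F := by
  refine good_step σ hσ (good_rat l) hs (fun P hP hlP => ?_) (fun P hP hlP h => ?_)
  · have h1 : (l : ℤ) ∣ (D : ℤ) ^ (l / 2) - 1 := by
      rw [← ZMod.intCast_zmod_eq_zero_iff_dvd]; push_cast
      have := legendreSym.eq_pow l D
      rw [hL] at this
      rw [sub_eq_zero]; simpa using this.symm
    obtain ⟨k, hk⟩ := h1
    have hodd : l % 2 = 1 := by
      rcases hl.out.eq_two_or_odd with rfl | h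
      · exact absurd (Nat.Coprime.coprime_dvd_right (dvd_mul_right 2 D) hlD) (by decide)
      · exact h
    have h2 : ((D : 𝓞 F) ^ (l / 2) - 1) = l * k := by exact_mod_cast congrArg (fun z : ℤ => (z : 𝓞 F)) hk
    have h3 : θ ^ l - θ = ((D : 𝓞 F) ^ (l / 2) - 1) * θ := by
      conv_lhs => rw [← Nat.div_add_mod l 2, hodd, pow_add, pow_mul, hθ]
      ring
    rw [h3, h2]
    exact P.mul_mem_right _ (P.mul_mem_right _ hlP)
  · apply nat_not_mem hP hlD hlP
    have : ((2 * D : ℕ) : 𝓞 F) = θ * (2 * θ) := by push_cast; rw [← hθ]; ring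
    rw [this]
    exact P.mul_mem_left _ h

theorem good_isB {K L : Type} [Field K] [Field L] [NumberField K] [NumberField L] [Algebra K L]
    [Algebra.IsQuadraticExtension K L] (σ : L ≃ₐ[K] L) (hσ : σ ≠ 1) {n l : ℕ} [hl : Fact l.Prime] (hK : Good l K)
    {β : 𝓞 L} (hβ : sI σ β = -β) (hB : IsB (n + 1) β) (hmod : l % 2 ^ (n + 3) = 1) : Good l L := by
  have hodd : Nat.Coprime l 2 := by
    rw [Nat.coprime_two_right, Nat.odd_iff]
    have h2 : (2 : ℕ) ∣ 2 ^ (n + 3) := dvd_pow_self 2 (by omega)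
    rw [← Nat.mod_mod_of_dvd l h2, hmod]
  refine good_step σ hσ hK hβ (fun P hP hlP => ?_) (fun P hP hlP h => ?_)
  · haveI := hP
    have hP0 : P ≠ ⊥ := by
      rintro rfl
      rw [Ideal.mem_bot] at hlP
      exact hl.out.ne_zero (by exact_mod_cast hlP)
    haveI : P.IsMaximal := hP.isMaximal hP0
    letI := Ideal.Quotient.field P
    haveI : CharP (𝓞 L ⧸ P) l := by
      have h0 : (l : 𝓞 L ⧸ P) = 0 := by
        rw [← map_natCast (Ideal.Quotient.mk P)]; exact Ideal.Quotient.eq_zero_iff_mem.2 hlP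
      exact (CharP.charP_iff_prime_eq_zero hl.out).2 h0
    have := IsB.pow_eq l (hB.map (Ideal.Quotient.mk P)) hmod
    rw [← Ideal.Quotient.eq_zero_iff_mem, map_sub, map_pow, sub_eq_zero]
    exact this
  · have h2 : ((2 : ℕ) : 𝓞 L) ∉ P := nat_not_mem hP hodd hlP
    rcases hP.mem_or_mem h with h | h
    · exact h2 (by exact_mod_cast h)
    · exact h2 (by exact_mod_cast hB.two_mem h)

theorem good_prime {L : Type} [Field L] [NumberField L] {l : ℕ} [hl : Fact l.Prime] (hL : Good l L) :
    ∃ P : (Ideal (𝓞 L))⁰, Ideal.absNorm (P : Ideal (𝓞 L)) = l := by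
  have hnu : ¬ IsUnit (l : 𝓞 L) := by
    intro h
    have h1 := Algebra.norm_algebraMap (S := 𝓞 L) (l : ℤ)
    have h2 := h.map (Algebra.norm ℤ)
    rw [show (l : 𝓞 L) = algebraMap ℤ (𝓞 L) l by simp, h1, isUnit_pow_iff (Module.finrank_pos.ne')] at h2
    have := Int.isUnit_iff.1 h2
    have := hl.out.one_lt
    omega
  obtain ⟨P, hP, hlP⟩ := exists_max_ideal_of_mem_nonunits (a := (l : 𝓞 L)) hnu
  have hP0 : P ≠ ⊥ := by
    rintro rfl
    rw [Ideal.mem_bot] at hlP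
    exact hl.out.ne_zero (by exact_mod_cast hlP)
  refine ⟨⟨P, mem_nonZeroDivisors_iff_ne_zero.2 hP0⟩, ?_⟩
  change Ideal.absNorm P = l
  letI := Ideal.Quotient.field P
  haveI hfin : Finite (𝓞 L ⧸ P) := Ideal.finiteQuotientOfFreeOfNeBot P hP0
  haveI : CharP (𝓞 L ⧸ P) l := by
    have h0 : (l : 𝓞 L ⧸ P) = 0 := by
      rw [← map_natCast (Ideal.Quotient.mk P)]; exact Ideal.Quotient.eq_zero_iff_mem.2 hlP
    exact (CharP.charP_iff_prime_eq_zero hl.out).2 h0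
  rw [Ideal.absNorm_apply, Submodule.cardQuot_apply]
  apply le_antisymm
  · have hcard : ((Polynomial.X ^ l - Polynomial.X : Polynomial (𝓞 L ⧸ P))).natDegree = l :=
      FiniteField.X_pow_card_sub_X_natDegree_eq _ hl.out.one_lt
    have hne := FiniteField.X_pow_card_sub_X_ne_zero (𝓞 L ⧸ P) hl.out.one_lt
    letI := Fintype.ofFinite (𝓞 L ⧸ P)
    have h1 : (Finset.univ : Finset (𝓞 L ⧸ P)).val ≤ (Polynomial.X ^ l - Polynomial.X : Polynomial (𝓞 L ⧸ P)).roots := by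
      rw [Finset.val_le_iff_val_subset]
      intro x _
      rw [Polynomial.mem_roots hne]
      obtain ⟨x, rfl⟩ := Ideal.Quotient.mk_surjective x
      have := hL P hP.isPrime hlP x
      simp only [Polynomial.IsRoot, Polynomial.eval_sub, Polynomial.eval_pow, Polynomial.eval_X]
      rw [← map_pow, ← map_sub]
      exact Ideal.Quotient.eq_zero_iff_mem.2 this
    have h2 := Multiset.card_le_card h1
    have h3 := Polynomial.card_roots' (Polynomial.X ^ l - Polynomial.X : Polynomial (𝓞 L ⧸ P))
    rw [hcard] at h3
    rw [Nat.card_eq_fintype_card]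
    exact h2.trans h3
  · apply Nat.le_of_dvd Nat.card_pos
    letI := Fintype.ofFinite (𝓞 L ⧸ P)
    rw [Nat.card_eq_fintype_card]
    obtain ⟨n, -, hn⟩ := FiniteField.card (𝓞 L ⧸ P) l
    rw [hn]
    exact dvd_pow_self l n.ne_zero

theorem norm_surj {e q r s : ℕ} [hq : Fact q.Prime] [hr : Fact r.Prime] [hs : Fact s.Prime]
    (he : e = 1 ∨ e = 2)
    (hq4 : q % 4 = 3) (hr8 : r % 8 = 5) (hs8 : s % 8 = 5) (hrs : legendreSym s r = 1)
    {F : Type} [Field F] [NumberField F] [Algebra.IsQuadraticExtension ℚ F]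
    (σ : F ≃ₐ[ℚ] F) (hσ : σ ≠ 1)
    {θ : 𝓞 F} (hθ : θ ^ 2 = ((e * q * r * s : ℕ) : 𝓞 F))
    (hc : Nat.card (fixS (sC σ)) = 4) (h8 : Nat.card (A2 (ClassGroup (𝓞 F))) = 8)
    {L : Type} [Field L] [NumberField L] [Algebra F L] (n : ℕ)
    (hgood : ∀ l : ℕ, l.Prime → l % 2 ^ (n + 3) = 1 → e * q * r * s < l →
      (∀ _ : Fact l.Prime, legendreSym l (e * q * r * s : ℕ) = 1) → Good l L) :
    ∀ c ∈ A2 (ClassGroup (𝓞 F)), ∃ x ∈ A2 (ClassGroup (𝓞 L)), rC F L x = c := by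
  obtain ⟨χ₁, χ₂, h1, h2⟩ := exists_chars he hq4 hr8 hs8 hrs σ hσ hθ
  have key : ∀ e₁ e₂ : ℤˣ, ∃ x, χ₁ (rC F L x) = e₁ ∧ χ₂ (rC F L x) = e₂ := by
    intro e₁ e₂
    obtain ⟨l, hlp, hmod, hrl, hsl, hDl, hl1, hl2, hlD⟩ := exists_ell he hq4 hr8 hs8 hrs n e₁ e₂
    haveI : Fact l.Prime := ⟨hlp⟩
    obtain ⟨P, hP⟩ := good_prime (hgood l hlp hmod hDl hlD)
    have hN : Ideal.absNorm ((idN F L P : (Ideal (𝓞 F))⁰) : Ideal (𝓞 F)) = l := by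
      rw [coe_idN, Ideal.absNorm_relNorm, hP]
    refine ⟨ClassGroup.mk0 P, ?_, ?_⟩
    · apply Units.ext
      rw [rC_mk0, h1, hN, gf_not_dvd, hl1]
      intro h
      have := (Nat.prime_dvd_prime_iff_eq hr.out hlp).1 h
      omega
    · apply Units.ext
      rw [rC_mk0, h2, hN, gf_not_dvd, hl2]
      intro h
      have := (Nat.prime_dvd_prime_iff_eq hs.out hlp).1 h
      omega
  have hN : (A2 (ClassGroup (𝓞 L))).map (rC F L) = A2 (ClassGroup (𝓞 F)) := by
    refine grp_three χ₁ χ₂ (fixS (sC σ)) (mem_fix_iff σ hσ) hc h8 _ ?_ ?_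
    · rintro _ ⟨x, hx, rfl⟩
      exact map_mem_A2 _ hx
    · intro e₁ e₂
      obtain ⟨x, hx1, hx2⟩ := key e₁ e₂
      obtain ⟨m, hm, hmA⟩ := exists_odd_pow (ClassGroup (𝓞 L))
      have hodd : ∀ e : ℤˣ, e ^ m = e := by
        intro e
        rcases Int.units_eq_one_or e with rfl | rfl
        · simp
        · exact hm.neg_one_pow
      exact ⟨rC F L (x ^ m), ⟨_, hmA x, rfl⟩, by rw [map_pow, map_pow, hx1, hodd], by rw [map_pow, map_pow, hx2, hodd]⟩
  intro c hc'
  rw [← hN] at hc'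
  exact hc'

end surj
end S4

namespace S4
open nonZeroDivisors

section comp
variable {K₁ K₂ K₃ L : Type} [Field K₁] [Field K₂] [Field K₃] [Field L] [NumberField K₁] [NumberField K₂]
  [NumberField K₃] [NumberField L] [Algebra K₁ L] [Algebra K₂ L] [Algebra K₃ L]
  (σ₁ : L ≃ₐ[K₁] L) (σ₂ : L ≃ₐ[K₂] L) (σ₃ : L ≃ₐ[K₃] L)

theorem map_comp3 (h : ∀ x, σ₁ (σ₂ x) = σ₃ x) (I : Ideal (𝓞 L)) :
    (I.map (sI σ₂)).map (sI σ₁) = I.map (sI σ₃) := by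
  rw [Ideal.map_map]
  congr 1
  ext x
  exact h x

theorem sC_comp3 (h : ∀ x, σ₁ (σ₂ x) = σ₃ x) (c : ClassGroup (𝓞 L)) : sC σ₁ (sC σ₂ c) = sC σ₃ c := by
  induction c using cl_ind with
  | h I =>
    simp only [sC, clMap_mk0]
    congr 1
    apply Subtype.ext
    simp only [coe_idMap]
    exact map_comp3 σ₁ σ₂ σ₃ h I

theorem map_sI_inj {I J : Ideal (𝓞 L)} (h : I.map (sI σ₁) = J.map (sI σ₁)) : I = J := by
  have := congrArg (Ideal.map (sI σ₁⁻¹)) h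
  rwa [map_sI_comp, map_sI_comp, inv_mul_cancel, map_sI_one, map_sI_one] at this

end comp

section sqinj

theorem ideal_sq_inj {L : Type} [Field L] [NumberField L] {I J : Ideal (𝓞 L)} (hI : I ≠ ⊥) (hJ : J ≠ ⊥)
    (h : I ^ 2 = J ^ 2) : I = J := by
  classical
  have h1 := congrArg UniqueFactorizationMonoid.normalizedFactors h
  rw [UniqueFactorizationMonoid.normalizedFactors_pow, UniqueFactorizationMonoid.normalizedFactors_pow] at h1
  have h2 : UniqueFactorizationMonoid.normalizedFactors I = UniqueFactorizationMonoid.normalizedFactors J := by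
    ext a
    have := congrArg (Multiset.count a) h1
    rw [Multiset.count_nsmul, Multiset.count_nsmul] at this
    omega
  rw [← Ideal.prod_normalizedFactors_eq_self hI, h2, Ideal.prod_normalizedFactors_eq_self hJ]

theorem jC_kill {K L : Type} [Field K] [Field L] [NumberField K] [NumberField L] [Algebra K L]
    {P : (Ideal (𝓞 K))⁰} {x : 𝓞 K} {y : 𝓞 L} (hP : (P : Ideal (𝓞 K)) ^ 2 = Ideal.span {x})
    (hy : Ideal.span {y} ^ 2 = Ideal.span {algebraMap (𝓞 K) (𝓞 L) x}) : jC K L (ClassGroup.mk0 P) = 1 := by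
  have hP0 := ideal_ne_zero P
  have h0 : (P : Ideal (𝓞 K)).map (algebraMap (𝓞 K) (𝓞 L)) ≠ ⊥ := by
    rw [Ne, Ideal.map_eq_bot_iff_of_injective alg_inj]; exact hP0
  have h1 : ((P : Ideal (𝓞 K)).map (algebraMap (𝓞 K) (𝓞 L))) ^ 2 = Ideal.span {y} ^ 2 := by
    rw [← Ideal.map_pow, hP, Ideal.map_span, Set.image_singleton, hy]
  have h2 : Ideal.span {y} ≠ ⊥ := by
    intro h
    rw [h] at h1
    have h3 : ((P : Ideal (𝓞 K)).map (algebraMap (𝓞 K) (𝓞 L))) ^ 2 = 0 := by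
      rw [h1, ← Ideal.zero_eq_bot]; exact zero_pow two_ne_zero
    exact h0 (pow_eq_zero_iff two_ne_zero |>.1 h3)
  rw [jC, clMap_mk0, ClassGroup.mk0_eq_one_iff, coe_idMap, ideal_sq_inj h0 h2 h1]
  exact ⟨⟨y, rfl⟩⟩

end sqinj

section U2

/-- There is only one prime above `2`. -/
def U2 (L : Type) [Field L] [NumberField L] : Prop :=
  ∀ P Q : Ideal (𝓞 L), P.IsPrime → Q.IsPrime → 2 ∈ P → 2 ∈ Q → P = Q

theorem exists_two (L : Type) [Field L] [NumberField L] :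
    ∃ P : (Ideal (𝓞 L))⁰, (P : Ideal (𝓞 L)).IsPrime ∧ (2 : 𝓞 L) ∈ (P : Ideal (𝓞 L)) := by
  have hnu : ¬ IsUnit (2 : 𝓞 L) := by
    intro h
    have h1 := Algebra.norm_algebraMap (S := 𝓞 L) (2 : ℤ)
    have h2 := h.map (Algebra.norm ℤ)
    rw [show (2 : 𝓞 L) = algebraMap ℤ (𝓞 L) 2 by simp, h1, isUnit_pow_iff (Module.finrank_pos.ne')] at h2
    have := Int.isUnit_iff.1 h2
    omega
  obtain ⟨P, hP, hlP⟩ := exists_max_ideal_of_mem_nonunits (a := (2 : 𝓞 L)) hnu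
  have hP0 : P ≠ ⊥ := by
    rintro rfl
    rw [Ideal.mem_bot] at hlP
    exact two_ne_zero hlP
  exact ⟨⟨P, mem_nonZeroDivisors_iff_ne_zero.2 hP0⟩, hP.isPrime, hlP⟩

theorem ne_bot_of_two {L : Type} [Field L] [NumberField L] {P : Ideal (𝓞 L)} (h : (2 : 𝓞 L) ∈ P) : P ≠ ⊥ := by
  rintro rfl
  rw [Ideal.mem_bot] at h
  exact two_ne_zero h

theorem two_mem_map {K L : Type} [Field K] [Field L] [NumberField K] [NumberField L] [Algebra K L] (σ : L ≃ₐ[K] L)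
    {P : Ideal (𝓞 L)} (h : (2 : 𝓞 L) ∈ P) : (2 : 𝓞 L) ∈ P.map (sI σ) := by
  rw [mem_map_sI, map_ofNat]; exact h

theorem U2_rat {F : Type} [Field F] [NumberField F] [Algebra.IsQuadraticExtension ℚ F] {D : ℕ} {θ : 𝓞 F}
    (hθ : θ ^ 2 = (D : 𝓞 F)) (hsf : Squarefree D) (hD : D % 4 = 2 ∨ D % 4 = 3) : U2 F := by
  obtain ⟨P, -, -, -, h⟩ := exists_rp hθ hsf hD 2 Nat.prime_two (dvd_mul_right _ _)
  intro I J hI hJ h2 h2'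
  rw [h I hI (by exact_mod_cast h2), h J hJ (by exact_mod_cast h2')]

variable {K L : Type} [Field K] [Field L] [NumberField K] [NumberField L] [Algebra K L]
    [Algebra.IsQuadraticExtension K L] (σ : L ≃ₐ[K] L) (hσ : σ ≠ 1)
include hσ

theorem U2_two (hK : U2 K) {P Q : Ideal (𝓞 L)} (hP : P.IsPrime) (hQ : Q.IsPrime) (h2P : 2 ∈ P) (h2Q : 2 ∈ Q) :
    Q = P ∨ Q = P.map (sI σ) := by
  refine primes_over σ hσ hP (ne_bot_of_two h2P) hQ (le_of_eq (hK _ _ (Ideal.comap_isPrime _ _) (Ideal.comap_isPrime _ _) ?_ ?_))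
  · rw [Ideal.mem_comap, map_ofNat]; exact h2P
  · rw [Ideal.mem_comap, map_ofNat]; exact h2Q

theorem U2_step {F : Type} [Field F] [NumberField F] [Algebra F L] (hK : U2 K) (τ : L ≃ₐ[F] L)
    (hτ : ∀ x, τ (τ x) = σ x) : U2 L := by
  have key : ∀ P : Ideal (𝓞 L), P.IsPrime → 2 ∈ P → P.map (sI σ) = P := by
    intro P hP h2
    rw [← map_comp3 τ τ σ hτ]
    haveI := hP
    rcases U2_two σ hσ hK hP (isPrime_map_sI τ P) h2 (two_mem_map τ h2) with h | h
    · rw [h, h]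
    · rw [← map_comp3 τ τ σ hτ] at h
      have := map_sI_inj τ h
      rw [← this, ← this]
  intro P Q hP hQ h2P h2Q
  rcases U2_two σ hσ hK hP hQ h2P h2Q with h | h
  · exact h.symm
  · rw [h, key P hP h2P]

theorem chev_U2 [IsTotallyReal K] [IsTotallyReal L] (hL : U2 L) (α : 𝓞 L) (hα : sI σ α = -α)
    (hα2 : ∀ P : Ideal (𝓞 L), P.IsPrime → α ∈ P → 2 ∈ P) :
    Nat.card (fixS (sC σ) ⊓ A2 (ClassGroup (𝓞 L)) : Subgroup _) ∣ Nat.card (A2 (ClassGroup (𝓞 K))) := by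
  obtain ⟨R, hR, h2R⟩ := exists_two L
  haveI := hR
  obtain ⟨m, hm, -⟩ := chev_bound σ hσ (Finset.univ : Finset Unit) (fun _ => R) α
    (by have := congrArg (fun z : 𝓞 L => (z : L)) hα; simpa using this)
    (fun _ _ => hL _ _ (isPrime_map_sI σ _) hR (two_mem_map σ h2R) h2R)
    (fun P hP hP0 h => ⟨(), Finset.mem_univ _, hL _ _ hP hR (by
      rcases hP.mem_or_mem h with h | h
      · exact h
      · exact hα2 P hP h) h2R⟩)
  have h1 : Nat.card (fixS (sC σ)) ∣ Nat.card (ClassGroup (𝓞 K)) := by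
    rw [Finset.card_univ, Fintype.card_unit, pow_one] at hm
    rw [show Nat.card (fixS (sC σ)) * (2 * m) = 2 * (Nat.card (fixS (sC σ)) * m) by ring] at hm
    exact (dvd_mul_right _ _).trans (Nat.dvd_of_mul_dvd_mul_left (by norm_num) hm)
  rw [card_A2 (ClassGroup (𝓞 K))]
  exact card_dvd_of_le_A2 inf_le_right Nat.card_pos.ne'
    ((Subgroup.card_dvd_of_le inf_le_left).trans h1)

end U2

section step

theorem sC_inv {K L : Type} [Field K] [Field L] [NumberField K] [NumberField L] [Algebra K L]
    [Algebra.IsQuadraticExtension K L] (σ : L ≃ₐ[K] L) (hσ : σ ≠ 1) (c : ClassGroup (𝓞 L)) :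
    sC σ (sC σ c) = c := by
  rw [sC_sC, gal_sq σ hσ, sC_one]

theorem A2_eq_of_surj {G H : Type} [CommGroup G] [CommGroup H] [Finite G] [Finite H] (f : G →* H)
    (hf : ∀ c ∈ A2 H, ∃ x ∈ A2 G, f x = c) (hle : Nat.card (A2 G) ≤ Nat.card (A2 H)) :
    Nat.card (A2 G) = Nat.card (A2 H) ∧ Nonempty (A2 G ≃* A2 H) := by
  let g : A2 G →* A2 H := (f.comp (A2 G).subtype).codRestrict (A2 H) (fun x => map_mem_A2 f x.2)
  have hg : Function.Surjective g := by
    rintro ⟨c, hc⟩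
    obtain ⟨x, hx, rfl⟩ := hf c hc
    exact ⟨⟨x, hx⟩, rfl⟩
  have h1 := Nat.card_le_card_of_surjective g hg
  have h2 : Nat.card (A2 G) = Nat.card (A2 H) := le_antisymm hle h1
  exact ⟨h2, ⟨MulEquiv.ofBijective g ((Nat.bijective_iff_surjective_and_card g).2 ⟨hg, h2⟩)⟩⟩

theorem step {F K L : Type} [Field F] [Field K] [Field L] [NumberField F] [NumberField K] [NumberField L]
    [Algebra F L] [Algebra K L] [Algebra.IsQuadraticExtension K L] (σ : L ≃ₐ[K] L) (hσ : σ ≠ 1)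
    [IsTotallyReal K] [IsTotallyReal L] (hL : U2 L) (τ : L ≃ₐ[F] L) (hτ : ∀ x, τ (τ x) = σ x)
    (α : 𝓞 L) (hα : sI σ α = -α) (hα2 : ∀ P : Ideal (𝓞 L), P.IsPrime → α ∈ P → 2 ∈ P)
    (hs : ∀ c ∈ A2 (ClassGroup (𝓞 F)), ∃ x ∈ A2 (ClassGroup (𝓞 L)), rC F L x = c)
    (hc : Nat.card (A2 (ClassGroup (𝓞 K))) = Nat.card (A2 (ClassGroup (𝓞 F)))) :
    Nat.card (A2 (ClassGroup (𝓞 L))) ≤ Nat.card (A2 (ClassGroup (𝓞 F))) := by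
  set B := A2 (ClassGroup (𝓞 L)) with hB
  have hfix := chev_U2 σ hσ hL α hα hα2
  rw [hc] at hfix
  have hstab : ∀ {E : Type} [Field E] [NumberField E] [Algebra E L] (g : L ≃ₐ[E] L), ∀ x ∈ B, sC g x ∈ B :=
    fun g x hx => map_mem_A2 _ hx
  let t : B →* B := ((sC τ).comp B.subtype).codRestrict B (fun x => hstab τ x x.2)
  let N : B →* A2 (ClassGroup (𝓞 F)) := ((rC F L).comp B.subtype).codRestrict _ (fun x => map_mem_A2 (rC F L) x.2)
  have hN : Function.Surjective N := by
    rintro ⟨c, hc⟩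
    obtain ⟨x, hx, rfl⟩ := hs c hc
    exact ⟨⟨x, hx⟩, rfl⟩
  let d : B →* B := 
    { toFun := fun x => t (t x) * x⁻¹
      map_one' := by simp
      map_mul' := fun x y => by
        rw [map_mul, map_mul]
        apply Additive.ofMul.injective; simp only [ofMul_mul, ofMul_inv, mul_inv_rev]; abel }
  have htt : ∀ x : B, ((t (t x) : B) : ClassGroup (𝓞 L)) = sC σ x := fun x => sC_comp3 τ τ σ hτ x
  have hNt : ∀ x, N (t x) = N x := fun x => Subtype.ext (rC_sC τ x.1)
  have hle : d.range ≤ N.ker := by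
    rintro _ ⟨x, rfl⟩
    rw [MonoidHom.mem_ker]
    change N (t (t x) * x⁻¹) = 1
    rw [map_mul, hNt, hNt, map_inv, mul_inv_cancel]
  have hdk : Nat.card d.ker ≤ Nat.card (A2 (ClassGroup (𝓞 F))) := by
    refine le_trans ?_ (Nat.le_of_dvd Nat.card_pos hfix)
    refine Nat.card_le_card_of_injective (fun x : d.ker => ⟨((x : B) : ClassGroup (𝓞 L)), ?_, (x : B).2⟩) ?_
    · have := x.2
      rw [MonoidHom.mem_ker] at this
      change t (t x) * (x : B)⁻¹ = 1 at this
      rw [mul_inv_eq_one] at this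
      change _ ∈ fixS (sC σ)
      rw [mem_fixS, ← htt, this]
    · intro x y h
      apply Subtype.ext; apply Subtype.ext
      exact congrArg (fun z : (fixS (sC σ) ⊓ B : Subgroup _) => (z : ClassGroup (𝓞 L))) h
  have h1 : Nat.card d.ker * Nat.card d.range = Nat.card B := by
    rw [← Subgroup.index_ker]; exact d.ker.card_mul_index
  have h2 : Nat.card N.ker * Nat.card (A2 (ClassGroup (𝓞 F))) = Nat.card B := by
    have : Nat.card N.range = Nat.card (A2 (ClassGroup (𝓞 F))) := by
      rw [MonoidHom.range_eq_top.2 hN]; exact Subgroup.card_top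
    rw [← this, ← Subgroup.index_ker]; exact N.ker.card_mul_index
  have h3 : Nat.card N.ker ≤ Nat.card d.range := by
    have hpos : 0 < Nat.card (A2 (ClassGroup (𝓞 F))) := Nat.card_pos
    have h4 : Nat.card d.range * Nat.card (A2 (ClassGroup (𝓞 F))) ≥ Nat.card N.ker * Nat.card (A2 (ClassGroup (𝓞 F))) := by
      rw [h2, ← h1, mul_comm]; exact Nat.mul_le_mul_right _ hdk
    exact Nat.le_of_mul_le_mul_right h4 hpos
  have h4 : d.range = N.ker := Subgroup.eq_of_le_of_card_ge hle h3
  have h5 : ∀ x, t x = x := by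
    obtain ⟨k, hk⟩ : ∃ k, ∀ x : B, x ^ 2 ^ k = 1 := by
      refine ⟨(Nat.card (ClassGroup (𝓞 L))).factorization 2, fun x => ?_⟩
      rw [← card_A2]; exact pow_card_eq_one'
    refine nakayama hk t (fun x => ?_) (fun x => ?_)
    · apply Subtype.ext
      rw [htt, htt]
      exact sC_inv σ hσ x.1
    · have : t x * x⁻¹ ∈ N.ker := by
        rw [MonoidHom.mem_ker, map_mul, hNt, map_inv, mul_inv_cancel]
      rw [← h4] at this
      obtain ⟨y, hy⟩ := this
      exact ⟨y, hy.symm⟩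
  have h6 : Nat.card d.range = 1 := by
    rw [Subgroup.card_eq_one, MonoidHom.range_eq_bot_iff]
    ext x
    change ((t (t x) * x⁻¹ : B) : ClassGroup (𝓞 L)) = 1
    rw [h5, h5, mul_inv_cancel]; rfl
  rw [h6, mul_one] at h1
  rw [← h1]; exact hdk

end step

section F1

theorem A2_two_trivial {k : Type} [Field k] [NumberField k] [Algebra.IsQuadraticExtension ℚ k] [IsTotallyReal k]
    {θ : 𝓞 k} (hθ : θ ^ 2 = ((2 : ℕ) : 𝓞 k)) : ∀ c ∈ A2 (ClassGroup (𝓞 k)), c = 1 := by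
  obtain ⟨σ, hσ⟩ := exists_sigma ℚ k
  obtain ⟨m, hm, -⟩ := fix_card σ hσ hθ Nat.prime_two.prime.squarefree (by norm_num)
  have hpf : (2 * 2 : ℕ).primeFactors.card = 1 := by
    rw [show (2 * 2 : ℕ) = 2 ^ 2 by norm_num, Nat.primeFactors_prime_pow (by norm_num) Nat.prime_two]; rfl
  rw [hpf, pow_one] at hm
  have h1 : Nat.card (fixS (sC σ)) = 1 := by
    rw [show Nat.card (fixS (sC σ)) * (2 * m) = 2 * (Nat.card (fixS (sC σ)) * m) by ring] at hm
    have := Nat.dvd_of_mul_dvd_mul_left (k := 2) (m := Nat.card (fixS (sC σ)) * m) (n := 1) (by norm_num) (by simpa using hm)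
    exact Nat.dvd_one.1 ((dvd_mul_right _ _).trans this)
  rw [Subgroup.card_eq_one] at h1
  have h2 : ∀ c : ClassGroup (𝓞 k), c ^ 2 = 1 → c = 1 := by
    intro c hc
    have := (mem_fix_iff σ hσ c).2 hc
    rw [h1] at this
    exact this
  rintro c ⟨j, hj⟩
  induction j with
  | zero => simpa using hj
  | succ j ih => exact ih (h2 _ (by rw [← pow_mul, ← pow_succ]; exact hj))

variable {F F' k L : Type} [Field F] [Field F'] [Field k] [Field L] [NumberField F] [NumberField F']
  [NumberField k] [NumberField L] [Algebra F L] [Algebra F' L] [Algebra k L]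
  [Algebra.IsQuadraticExtension F L] [Algebra.IsQuadraticExtension F' L] [Algebra.IsQuadraticExtension k L]
  (σ : L ≃ₐ[F] L) (hσ : σ ≠ 1) (σ' : L ≃ₐ[F'] L) (hσ' : σ' ≠ 1) (κ : L ≃ₐ[k] L) (hκ : κ ≠ 1)
  (hcomp : ∀ x, σ (σ' x) = κ x)
include hσ hσ' hκ hcomp

theorem U2_F1 (hF : U2 F) (hF' : U2 F') (hk : U2 k) : U2 L := by
  intro P Q hP hQ h2P h2Q
  rcases U2_two σ hσ hF hP hQ h2P h2Q with h | h
  · exact h.symm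
  rcases U2_two σ' hσ' hF' hP hQ h2P h2Q with h' | h'
  · exact h'.symm
  rcases U2_two κ hκ hk hP hQ h2P h2Q with h'' | h''
  · exact h''.symm
  rw [← map_comp3 σ σ' κ hcomp, h] at h''
  have := map_sI_inj σ h''
  rw [h', ← this]

theorem F1_bound [IsTotallyReal F'] [IsTotallyReal L] (hL : U2 L)
    (hk : ∀ c ∈ A2 (ClassGroup (𝓞 k)), c = 1)
    (hF : Nat.card (A2 (ClassGroup (𝓞 F))) = 8)
    (T : Subgroup (ClassGroup (𝓞 F))) (hT : ∀ x, x ∈ T ↔ x ^ 2 = 1) (hT4 : Nat.card T = 4)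
    (hj : ∀ c : ClassGroup (𝓞 F), c ^ 2 = 1 → jC F L c = 1)
    (hF' : Nat.card (A2 (ClassGroup (𝓞 F'))) ∣ 4)
    (α : 𝓞 L) (hα : sI σ' α = -α) (hα2 : ∀ P : Ideal (𝓞 L), P.IsPrime → α ∈ P → 2 ∈ P) :
    Nat.card (A2 (ClassGroup (𝓞 L))) ≤ 8 := by
  set B := A2 (ClassGroup (𝓞 L)) with hB
  have hfix := (chev_U2 σ' hσ' hL α hα hα2).trans hF'
  let d : B →* ClassGroup (𝓞 L) := 
    { toFun := fun x => x * sC σ x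
      map_one' := by simp
      map_mul' := fun x y => by
        rw [Subgroup.coe_mul, map_mul]
        apply Additive.ofMul.injective; simp only [ofMul_mul]; abel }
  have hker : Nat.card d.ker ≤ 4 := by
    refine le_trans ?_ (Nat.le_of_dvd (by norm_num) hfix)
    refine Nat.card_le_card_of_injective (fun x : d.ker => ⟨((x : B) : ClassGroup (𝓞 L)), ?_, (x : B).2⟩) ?_
    · have h1 : ((x : B) : ClassGroup (𝓞 L)) * sC σ ((x : B) : ClassGroup (𝓞 L)) = 1 := x.2
      have h2 := jC_rC κ hκ ((x : B) : ClassGroup (𝓞 L))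
      rw [hk _ (map_mem_A2 _ (x : B).2), map_one, ← sC_comp3 σ σ' κ hcomp] at h2
      have h3 : sC σ ((x : B) : ClassGroup (𝓞 L)) = sC σ (sC σ' ((x : B) : ClassGroup (𝓞 L))) :=
        mul_left_cancel (h1.trans h2)
      have h4 := congrArg (sC σ) h3
      rw [sC_inv σ hσ, sC_inv σ hσ] at h4
      change _ ∈ fixS (sC σ')
      rw [mem_fixS]; exact h4.symm
    · intro x y h
      apply Subtype.ext; apply Subtype.ext
      exact congrArg (fun z : (fixS (sC σ') ⊓ B : Subgroup _) => (z : ClassGroup (𝓞 L))) h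
  have hrange : Nat.card d.range ≤ 2 := by
    let J : A2 (ClassGroup (𝓞 F)) →* ClassGroup (𝓞 L) := (jC F L).comp (A2 (ClassGroup (𝓞 F))).subtype
    have h1 : d.range ≤ J.range := by
      rintro _ ⟨x, rfl⟩
      refine ⟨⟨rC F L x, map_mem_A2 _ x.2⟩, ?_⟩
      exact jC_rC σ hσ x.1
    have h2 : 4 ≤ Nat.card J.ker := by
      rw [← hT4]
      refine Nat.card_le_card_of_injective (fun x : T => ⟨⟨x.1, T_le_A2 T hT x.2⟩, hj x.1 ((hT _).1 x.2)⟩) ?_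
      intro x y h
      apply Subtype.ext
      exact congrArg (fun z : J.ker => ((z : A2 (ClassGroup (𝓞 F))) : ClassGroup (𝓞 F))) h
    have h3 : Nat.card J.ker * Nat.card J.range = 8 := by
      rw [← hF, ← Subgroup.index_ker]; exact J.ker.card_mul_index
    have h4 : Nat.card d.range ≤ Nat.card J.range := Nat.card_le_card_of_injective _ (Subgroup.inclusion_injective h1)
    nlinarith
  have h1 : Nat.card d.ker * Nat.card d.range = Nat.card B := by
    rw [← Subgroup.index_ker]; exact d.ker.card_mul_index
  rw [← h1]
  exact (Nat.mul_le_mul hker hrange)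

end F1
end S4

namespace S4
open nonZeroDivisors

section tau

theorem not_sq {K₀ K₁ : Type} [Field K₀] [Field K₁] [NumberField K₀] [NumberField K₁] [Algebra K₀ K₁]
    [Algebra.IsQuadraticExtension K₀ K₁] (σ : K₁ ≃ₐ[K₀] K₁) (hσ : σ ≠ 1) {n : ℕ} {x : K₁} (hx : IsB (n + 1) x)
    (hσx : σ x = -x) (y : K₁) : y ^ 2 - 2 ≠ x := by
  rintro rfl
  have h : IsB (n + 2) y := hx
  have h1 := h.gg (σ : K₁ →+* K₁) hσx
  have h2 : σ (σ y) = - y := h1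
  rw [sig_sig σ hσ] at h2
  exact h.ne_zero (self_eq_neg.1 h2)

variable {K₀ K₁ K₂ : Type} [Field K₀] [Field K₁] [Field K₂] [NumberField K₀] [NumberField K₁] [NumberField K₂]
  [Algebra K₀ K₁] [Algebra K₁ K₂] [Algebra K₀ K₂] [IsScalarTower K₀ K₁ K₂]
  [Algebra.IsQuadraticExtension K₀ K₁] [Algebra.IsQuadraticExtension K₁ K₂]
  (σ₁ : K₁ ≃ₐ[K₀] K₁) (hσ₁ : σ₁ ≠ 1) (σ₂ : K₂ ≃ₐ[K₁] K₂) (hσ₂ : σ₂ ≠ 1)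
  {n : ℕ} {x : K₁} {y : K₂} (hy : IsB (n + 2) y) (hxy : algebraMap K₁ K₂ x = y ^ 2 - 2)
  (hx1 : σ₁ x = -x) (hy1 : σ₂ y = -y)
include hσ₁ hσ₂ hy hxy hx1 hy1

theorem normal_tower : Normal K₀ K₂ := by
  have hy0 : y ≠ 0 := hy.ne_zero
  have hX : IsB (n + 1) (y ^ 2 - 2) := hy
  have hx0 : y ^ 2 - 2 ≠ 0 := hX.ne_zero
  have hx0' : x ≠ 0 := by rintro rfl; rw [map_zero] at hxy; exact hx0 hxy.symm
  have h2 : IsB n ((y ^ 2 - 2) ^ 2 - 2) := hX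
  obtain ⟨c, hc, -⟩ := h2.exists_c
  obtain ⟨z, hz⟩ := fix_field σ₁ hσ₁ (x := x ^ 2) (by rw [map_pow, hx1, neg_sq])
  have hz' : algebraMap K₀ K₂ z = (y ^ 2 - 2) ^ 2 := by
    rw [IsScalarTower.algebraMap_apply K₀ K₁ K₂, hz, map_pow, hxy]
  set w := c / ((y ^ 2 - 2) * y) with hw
  have hw2 : w ^ 2 = 4 - y ^ 2 := by
    rw [hw, div_pow, hc]; field_simp; ring
  let p : Polynomial K₀ := (Polynomial.X ^ 2 - Polynomial.C 2) ^ 2 - Polynomial.C z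
  have hp : p.map (algebraMap K₀ K₂) = (Polynomial.X - Polynomial.C y) * (Polynomial.X - Polynomial.C (-y)) *
      ((Polynomial.X - Polynomial.C w) * (Polynomial.X - Polynomial.C (-w))) := by
    have e1 : (Polynomial.X - Polynomial.C w) * (Polynomial.X - Polynomial.C (-w)) = Polynomial.X ^ 2 - Polynomial.C (4 - y ^ 2) := by
      rw [← hw2]; simp only [map_neg, map_pow]; ring
    rw [e1]
    simp only [p, Polynomial.map_sub, Polynomial.map_pow, Polynomial.map_X, Polynomial.map_C, hz', map_ofNat, Polynomial.map_ofNat, map_sub, map_pow, map_neg]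
    ring
  have hp0 : p.map (algebraMap K₀ K₂) ≠ 0 := by
    rw [hp]
    exact mul_ne_zero (mul_ne_zero (Polynomial.X_sub_C_ne_zero _) (Polynomial.X_sub_C_ne_zero _))
      (mul_ne_zero (Polynomial.X_sub_C_ne_zero _) (Polynomial.X_sub_C_ne_zero _))
  haveI : Polynomial.IsSplittingField K₀ K₂ p := by
    refine ⟨?_, ?_⟩
    · rw [hp]
      exact ((Polynomial.Splits.X_sub_C _).mul (Polynomial.Splits.X_sub_C _)).mul
        ((Polynomial.Splits.X_sub_C _).mul (Polynomial.Splits.X_sub_C _))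
    · rw [eq_top_iff]
      intro u _
      have hyr : y ∈ Algebra.adjoin K₀ (p.rootSet K₂) := by
        apply Algebra.subset_adjoin
        rw [Polynomial.mem_rootSet']
        refine ⟨hp0, ?_⟩
        rw [Polynomial.aeval_def, ← Polynomial.eval_map, hp]
        simp
      have hxr : algebraMap K₁ K₂ x ∈ Algebra.adjoin K₀ (p.rootSet K₂) := by
        rw [hxy]
        exact Subalgebra.sub_mem _ (Subalgebra.pow_mem _ hyr 2) (by
          have := Subalgebra.algebraMap_mem (Algebra.adjoin K₀ (p.rootSet K₂)) 2
          rwa [map_ofNat] at this)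
      have hK : ∀ v : K₁, algebraMap K₁ K₂ v ∈ Algebra.adjoin K₀ (p.rootSet K₂) := by
        intro v
        obtain ⟨a, b, rfl⟩ := field_repr σ₁ hσ₁ hx1 hx0' v
        rw [map_add, map_mul, ← IsScalarTower.algebraMap_apply, ← IsScalarTower.algebraMap_apply]
        exact Subalgebra.add_mem _ (Subalgebra.mul_mem _ (Subalgebra.algebraMap_mem _ _) hxr) (Subalgebra.algebraMap_mem _ _)
      obtain ⟨a, b, rfl⟩ := field_repr σ₂ hσ₂ hy1 hy0 u
      exact Subalgebra.add_mem _ (Subalgebra.mul_mem _ (hK _) hyr) (hK _)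
  exact Normal.of_isSplittingField p

theorem exists_tau : ∃ τ : K₂ ≃ₐ[K₀] K₂, ∀ u, τ (τ u) = σ₂ u := by
  haveI := normal_tower σ₁ hσ₁ σ₂ hσ₂ hy hxy hx1 hy1
  refine ⟨σ₁.liftNormal K₂, fun u => ?_⟩
  set τ := σ₁.liftNormal K₂
  have h1 : ∀ v, τ (algebraMap K₁ K₂ v) = algebraMap K₁ K₂ (σ₁ v) := fun v => σ₁.liftNormal_commutes K₂ v
  have h2 : τ (y ^ 2 - 2) = - (y ^ 2 - 2) := by rw [← hxy, h1, hx1, map_neg]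
  have h3 : τ (τ y) = - y := hy.gg (τ : K₂ →+* K₂) h2
  obtain ⟨a, b, rfl⟩ := field_repr σ₂ hσ₂ hy1 hy.ne_zero u
  rw [map_add, map_add, map_add, map_mul, map_mul, map_mul, h1, h1, h1, h1, sig_sig σ₁ hσ₁, sig_sig σ₁ hσ₁, h3, hy1,
    AlgEquiv.commutes, AlgEquiv.commutes]

end tau
end S4

namespace S4
open nonZeroDivisors

section real

theorem real_of_sq {z : ℂ} {d : ℝ} (hd : 0 ≤ d) (h : z ^ 2 = (d : ℂ)) : ∃ t : ℝ, z = t ∧ t ^ 2 = d := by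
  have h1 : z ^ 2 = ((Real.sqrt d : ℝ) : ℂ) ^ 2 := by
    rw [h, ← Complex.ofReal_pow, Real.sq_sqrt hd]
  rcases sq_eq_sq_iff_eq_or_eq_neg.1 h1 with h | h
  · exact ⟨Real.sqrt d, h, Real.sq_sqrt hd⟩
  · exact ⟨-Real.sqrt d, by rw [h]; simp, by rw [neg_sq, Real.sq_sqrt hd]⟩

theorem IsB.real {n : ℕ} {z : ℂ} (h : IsB n z) : ∃ t : ℝ, z = t ∧ t ^ 2 ≤ 4 := by
  induction n generalizing z with
  | zero => exact ⟨0, by rw [show z = 0 from h]; simp, by norm_num⟩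
  | succ n ih =>
    obtain ⟨t, ht, ht2⟩ := ih (z := z ^ 2 - 2) h
    have h1 : -2 ≤ t := by nlinarith
    have h2 : t ≤ 2 := by nlinarith
    obtain ⟨u, hu, hu2⟩ := real_of_sq (z := z) (d := 2 + t) (by linarith) (by push_cast; rw [← ht]; ring)
    exact ⟨u, hu, by rw [hu2]; linarith⟩

theorem tr_quad {F : Type} [Field F] [NumberField F] [Algebra.IsQuadraticExtension ℚ F]
    (σ : F ≃ₐ[ℚ] F) (hσ : σ ≠ 1) {D : ℕ} {θ : 𝓞 F} (hθ : θ ^ 2 = (D : 𝓞 F)) (hD : D % 4 = 2 ∨ D % 4 = 3) :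
    IsTotallyReal F := by
  have hs : σ (θ : F) = - (θ : F) := by
    have := congrArg (fun z : 𝓞 F => (z : F)) (sI_theta σ hσ hθ hD); simpa using this
  have hθ' : (θ : F) ^ 2 = D := by exact_mod_cast congrArg (fun z : 𝓞 F => (z : F)) hθ
  refine totally_real_step σ hσ inferInstance hs ?_ (fun φ => ?_)
  · intro h
    rw [h] at hθ'
    have : D = 0 := by
      have h2 : ((D : ℕ) : F) = 0 := by rw [← hθ']; ring
      exact_mod_cast h2
    omega
  · obtain ⟨t, ht, -⟩ := real_of_sq (z := φ θ) (d := D) (by positivity) (by rw [← map_pow, hθ']; simp)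
    rw [ht, Complex.conj_ofReal]

theorem tr_isB {K L : Type} [Field K] [Field L] [NumberField K] [NumberField L] [Algebra K L]
    [Algebra.IsQuadraticExtension K L] (σ : L ≃ₐ[K] L) (hσ : σ ≠ 1) (hK : IsTotallyReal K) {n : ℕ} {β : L}
    (hβ : σ β = - β) (hB : IsB (n + 1) β) : IsTotallyReal L := by
  refine totally_real_step σ hσ hK hβ hB.ne_zero (fun φ => ?_)
  obtain ⟨t, ht, -⟩ := (hB.map φ).real
  rw [ht, Complex.conj_ofReal]

end real

section F1

theorem ratAlg {k L : Type} [Field k] [Field L] [NumberField k] [NumberField L] [Algebra k L] (x : ℚ) :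
    algebraMap k L (algebraMap ℚ k x) = (x : L) := by
  simp

theorem comp_klein {F F' k L : Type} [Field F] [Field F'] [Field k] [Field L] [NumberField F] [NumberField F']
    [NumberField k] [NumberField L] [Algebra F L] [Algebra F' L] [Algebra k L]
    [Algebra.IsQuadraticExtension ℚ k]
    [Algebra.IsQuadraticExtension k L]
    (σ : L ≃ₐ[F] L) (σ' : L ≃ₐ[F'] L) (κ : L ≃ₐ[k] L) (hκ : κ ≠ 1)
    {x : F} {x' : F'} {t : k} {d m : ℚ} (hm : m ≠ 0) (ht : t ^ 2 = 2) (hx : x ^ 2 = algebraMap ℚ F d)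
    (hrel : algebraMap F L x * algebraMap F' L x' = algebraMap k L t * (m : L))
    (h2F : ∀ y, algebraMap F L y ≠ algebraMap k L t) (h2F' : ∀ y, algebraMap F' L y ≠ algebraMap k L t)
    (hkD : ∀ y, algebraMap k L y ≠ algebraMap F L x)
    (hσt : σ (algebraMap k L t) = - algebraMap k L t) (hσt' : σ' (algebraMap k L t) = - algebraMap k L t)
    (u : L) :
    σ (σ' u) = κ u := by
  obtain ⟨ν, hν⟩ := exists_sigma ℚ k
  have ht0 : t ≠ 0 := by rintro rfl; norm_num at ht
  have hνt : ν t = - t := by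
    refine sigma_neg ν hν (c := 2) (by rw [ht]; simp) (fun y hy => ?_)
    refine h2F (algebraMap ℚ F y) ?_
    rw [← hy]; simp
  have hκx : κ (algebraMap F L x) = - algebraMap F L x := by
    refine sigma_neg κ hκ (c := algebraMap ℚ k d) ?_ hkD
    rw [← map_pow, hx]; simp
  have ht0' : algebraMap k L t ≠ 0 := by rwa [Ne, map_eq_zero]
  have hm' : (m : L) ≠ 0 := by exact_mod_cast hm
  have hx'0 : algebraMap F' L x' ≠ 0 := by
    intro h; rw [h, mul_zero] at hrel
    exact mul_ne_zero ht0' hm' hrel.symm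
  have hx0 : algebraMap F L x ≠ 0 := by
    intro h; rw [h, zero_mul] at hrel
    exact mul_ne_zero ht0' hm' hrel.symm
  have hσ'x : σ' (algebraMap F L x) = - algebraMap F L x := by
    have := congrArg σ' hrel
    rw [map_mul, map_mul, AlgEquiv.commutes, hσt', map_ratCast, neg_mul, ← hrel, ← neg_mul] at this
    exact mul_right_cancel₀ hx'0 this
  have hk : ∀ v : k, σ (σ' (algebraMap k L v)) = algebraMap k L v := by
    intro v
    obtain ⟨a, b, rfl⟩ := field_repr ν hν hνt ht0 v
    rw [map_add, map_mul, ratAlg, ratAlg]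
    simp only [map_add, map_mul, map_ratCast, hσt', hσt, map_neg, neg_neg]
  obtain ⟨a, b, rfl⟩ := field_repr κ hκ hκx hx0 u
  simp only [map_add, map_mul, hk, hσ'x, map_neg, AlgEquiv.commutes, hκx]

theorem F1_main {η η' q r s : ℕ} [hq : Fact q.Prime] [hr : Fact r.Prime] [hs : Fact s.Prime]
    (hη : η = 1 ∨ η = 2) (hη' : η' = 1 ∨ η' = 2)
    (hq4 : q % 4 = 3) (hr8 : r % 8 = 5) (hs8 : s % 8 = 5) (hrs : legendreSym s r = 1)
    (h1 : legendreSym r (η * q : ℕ) = 1) (h2 : legendreSym s (η * q : ℕ) = 1)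
    (h3 : legendreSym r (η' * q : ℕ) = -1) (h4 : legendreSym s (η' * q : ℕ) = -1)
    {F F' k L : Type} [Field F] [Field F'] [Field k] [Field L] [NumberField F] [NumberField F']
    [NumberField k] [NumberField L] [Algebra F L] [Algebra F' L] [Algebra k L]
    [Algebra.IsQuadraticExtension ℚ F] [Algebra.IsQuadraticExtension ℚ F'] [Algebra.IsQuadraticExtension ℚ k]
    [Algebra.IsQuadraticExtension F L] [Algebra.IsQuadraticExtension F' L] [Algebra.IsQuadraticExtension k L]
    {θ : 𝓞 F} (hθ : θ ^ 2 = ((η * q * r * s : ℕ) : 𝓞 F)) {θ' : 𝓞 F'} (hθ' : θ' ^ 2 = ((η' * q * r * s : ℕ) : 𝓞 F'))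
    {t : 𝓞 k} (ht : t ^ 2 = ((2 : ℕ) : 𝓞 k))
    (hrel : algebraMap F L θ * algebraMap F' L θ' = algebraMap k L t * ((q * r * s : ℕ) : L))
    (h2F : ∀ y, algebraMap F L y ≠ algebraMap k L t) (h2F' : ∀ y, algebraMap F' L y ≠ algebraMap k L t)
    (hkD : ∀ y, algebraMap k L y ≠ algebraMap F L θ)
    (σ₀ : F ≃ₐ[ℚ] F) (hσ₀ : σ₀ ≠ 1)
    (hnp : ∀ a u : 𝓞 F, IsUnit u → a ^ 2 = (η * q : ℕ) * u → False)
    (h8 : Nat.card (A2 (ClassGroup (𝓞 F))) = 8) :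
    IsTotallyReal F ∧ Nat.card (fixS (sC σ₀)) = 4 ∧ U2 L ∧ IsTotallyReal L ∧ Nat.card (A2 (ClassGroup (𝓞 L))) ≤ 8 := by
  have hsf := D_sqf hη hq4 hr8 hs8 hrs
  have hD := D_mod hη hq4 hr8 hs8
  have hsf' := D_sqf hη' hq4 hr8 hs8 hrs
  have hD' := D_mod hη' hq4 hr8 hs8
  obtain ⟨ν', hν'⟩ := exists_sigma ℚ F'
  obtain ⟨ν, hν⟩ := exists_sigma ℚ k
  obtain ⟨σ, hσ⟩ := exists_sigma F L
  obtain ⟨σ', hσ'⟩ := exists_sigma F' L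
  obtain ⟨κ, hκ⟩ := exists_sigma k L
  haveI trF : IsTotallyReal F := tr_quad σ₀ hσ₀ hθ hD
  haveI trF' : IsTotallyReal F' := tr_quad ν' hν' hθ' hD'
  haveI trk : IsTotallyReal k := tr_quad ν hν ht (by norm_num)
  have htk : (t : k) ^ 2 = 2 := by
    have := congrArg (algebraMap (𝓞 k) k) ht
    rw [map_pow, map_natCast] at this
    simpa using this
  have hθF : (θ : F) ^ 2 = algebraMap ℚ F ((η * q * r * s : ℕ) : ℚ) := by
    have := congrArg (fun z : 𝓞 F => (z : F)) hθ
    rw [map_natCast]; exact_mod_cast this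
  have htL : (algebraMap k L t) ^ 2 = 2 := by rw [← map_pow, htk, map_ofNat]
  have hσt : σ (algebraMap k L t) = - algebraMap k L t := sigma_neg σ hσ (c := 2) (by rw [htL, map_ofNat]) h2F
  have hσt' : σ' (algebraMap k L t) = - algebraMap k L t := sigma_neg σ' hσ' (c := 2) (by rw [htL, map_ofNat]) h2F'
  have ht0' : algebraMap k L t ≠ 0 := by intro h; rw [h] at htL; norm_num at htL
  have hm0 : q * r * s ≠ 0 := mul_ne_zero (mul_ne_zero hq.out.ne_zero hr.out.ne_zero) hs.out.ne_zero
  have hcomp : ∀ x, σ (σ' x) = κ x := by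
    refine comp_klein σ σ' κ hκ (x := (θ : F)) (x' := (θ' : F')) (t := (t : k)) (d := ((η * q * r * s : ℕ) : ℚ))
      (m := ((q * r * s : ℕ) : ℚ)) (by exact_mod_cast hm0) htk hθF ?_ h2F h2F' hkD hσt hσt'
    rw [hrel]; simp
  have uF : U2 F := U2_rat hθ hsf hD
  have uF' : U2 F' := U2_rat hθ' hsf' hD'
  have uk : U2 k := U2_rat ht Nat.prime_two.prime.squarefree (by norm_num)
  have uL : U2 L := U2_F1 σ hσ σ' hσ' κ hκ hcomp uF uF' uk
  haveI trL : IsTotallyReal L := by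
    refine totally_real_step σ hσ trF hσt ht0' (fun φ => ?_)
    obtain ⟨t, ht, -⟩ := real_of_sq (z := φ (algebraMap k L t)) (d := 2) (by norm_num) (by rw [← map_pow, htL, map_ofNat]; simp)
    rw [ht, Complex.conj_ofReal]
  obtain ⟨hc4, P, M, hP, hM, hcl⟩ := F_struct hη hq4 hr8 hs8 hrs σ₀ hσ₀ hθ h1 hnp
  obtain ⟨hF'4, μ, hμ⟩ := F'_struct hη' hq4 hr8 hs8 hrs ν' hν' hθ' hη h1 h2 h3 h4
  let T : 𝓞 L := algebraMap (𝓞 k) (𝓞 L) t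
  have hT : T ^ 2 = 2 := by
    have := congrArg (algebraMap (𝓞 k) (𝓞 L)) ht
    rw [map_pow, map_natCast] at this
    simpa using this
  have hkP : jC F L (ClassGroup.mk0 P) = 1 := by
    refine jC_kill (y := T) hP ?_
    rw [Ideal.span_singleton_pow, hT, map_ofNat]
  have hkM : jC F L (ClassGroup.mk0 M) = 1 := by
    refine jC_kill (y := algebraMap (𝓞 F') (𝓞 L) μ) hM ?_
    have := congrArg (Ideal.map (algebraMap (𝓞 F') (𝓞 L))) hμ
    rw [Ideal.map_pow, Ideal.map_span, Ideal.map_span, Set.image_singleton, Set.image_singleton, map_natCast] at this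
    rw [this, map_natCast]
  refine ⟨trF, hc4, uL, trL, ?_⟩
  refine F1_bound σ hσ σ' hσ' κ hκ hcomp uL (A2_two_trivial ht) h8 (fixS (sC σ₀)) (mem_fix_iff σ₀ hσ₀) hc4 ?_ hF'4 T ?_ ?_
  · intro c hc
    rcases hcl c hc with rfl | rfl | rfl | rfl
    · exact map_one _
    · exact hkP
    · exact hkM
    · rw [map_mul, hkP, hkM, mul_one]
  · apply RingOfIntegers.ext
    exact hσt'
  · intro I _ hI
    rw [← hT, pow_two]; exact I.mul_mem_left _ hI

end F1
end S4

namespace S4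
open nonZeroDivisors

section tower

theorem tower_basic {K₀ K₁ : Type} [Field K₀] [Field K₁] [NumberField K₀] [NumberField K₁] [Algebra K₀ K₁]
    [Algebra.IsQuadraticExtension K₀ K₁] {n : ℕ} {x : K₁} {c : K₀} (hx : IsB (n + 1) x)
    (hc : x ^ 2 = algebraMap K₀ K₁ c) (hn : ∀ z, algebraMap K₀ K₁ z ≠ x) :
    (IsTotallyReal K₀ → IsTotallyReal K₁) ∧ (∀ y : K₁, y ^ 2 - 2 ≠ x) ∧
    (∀ l : ℕ, l.Prime → l % 2 ^ (n + 3) = 1 → Good l K₀ → Good l K₁) := by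
  obtain ⟨σ, hσ⟩ := exists_sigma K₀ K₁
  have hs : σ x = - x := sigma_neg σ hσ hc hn
  refine ⟨fun h => tr_isB σ hσ h hs hx, not_sq σ hσ hx hs, fun l hl hm hg => ?_⟩
  haveI : Fact l.Prime := ⟨hl⟩
  have hintg := hx.integral
  let β : 𝓞 K₁ := ⟨x, hintg⟩
  have hβ : IsB (n + 1) β := IsB.of_map (algebraMap (𝓞 K₁) K₁) RingOfIntegers.coe_injective hx
  have hsβ : sI σ β = - β := RingOfIntegers.ext hs
  exact good_isB σ hσ hg hsβ hβ hm

theorem tower_step {F K₀ K₁ K₂ : Type} [Field F] [Field K₀] [Field K₁] [Field K₂] [NumberField F] [NumberField K₀]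
    [NumberField K₁] [NumberField K₂] [Algebra F K₀] [Algebra F K₂] [Algebra K₀ K₁] [Algebra K₀ K₂]
    [Algebra K₁ K₂] [IsScalarTower F K₀ K₂] [IsScalarTower K₀ K₁ K₂]
    [Algebra.IsQuadraticExtension K₀ K₁] [Algebra.IsQuadraticExtension K₁ K₂]
    {n : ℕ} {x : K₁} {y : K₂} {c : K₀} (hy : IsB (n + 2) y) (hxy : algebraMap K₁ K₂ x = y ^ 2 - 2)
    (hc : x ^ 2 = algebraMap K₀ K₁ c) (hxn : ∀ z, algebraMap K₀ K₁ z ≠ x) (hyn : ∀ z, algebraMap K₁ K₂ z ≠ y)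
    (h1 : IsTotallyReal K₁) (h2 : IsTotallyReal K₂) (hU : U2 K₁)
    (hs : ∀ c ∈ A2 (ClassGroup (𝓞 F)), ∃ x ∈ A2 (ClassGroup (𝓞 K₂)), rC F K₂ x = c)
    (hcard : Nat.card (A2 (ClassGroup (𝓞 K₁))) = Nat.card (A2 (ClassGroup (𝓞 F)))) :
    U2 K₂ ∧ Nat.card (A2 (ClassGroup (𝓞 K₂))) = Nat.card (A2 (ClassGroup (𝓞 F))) := by
  obtain ⟨σ₁, hσ₁⟩ := exists_sigma K₀ K₁
  obtain ⟨σ₂, hσ₂⟩ := exists_sigma K₁ K₂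
  have hs1 : σ₁ x = - x := sigma_neg σ₁ hσ₁ hc hxn
  have hs2 : σ₂ y = - y := by
    refine sigma_neg σ₂ hσ₂ (c := x + 2) ?_ hyn
    rw [map_add, hxy, map_ofNat]; ring
  obtain ⟨τ', hτ'⟩ := exists_tau σ₁ hσ₁ σ₂ hσ₂ hy hxy hs1 hs2
  let τ : K₂ ≃ₐ[F] K₂ := τ'.restrictScalars F
  have hτ : ∀ u, τ (τ u) = σ₂ u := hτ'
  have hU2 : U2 K₂ := U2_step σ₂ hσ₂ hU τ hτ
  have hintg := hy.integral
  let β : 𝓞 K₂ := ⟨y, hintg⟩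
  have hβ : IsB (n + 2) β := IsB.of_map (algebraMap (𝓞 K₂) K₂) RingOfIntegers.coe_injective hy
  have hsβ : sI σ₂ β = - β := RingOfIntegers.ext hs2
  refine ⟨hU2, (A2_eq_of_surj (rC F K₂) hs ?_).1⟩
  exact step σ₂ hσ₂ hU2 τ hτ β hsβ (fun P _ h => hβ.two_mem h) hs hcard

end tower
end S4

namespace S4
open nonZeroDivisors

section conc

/-- The algebra structure given by an inclusion of subfields of the reals. -/
@[reducible] noncomputable def incl {E E' : IntermediateField ℚ ℝ} (h : E ≤ E') : Algebra E E' :=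
  (IntermediateField.inclusion h).toRingHom.toAlgebra

theorem incl_coe {E E' : IntermediateField ℚ ℝ} (h : E ≤ E') (x : E) :
    ((@algebraMap E E' _ _ (incl h) x : E') : ℝ) = x := rfl

theorem incl_tower {E E' E'' : IntermediateField ℚ ℝ} (h : E ≤ E') (h' : E' ≤ E'') :
    @IsScalarTower E E' E'' (incl h).toSMul (incl h').toSMul (incl (h.trans h')).toSMul := by
  letI := incl h; letI := incl h'; letI := incl (h.trans h')
  exact IsScalarTower.of_algebraMap_eq (fun x => rfl)

theorem quad_mk {K L : Type} [Field K] [Field L] [Algebra K L] (h : Module.finrank K L = 2) :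
    Algebra.IsQuadraticExtension K L := { finrank_eq_two' := h }

theorem finrank_sqrt {K : Type} [Field K] [Algebra K ℝ] {b : ℝ} {c : K} (hb2 : b ^ 2 = algebraMap K ℝ c)
    (hb : b ∉ (algebraMap K ℝ).range) : Module.finrank K K⟮b⟯ = 2 := by
  have hmon : (Polynomial.X ^ 2 - Polynomial.C c : Polynomial K).Monic := Polynomial.monic_X_pow_sub_C c (by norm_num)
  have hev : Polynomial.aeval b (Polynomial.X ^ 2 - Polynomial.C c : Polynomial K) = 0 := by
    simp [hb2]
  have hintg : IsIntegral K b := ⟨_, hmon, hev⟩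
  rw [adjoin.finrank hintg]
  refine le_antisymm ?_ ((minpoly.two_le_natDegree_iff hintg).2 hb)
  have := Polynomial.natDegree_le_of_dvd (minpoly.dvd K b hev) hmon.ne_zero
  rwa [Polynomial.natDegree_X_pow_sub_C] at this

theorem quad_of {E E' : IntermediateField ℚ ℝ} (h : E ≤ E') {b : ℝ} (hE : E' = E ⊔ adjoin ℚ {b})
    (hb2 : b ^ 2 ∈ E) (hb : b ∉ E) : letI := incl h; Algebra.IsQuadraticExtension E E' := by
  letI := incl h
  have h1 : extendScalars h = E⟮b⟯ := by
    ext x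
    have h5 := restrictScalars_adjoin_eq_sup ℚ E {b}
    rw [← hE] at h5
    have h6 : x ∈ E' ↔ x ∈ E⟮b⟯ := by
      rw [← h5]; exact Iff.rfl
    exact h6
  have h2 : Module.finrank E E⟮b⟯ = 2 := by
    refine finrank_sqrt (c := (⟨b ^ 2, hb2⟩ : E)) rfl ?_
    rintro ⟨x, hx⟩
    exact hb (hx ▸ x.2)
  rw [← h1] at h2
  let e : E' ≃ₗ[E] (extendScalars h) :=
    { toFun := fun x => ⟨x.1, x.2⟩
      invFun := fun x => ⟨x.1, x.2⟩
      map_add' := fun _ _ => rfl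
      map_smul' := fun _ _ => rfl
      left_inv := fun _ => rfl
      right_inv := fun _ => rfl }
  have h3 : Module.finrank E E' = 2 := by rw [e.finrank_eq, h2]
  exact quad_mk h3

theorem rat_quad {E : IntermediateField ℚ ℝ} {b : ℝ} (hE : E = adjoin ℚ {b}) {d : ℕ} (hb2 : b ^ 2 = d)
    (hb : Irrational b) : Algebra.IsQuadraticExtension ℚ E := by
  have h2 : Module.finrank ℚ ℚ⟮b⟯ = 2 := by
    refine finrank_sqrt (c := (d : ℚ)) (by simp [hb2]) ?_
    rintro ⟨x, hx⟩
    exact hb ⟨x, by simpa using hx⟩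
  subst hE
  have h3 : @Module.finrank ℚ ℚ⟮b⟯ _ _ DivisionRing.toRatAlgebra.toModule = 2 := by
    convert h2
  exact quad_mk h3

theorem nf_of {E : IntermediateField ℚ ℝ} (h : FiniteDimensional ℚ E) : NumberField E := by
  refine @NumberField.mk _ _ inferInstance ?_
  convert h

theorem fd_sup {E : IntermediateField ℚ ℝ} (h : FiniteDimensional ℚ E) {b : ℝ} (hb : IsIntegral ℚ b) :
    FiniteDimensional ℚ (E ⊔ adjoin ℚ {b} : IntermediateField ℚ ℝ) := by
  haveI := adjoin.finiteDimensional hb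
  exact IntermediateField.finiteDimensional_sup _ _

end conc
end S4

namespace S4
open nonZeroDivisors

section lay

/-- The generators of the layers. -/
noncomputable def bn (n : ℕ) : ℝ := 2 * Real.cos (2 * Real.pi / 2 ^ (n + 2))

theorem bn_succ (n : ℕ) : bn (n + 1) ^ 2 - 2 = bn n := by
  unfold bn
  have : 2 * Real.pi / 2 ^ (n + 2) = 2 * (2 * Real.pi / 2 ^ (n + 1 + 2)) := by
    rw [pow_succ 2 (n + 2)]; field_simp
  rw [this, Real.cos_two_mul]; ring

theorem bn_zero : bn 0 = 0 := by
  unfold bn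
  have : 2 * Real.pi / 2 ^ (0 + 2) = Real.pi / 2 := by ring
  rw [this, Real.cos_pi_div_two, mul_zero]

theorem bn_one : bn 1 = √2 := by
  unfold bn
  have : 2 * Real.pi / 2 ^ (1 + 2) = Real.pi / 4 := by ring
  rw [this, Real.cos_pi_div_four]; ring

theorem bn_isB (n : ℕ) : IsB n (bn n) := by
  induction n with
  | zero => exact bn_zero
  | succ n ih =>
    change IsB n (bn (n + 1) ^ 2 - 2)
    rwa [bn_succ]

theorem incl_ne {E E' : IntermediateField ℚ ℝ} (h : E ≤ E') {b : ℝ} (hb : b ∉ E) (hb' : b ∈ E') :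
    letI := incl h; ∀ z : E, algebraMap E E' z ≠ ⟨b, hb'⟩ := by
  intro z hz
  have h1 : (z : ℝ) = b := congrArg Subtype.val hz
  exact hb (h1 ▸ z.2)

theorem layer_zero (F : IntermediateField ℚ ℝ) : layer F 0 = F := by
  change F ⊔ adjoin ℚ {bn 0} = F
  rw [bn_zero]; simp

theorem bn_mem (F : IntermediateField ℚ ℝ) (n : ℕ) : bn n ∈ layer F n :=
  (le_sup_right : adjoin ℚ {bn n} ≤ layer F n) (mem_adjoin_simple_self ℚ _)

theorem le_layer (F : IntermediateField ℚ ℝ) (n : ℕ) : F ≤ layer F n := le_sup_left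

theorem layer_succ (F : IntermediateField ℚ ℝ) (n : ℕ) : layer F (n + 1) = layer F n ⊔ adjoin ℚ {bn (n + 1)} := by
  change F ⊔ adjoin ℚ {bn (n + 1)} = (F ⊔ adjoin ℚ {bn n}) ⊔ adjoin ℚ {bn (n + 1)}
  rw [sup_assoc]
  congr 1
  symm
  rw [sup_eq_right, adjoin_simple_le_iff, ← bn_succ n]
  have h := mem_adjoin_simple_self ℚ (bn (n + 1))
  exact sub_mem (pow_mem h 2) (ofNat_mem _ 2)

theorem layer_le (F : IntermediateField ℚ ℝ) (n : ℕ) : layer F n ≤ layer F (n + 1) := by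
  rw [layer_succ]; exact le_sup_left

theorem layer_fd (F : IntermediateField ℚ ℝ) (h : FiniteDimensional ℚ F) (n : ℕ) : FiniteDimensional ℚ (layer F n) :=
  fd_sup h (b := bn n) ((bn_isB n).integral.tower_top)

theorem bn_sq_mem (F : IntermediateField ℚ ℝ) (n : ℕ) : bn (n + 1) ^ 2 ∈ layer F n := by
  have : bn (n + 1) ^ 2 = bn n + 2 := by rw [← bn_succ n]; ring
  rw [this]
  exact add_mem (bn_mem F n) (ofNat_mem _ 2)

variable {F : IntermediateField ℚ ℝ} (hfd : FiniteDimensional ℚ F) (h2 : √2 ∉ F)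
include hfd h2

theorem bn_not_mem (n : ℕ) : bn (n + 1) ∉ layer F n := by
  induction n with
  | zero => rw [layer_zero, bn_one]; exact h2
  | succ n ih =>
    intro hm
    letI := incl (layer_le F n)
    haveI := quad_of (layer_le F n) (layer_succ F n) (bn_sq_mem F n) ih
    haveI := nf_of (layer_fd F hfd n)
    haveI := nf_of (layer_fd F hfd (n + 1))
    have hx : IsB (n + 1) (⟨bn (n + 1), bn_mem F (n + 1)⟩ : layer F (n + 1)) :=
      IsB.of_map (algebraMap (layer F (n + 1)) ℝ) (RingHom.injective _) (bn_isB (n + 1))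
    have := (tower_basic (K₀ := layer F n) hx (c := ⟨_, bn_sq_mem F n⟩) rfl
      (incl_ne (layer_le F n) ih _)).2.1 ⟨_, hm⟩
    exact this (Subtype.ext (bn_succ (n + 1)))

theorem layer_tr (hF : IsTotallyReal F) (n : ℕ) : IsTotallyReal (layer F n) := by
  induction n with
  | zero => rw [layer_zero]; exact hF
  | succ n ih =>
    letI := incl (layer_le F n)
    have hn := bn_not_mem hfd h2 n
    haveI := quad_of (layer_le F n) (layer_succ F n) (bn_sq_mem F n) hn
    haveI := nf_of (layer_fd F hfd n)
    haveI := nf_of (layer_fd F hfd (n + 1))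
    have hx : IsB (n + 1) (⟨bn (n + 1), bn_mem F (n + 1)⟩ : layer F (n + 1)) :=
      IsB.of_map (algebraMap (layer F (n + 1)) ℝ) (RingHom.injective _) (bn_isB (n + 1))
    exact (tower_basic (K₀ := layer F n) hx (c := ⟨_, bn_sq_mem F n⟩) rfl
      (incl_ne (layer_le F n) hn _)).1 ih

theorem layer_good (l : ℕ) (hl : l.Prime) [NumberField F] (hF : Good l F) (n : ℕ) (hm : l % 2 ^ (n + 2) = 1)
    (inst : NumberField (layer F n)) : Good l (layer F n) := by
  revert inst
  induction n with
  | zero =>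
    intro inst
    have : ∀ E : IntermediateField ℚ ℝ, E = F → ∀ [NumberField E], Good l E := by
      rintro E rfl; exact hF
    exact this _ (layer_zero F)
  | succ n ih =>
    intro inst
    letI := incl (layer_le F n)
    have hn := bn_not_mem hfd h2 n
    haveI := quad_of (layer_le F n) (layer_succ F n) (bn_sq_mem F n) hn
    haveI := nf_of (layer_fd F hfd n)
    have hx : IsB (n + 1) (⟨bn (n + 1), bn_mem F (n + 1)⟩ : layer F (n + 1)) :=
      IsB.of_map (algebraMap (layer F (n + 1)) ℝ) (RingHom.injective _) (bn_isB (n + 1))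
    refine (tower_basic (K₀ := layer F n) hx (c := ⟨_, bn_sq_mem F n⟩) rfl
      (incl_ne (layer_le F n) hn _)).2.2 l hl hm (ih ?_ _)
    have hd : 2 ^ (n + 2) ∣ 2 ^ (n + 1 + 2) := pow_dvd_pow 2 (by omega)
    rw [← Nat.mod_mod_of_dvd l hd, hm, Nat.mod_eq_of_lt]
    exact Nat.one_lt_two_pow (by omega)

theorem layer_step (hF : IsTotallyReal F) [NumberField F] (n : ℕ) [NumberField (layer F (n + 1))]
    [NumberField (layer F (n + 2))] (hU : U2 (layer F (n + 1)))
    (hs : letI := incl (le_layer F (n + 2));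
      ∀ c ∈ A2 (ClassGroup (𝓞 F)), ∃ x ∈ A2 (ClassGroup (𝓞 (layer F (n + 2)))), rC F (layer F (n + 2)) x = c)
    (hcard : Nat.card (A2 (ClassGroup (𝓞 (layer F (n + 1))))) = Nat.card (A2 (ClassGroup (𝓞 F)))) :
    U2 (layer F (n + 2)) ∧ Nat.card (A2 (ClassGroup (𝓞 (layer F (n + 2))))) = Nat.card (A2 (ClassGroup (𝓞 F))) := by
  haveI := nf_of (layer_fd F hfd n)
  letI := incl (le_layer F n)
  letI := incl (layer_le F n)
  letI := incl (layer_le F (n + 1))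
  letI := incl ((layer_le F n).trans (layer_le F (n + 1)))
  letI := incl (le_layer F (n + 2))
  haveI := incl_tower (le_layer F n) ((layer_le F n).trans (layer_le F (n + 1)))
  haveI := incl_tower (layer_le F n) (layer_le F (n + 1))
  have hn := bn_not_mem hfd h2 n
  have hn1 := bn_not_mem hfd h2 (n + 1)
  haveI := quad_of (layer_le F n) (layer_succ F n) (bn_sq_mem F n) hn
  haveI := quad_of (layer_le F (n + 1)) (layer_succ F (n + 1)) (bn_sq_mem F (n + 1)) hn1
  have hy : IsB (n + 2) (⟨bn (n + 2), bn_mem F (n + 2)⟩ : layer F (n + 2)) :=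
    IsB.of_map (algebraMap (layer F (n + 2)) ℝ) (RingHom.injective _) (bn_isB (n + 2))
  refine tower_step (F := F) (K₀ := layer F n) (K₁ := layer F (n + 1)) (x := ⟨bn (n + 1), bn_mem F (n + 1)⟩)
    (c := ⟨_, bn_sq_mem F n⟩) hy ?_ rfl ?_ ?_ (layer_tr hfd h2 hF _) (layer_tr hfd h2 hF _) hU hs hcard
  · exact Subtype.ext (bn_succ (n + 1)).symm
  · exact incl_ne (layer_le F n) hn _
  · exact incl_ne (layer_le F (n + 1)) hn1 _

end lay
end S4

namespace S4
open nonZeroDivisors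

section fin

theorem nonsq {c q r s : ℕ} [hq : Fact q.Prime] [hr : Fact r.Prime] [hs : Fact s.Prime]
    (hc : c ∣ 4) (hq4 : q % 4 = 3) (hr8 : r % 8 = 5) (hs8 : s % 8 = 5) : ¬ IsSquare (c * q * r * s) := by
  rintro ⟨x, hx⟩
  have h1 : q ∣ x * x := ⟨c * r * s, by rw [← hx]; ring⟩
  have h2 : q ∣ x := by
    rcases hq.out.dvd_mul.1 h1 with h | h <;> exact h
  obtain ⟨y, rfl⟩ := h2
  have h3 : c * r * s = q * (y * y) := by
    apply Nat.eq_of_mul_eq_mul_left hq.out.pos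
    calc q * (c * r * s) = c * q * r * s := by ring
      _ = _ := by rw [hx]; ring
  have h4 : q ∣ c * r * s := ⟨_, h3⟩
  rcases hq.out.dvd_mul.1 h4 with h | h
  · rcases hq.out.dvd_mul.1 h with h | h
    · have h5 : q ∣ 2 ^ 2 := h.trans hc
      have h6 := (Nat.prime_dvd_prime_iff_eq hq.out Nat.prime_two).1 (hq.out.dvd_of_dvd_pow h5)
      omega
    · have := (Nat.prime_dvd_prime_iff_eq hq.out hr.out).1 h
      omega
  · have := (Nat.prime_dvd_prime_iff_eq hq.out hs.out).1 h
    omega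

theorem sq_sqrt_nat (d : ℕ) : (√(d : ℝ)) ^ 2 = d := Real.sq_sqrt (Nat.cast_nonneg d)

/-- The integral element given by a square root. -/
theorem exists_theta {E : IntermediateField ℚ ℝ} [NumberField E] {d : ℕ} (h : √(d : ℝ) ∈ E) :
    ∃ θ : 𝓞 E, θ ^ 2 = ((d : ℕ) : 𝓞 E) ∧ ((θ : E) : ℝ) = √(d : ℝ) := by
  have hsq : (⟨√(d : ℝ), h⟩ : E) ^ 2 = d := Subtype.ext (by simp [sq_sqrt_nat])
  have hintg : IsIntegral ℤ (⟨√(d : ℝ), h⟩ : E) := by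
    refine IsIntegral.of_pow (n := 2) (by norm_num) ?_
    rw [hsq]; exact isIntegral_natCast d
  obtain ⟨θ, h1⟩ : ∃ θ : 𝓞 E, algebraMap (𝓞 E) E θ = ⟨√(d : ℝ), h⟩ := ⟨⟨_, hintg⟩, rfl⟩
  refine ⟨θ, ?_, congrArg Subtype.val h1⟩
  apply RingOfIntegers.coe_injective
  rw [map_pow, map_natCast, h1]
  exact hsq

theorem fd_adj (d : ℕ) : FiniteDimensional ℚ (adjoin ℚ {√(d : ℝ)} : IntermediateField ℚ ℝ) := by
  apply adjoin.finiteDimensional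
  refine IsIntegral.of_pow (n := 2) (by norm_num) ?_
  rw [sq_sqrt_nat]; exact isIntegral_natCast d

theorem sqrt_not_mem {a d : ℕ} (ha : ¬ IsSquare a) (hd : ¬ IsSquare d) (had : ¬ IsSquare (a * d)) :
    √(a : ℝ) ∉ (adjoin ℚ {√(d : ℝ)} : IntermediateField ℚ ℝ) := by
  intro hm
  haveI := nf_of (fd_adj d)
  haveI := rat_quad (E := adjoin ℚ {√(d : ℝ)}) rfl (sq_sqrt_nat d) (irrational_sqrt_natCast_iff.2 hd)
  obtain ⟨σ, hσ⟩ := exists_sigma ℚ (adjoin ℚ {√(d : ℝ)} : IntermediateField ℚ ℝ)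
  have key : ∀ (e : ℕ) (he : ¬ IsSquare e) (h : √(e : ℝ) ∈ (adjoin ℚ {√(d : ℝ)} : IntermediateField ℚ ℝ)),
      σ ⟨_, h⟩ = - ⟨_, h⟩ := by
    intro e he h
    refine sigma_neg σ hσ (c := (e : ℚ)) ?_ ?_
    · rw [map_natCast]; exact Subtype.ext (by simp [sq_sqrt_nat])
    · intro y hy
      refine irrational_sqrt_natCast_iff.2 he ⟨y, ?_⟩
      have := congrArg Subtype.val hy
      rw [eq_ratCast] at this
      simpa using this
  have h1 := key a ha hm
  have h2 := key d hd (mem_adjoin_simple_self ℚ _)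
  have hd0 : (⟨_, mem_adjoin_simple_self ℚ (√(d : ℝ))⟩ : (adjoin ℚ {√(d : ℝ)} : IntermediateField ℚ ℝ)) ≠ 0 := by
    intro h
    have h3 : √(d : ℝ) = 0 := congrArg Subtype.val h
    have h4 := sq_sqrt_nat d
    rw [h3] at h4
    apply hd
    have : d = 0 := by exact_mod_cast (by simpa using h4.symm : (d : ℝ) = 0)
    rw [this]; exact ⟨0, rfl⟩
  obtain ⟨y, x, hxy⟩ := field_repr σ hσ h2 hd0 ⟨_, hm⟩
  have h5 := h1
  rw [hxy, map_add, map_mul, AlgEquiv.commutes, AlgEquiv.commutes, h2, eq_ratCast, eq_ratCast] at h5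
  have h6 : y * (-√(d : ℝ)) + (x : ℝ) = - (y * √(d : ℝ) + x) := by
    have := congrArg Subtype.val h5
    simpa using this
  have h7 : √(a : ℝ) = y * √(d : ℝ) + x := by
    have := congrArg Subtype.val hxy
    rw [eq_ratCast, eq_ratCast] at this
    simpa using this
  have hx : (x : ℝ) = 0 := by linarith
  refine irrational_sqrt_natCast_iff.2 had ⟨y * d, ?_⟩
  rw [Nat.cast_mul, Real.sqrt_mul (Nat.cast_nonneg a), h7, hx, add_zero, mul_assoc, ← pow_two, sq_sqrt_nat]
  push_cast; rfl

theorem final_card {G : Type} [CommGroup G] [Finite G] (S : Subgroup G) (hS : ∀ c, c ∈ S ↔ c ^ 2 = 1)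
    (h4 : Nat.card S = 4) (h8 : Nat.card (A2 G) = 8) :
    Nonempty (A2 G ≃* Multiplicative (ZMod 2 × ZMod 4)) := by
  refine equiv_of_card_eight h8 ?_
  rw [← h4]
  refine Nat.card_congr ⟨fun x => ⟨x.1.1, (hS _).2 (congrArg Subtype.val x.2)⟩,
    fun x => ⟨⟨x.1, 1, by simpa using (hS _).1 x.2⟩, Subtype.ext ((hS _).1 x.2)⟩, fun _ => rfl, fun _ => rfl⟩

end fin
end S4

namespace S4
open nonZeroDivisors

section main

/-- Everything about the first layer. -/
theorem main_first {η η' q r s : ℕ} [hq : Fact q.Prime] [hr : Fact r.Prime] [hs : Fact s.Prime]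
    (hη : η = 1 ∨ η = 2) (hη' : η' = 1 ∨ η' = 2) (hηη : η * η' = 2)
    (hq4 : q % 4 = 3) (hr8 : r % 8 = 5) (hs8 : s % 8 = 5) (hrs : legendreSym s r = 1)
    (h1 : legendreSym r (η * q : ℕ) = 1) (h2 : legendreSym s (η * q : ℕ) = 1)
    (h3 : legendreSym r (η' * q : ℕ) = -1) (h4 : legendreSym s (η' * q : ℕ) = -1)
    {F : IntermediateField ℚ ℝ} (hF : F = adjoin ℚ {√((η * q * r * s : ℕ) : ℝ)})
    [NumberField F] [NumberField (layer F 1)] [Algebra.IsQuadraticExtension ℚ F]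
    {θ : 𝓞 F} (hθ : θ ^ 2 = ((η * q * r * s : ℕ) : 𝓞 F)) (hθ1 : ((θ : F) : ℝ) = √((η * q * r * s : ℕ) : ℝ))
    (σ₀ : F ≃ₐ[ℚ] F) (hσ₀ : σ₀ ≠ 1)
    (hnp : ∀ a u : 𝓞 F, IsUnit u → a ^ 2 = (η * q : ℕ) * u → False)
    (h8 : Nat.card (A2 (ClassGroup (𝓞 F))) = 8) :
    IsTotallyReal F ∧ Nat.card (fixS (sC σ₀)) = 4 ∧ U2 (layer F 1) ∧
      Nat.card (A2 (ClassGroup (𝓞 (layer F 1)))) ≤ 8 := by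
  have h2sq : ¬ IsSquare (2 : ℕ) := Nat.prime_two.prime.not_isSquare
  have nD : ¬ IsSquare (η * q * r * s) := nonsq (by rcases hη with rfl | rfl <;> norm_num) hq4 hr8 hs8
  have nD' : ¬ IsSquare (η' * q * r * s) := nonsq (by rcases hη' with rfl | rfl <;> norm_num) hq4 hr8 hs8
  have n2D : ¬ IsSquare (2 * (η * q * r * s)) := by
    have : ¬ IsSquare ((2 * η) * q * r * s) := nonsq (by rcases hη with rfl | rfl <;> norm_num) hq4 hr8 hs8
    rwa [mul_assoc 2, mul_assoc 2, mul_assoc 2] at this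
  have n2D' : ¬ IsSquare (2 * (η' * q * r * s)) := by
    have : ¬ IsSquare ((2 * η') * q * r * s) := nonsq (by rcases hη' with rfl | rfl <;> norm_num) hq4 hr8 hs8
    rwa [mul_assoc 2, mul_assoc 2, mul_assoc 2] at this
  set D := η * q * r * s with hD
  set D' := η' * q * r * s with hD'
  have hrel : √(D : ℝ) * √(D' : ℝ) = √((2 : ℕ) : ℝ) * ((q * r * s : ℕ) : ℝ) := by
    rw [← Real.sqrt_mul (Nat.cast_nonneg _)]
    have : (D : ℝ) * D' = ((2 : ℕ) : ℝ) * ((q * r * s : ℕ) : ℝ) ^ 2 := by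
      have : D * D' = 2 * (q * r * s) ^ 2 := by
        calc D * D' = (η * η') * (q * r * s) ^ 2 := by rw [hD, hD']; ring
          _ = _ := by rw [hηη]
      exact_mod_cast this
    rw [this, Real.sqrt_mul (Nat.cast_nonneg _), Real.sqrt_sq (Nat.cast_nonneg _)]
  have hb1 : bn 1 = √((2 : ℕ) : ℝ) := by rw [bn_one]; norm_num
  have hm0 : ((q * r * s : ℕ) : ℝ) ≠ 0 := by
    exact_mod_cast mul_ne_zero (mul_ne_zero hq.out.ne_zero hr.out.ne_zero) hs.out.ne_zero
  have hL : layer F 1 = F ⊔ adjoin ℚ {√((2 : ℕ) : ℝ)} := by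
    rw [← hb1]; rfl
  have hLk : layer F 1 = adjoin ℚ {√((2 : ℕ) : ℝ)} ⊔ adjoin ℚ {√(D : ℝ)} := by
    rw [hL, hF, sup_comm]
  have s20 : √((2 : ℕ) : ℝ) ≠ 0 := by
    rw [Real.sqrt_ne_zero']; norm_num
  have sD0 : √(D : ℝ) ≠ 0 := fun h => mul_ne_zero s20 hm0 (by rw [← hrel, h, zero_mul])
  have sD0' : √(D' : ℝ) ≠ 0 := fun h => mul_ne_zero s20 hm0 (by rw [← hrel, h, mul_zero])
  have hLF' : layer F 1 = adjoin ℚ {√(D' : ℝ)} ⊔ adjoin ℚ {√((2 : ℕ) : ℝ)} := by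
    rw [hL, hF]
    apply le_antisymm
    · refine sup_le ?_ le_sup_right
      rw [adjoin_simple_le_iff]
      have : √(D : ℝ) = √((2 : ℕ) : ℝ) * ((q * r * s : ℕ) : ℝ) / √(D' : ℝ) := by
        rw [← hrel, mul_div_cancel_right₀ _ sD0']
      rw [this]
      refine div_mem (mul_mem ?_ (_root_.natCast_mem _ _)) ?_
      · exact (le_sup_right : adjoin ℚ {√((2 : ℕ) : ℝ)} ≤ _) (mem_adjoin_simple_self ℚ _)
      · exact (le_sup_left : adjoin ℚ {√(D' : ℝ)} ≤ _) (mem_adjoin_simple_self ℚ _)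
    · refine sup_le ?_ le_sup_right
      rw [adjoin_simple_le_iff]
      have : √(D' : ℝ) = √((2 : ℕ) : ℝ) * ((q * r * s : ℕ) : ℝ) / √(D : ℝ) := by
        rw [← hrel, mul_div_cancel_left₀ _ sD0]
      rw [this]
      refine div_mem (mul_mem ?_ (_root_.natCast_mem _ _)) ?_
      · exact (le_sup_right : adjoin ℚ {√((2 : ℕ) : ℝ)} ≤ _) (mem_adjoin_simple_self ℚ _)
      · exact (le_sup_left : adjoin ℚ {√(D : ℝ)} ≤ _) (mem_adjoin_simple_self ℚ _)
  have m2F : √((2 : ℕ) : ℝ) ∉ F := by rw [hF]; exact sqrt_not_mem h2sq nD n2D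
  have m2F' : √((2 : ℕ) : ℝ) ∉ adjoin ℚ {√(D' : ℝ)} := sqrt_not_mem h2sq nD' n2D'
  have mDk : √(D : ℝ) ∉ adjoin ℚ {√((2 : ℕ) : ℝ)} := sqrt_not_mem nD h2sq (by rwa [mul_comm])
  have leF : F ≤ layer F 1 := le_layer F 1
  have leF' : adjoin ℚ {√(D' : ℝ)} ≤ layer F 1 := by rw [hLF']; exact le_sup_left
  have lek : adjoin ℚ {√((2 : ℕ) : ℝ)} ≤ layer F 1 := by rw [hLk]; exact le_sup_left
  generalize hF'e : adjoin ℚ {√(D' : ℝ)} = F' at *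
  generalize hke : adjoin ℚ {√((2 : ℕ) : ℝ)} = k at *
  generalize layer F 1 = L at *
  haveI : NumberField F' := by rw [← hF'e]; exact nf_of (fd_adj _)
  haveI : NumberField k := by rw [← hke]; exact nf_of (fd_adj _)
  haveI : Algebra.IsQuadraticExtension ℚ F' :=
    rat_quad hF'e.symm (sq_sqrt_nat D') (irrational_sqrt_natCast_iff.2 nD')
  haveI : Algebra.IsQuadraticExtension ℚ k :=
    rat_quad hke.symm (sq_sqrt_nat 2) (irrational_sqrt_natCast_iff.2 h2sq)
  letI := incl leF
  letI := incl leF'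
  letI := incl lek
  haveI : Algebra.IsQuadraticExtension F L :=
    quad_of leF (b := √((2 : ℕ) : ℝ)) (by rw [hke, hL]) (by rw [sq_sqrt_nat]; exact _root_.natCast_mem _ _) m2F
  haveI : Algebra.IsQuadraticExtension F' L :=
    quad_of leF' (b := √((2 : ℕ) : ℝ)) (by rw [hke, hLF']) (by rw [sq_sqrt_nat]; exact _root_.natCast_mem _ _) m2F'
  haveI : Algebra.IsQuadraticExtension k L :=
    quad_of lek (b := √(D : ℝ)) hLk (by rw [sq_sqrt_nat]; exact _root_.natCast_mem _ _) mDk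
  obtain ⟨θ', hθ', hθ'1⟩ := exists_theta (E := F') (d := D') (by rw [← hF'e]; exact mem_adjoin_simple_self ℚ _)
  obtain ⟨t, ht, ht1⟩ := exists_theta (E := k) (d := 2) (by rw [← hke]; exact mem_adjoin_simple_self ℚ _)
  have cF : ∀ x : F, ((algebraMap F L x : L) : ℝ) = x := fun _ => rfl
  have cF' : ∀ x : F', ((algebraMap F' L x : L) : ℝ) = x := fun _ => rfl
  have ck : ∀ x : k, ((algebraMap k L x : L) : ℝ) = x := fun _ => rfl
  have res := F1_main (F := F) (F' := F') (k := k) (L := L) hη hη' hq4 hr8 hs8 hrs h1 h2 h3 h4 hθ hθ' ht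
    ?_ ?_ ?_ ?_ σ₀ hσ₀ hnp h8
  · exact ⟨res.1, res.2.1, res.2.2.1, res.2.2.2.2⟩
  · apply Subtype.ext
    rw [MulMemClass.coe_mul, MulMemClass.coe_mul, cF, cF', ck, hθ1, hθ'1, ht1, hrel]
    simp
  · intro y hy
    have := congrArg Subtype.val hy
    rw [cF, ck, ht1] at this
    exact m2F (this ▸ y.2)
  · intro y hy
    have := congrArg Subtype.val hy
    rw [cF', ck, ht1] at this
    exact m2F' (this ▸ y.2)
  · intro y hy
    have := congrArg Subtype.val hy
    rw [cF, ck, hθ1] at this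
    exact mDk (this ▸ y.2)

end main
end S4

namespace S4
open nonZeroDivisors

section last

theorem coprime_of_lt {l D : ℕ} (hl : l.Prime) (h2 : l ≠ 2) (hD : D < l) (h0 : 0 < D) : Nat.Coprime l (2 * D) := by
  rw [hl.coprime_iff_not_dvd]
  intro h
  rcases hl.dvd_mul.1 h with h | h
  · exact h2 ((Nat.prime_dvd_prime_iff_eq hl Nat.prime_two).1 h)
  · exact absurd (Nat.le_of_dvd h0 h) (by omega)

theorem main_all {η η' q r s : ℕ} [hq : Fact q.Prime] [hr : Fact r.Prime] [hs : Fact s.Prime]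
    (hη : η = 1 ∨ η = 2) (hη' : η' = 1 ∨ η' = 2) (hηη : η * η' = 2)
    (hq4 : q % 4 = 3) (hr8 : r % 8 = 5) (hs8 : s % 8 = 5) (hrs : legendreSym s r = 1)
    (h1 : legendreSym r (η * q : ℕ) = 1) (h2 : legendreSym s (η * q : ℕ) = 1)
    (h3 : legendreSym r (η' * q : ℕ) = -1) (h4 : legendreSym s (η' * q : ℕ) = -1)
    (hqrs : legendreSym r q * legendreSym s q = 1)
    (γ γ' : ℤ) (hγ : 0 < γ) (hγ' : 0 < γ')
    (hPell : γ ^ 2 - (η * q * r * s : ℕ) * γ' ^ 2 = 1)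
    (hfund : ∀ a b : ℤ, 0 < a → 0 < b → a ^ 2 - (η * q * r * s : ℕ) * b ^ 2 = 1 → γ ≤ a)
    (hnsq : ¬ ∃ t : ℤ, 2 ^ (if η = 1 then 1 else 0) * (q : ℤ) * (γ - 1) = t ^ 2)
    {F : IntermediateField ℚ ℝ} (hF : F = adjoin ℚ {√((η * q * r * s : ℕ) : ℝ)})
    (h8 : _root_.h2 F = 8) (n : ℕ) :
    Nonempty (A2 (ClassGroup (𝓞 (layer F n))) ≃* Multiplicative (ZMod 2 × ZMod 4)) := by
  have nD : ¬ IsSquare (η * q * r * s) := nonsq (by rcases hη with rfl | rfl <;> norm_num) hq4 hr8 hs8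
  have n2D : ¬ IsSquare (2 * (η * q * r * s)) := by
    have : ¬ IsSquare ((2 * η) * q * r * s) := nonsq (by rcases hη with rfl | rfl <;> norm_num) hq4 hr8 hs8
    rwa [mul_assoc 2, mul_assoc 2, mul_assoc 2] at this
  have m2F : √2 ∉ F := by
    have := sqrt_not_mem Nat.prime_two.prime.not_isSquare nD n2D
    rw [hF]; simpa using this
  have hfd : FiniteDimensional ℚ F := by rw [hF]; exact fd_adj _
  haveI : NumberField F := nf_of hfd
  have hnf : ∀ n, NumberField (layer F n) := fun n => nf_of (layer_fd F hfd n)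
  haveI : Algebra.IsQuadraticExtension ℚ F :=
    rat_quad hF (sq_sqrt_nat _) (irrational_sqrt_natCast_iff.2 nD)
  obtain ⟨θ, hθ, hθ1⟩ := exists_theta (E := F) (d := η * q * r * s) (by rw [hF]; exact mem_adjoin_simple_self ℚ _)
  obtain ⟨σ₀, hσ₀⟩ := exists_sigma ℚ F
  have hsf := D_sqf hη hq4 hr8 hs8 hrs
  have hD := D_mod hη hq4 hr8 hs8
  have hnp := pell_np hη hq4 hr8 hs8 hqrs hγ hγ' hPell hfund hnsq σ₀ hσ₀ hθ hsf hD
  have h8' : Nat.card (A2 (ClassGroup (𝓞 F))) = 8 := by rw [card_A2]; exact h8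
  obtain ⟨hTR, hc4, hU1, hle⟩ := main_first hη hη' hηη hq4 hr8 hs8 hrs h1 h2 h3 h4 hF hθ hθ1 σ₀ hσ₀ hnp h8'
  have hfin : Nonempty (A2 (ClassGroup (𝓞 F)) ≃* Multiplicative (ZMod 2 × ZMod 4)) :=
    final_card (fixS (sC σ₀)) (mem_fix_iff σ₀ hσ₀) hc4 h8'
  have hsurj : ∀ n, letI := incl (le_layer F n);
      ∀ c ∈ A2 (ClassGroup (𝓞 F)), ∃ x ∈ A2 (ClassGroup (𝓞 (layer F n))), rC F (layer F n) x = c := by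
    intro n
    letI := incl (le_layer F n)
    refine norm_surj hη hq4 hr8 hs8 hrs σ₀ hσ₀ hθ hc4 h8' (L := layer F n) n ?_
    intro l hl hm hlt hleg
    haveI : Fact l.Prime := ⟨hl⟩
    have hl2 : l ≠ 2 := by
      rintro rfl
      have : 2 < 2 ^ (n + 3) := by
        calc 2 < 2 ^ 3 := by norm_num
          _ ≤ 2 ^ (n + 3) := Nat.pow_le_pow_right (by norm_num) (by omega)
      rw [Nat.mod_eq_of_lt this] at hm
      omega
    have hbase : Good l F := good_base σ₀ hσ₀ hθ (sI_theta σ₀ hσ₀ hθ hD)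
      (coprime_of_lt hl hl2 hlt (Nat.pos_of_ne_zero hsf.ne_zero)) (hleg inferInstance)
    refine layer_good hfd m2F l hl hbase n ?_ _
    have hd : 2 ^ (n + 2) ∣ 2 ^ (n + 3) := pow_dvd_pow 2 (by omega)
    rw [← Nat.mod_mod_of_dvd l hd, hm, Nat.mod_eq_of_lt]
    exact Nat.one_lt_two_pow (by omega)
  have hind : ∀ n, U2 (layer F (n + 1)) ∧
      Nat.card (A2 (ClassGroup (𝓞 (layer F (n + 1))))) = Nat.card (A2 (ClassGroup (𝓞 F))) := by
    intro n
    induction n with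
    | zero =>
      refine ⟨hU1, ?_⟩
      letI := incl (le_layer F 1)
      exact (A2_eq_of_surj (rC F (layer F 1)) (hsurj 1) (by rw [h8']; exact hle)).1
    | succ n ih => exact layer_step hfd m2F hTR n ih.1 (hsurj (n + 2)) ih.2
  obtain ⟨e⟩ := hfin
  cases n with
  | zero => rw [layer_zero]; exact ⟨e⟩
  | succ n =>
    letI := incl (le_layer F (n + 1))
    obtain ⟨f⟩ := (A2_eq_of_surj (rC F (layer F (n + 1))) (hsurj (n + 1)) (hind n).2.le).2
    exact ⟨f.trans e⟩

end last
end S4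

theorem statement_4 (η q r s : ℕ) [Fact q.Prime] [Fact r.Prime] [Fact s.Prime]
    (hη : η = 1 ∨ η = 2)
    (hq4 : q % 4 = 3) (hr8 : r % 8 = 5) (hs8 : s % 8 = 5)
    (hqr : legendreSym r q = (-1) ^ (if η = 2 then 1 else 0))
    (hqs : legendreSym s q = (-1) ^ (if η = 2 then 1 else 0))
    (hrs : legendreSym s r = 1)
    (hNegPell : ¬ ∃ x y : ℤ, x ^ 2 - (r * s : ℕ) * y ^ 2 = -1)
    (γ γ' : ℤ) (hγ : 0 < γ) (hγ' : 0 < γ')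
    (hPell : γ ^ 2 - (η * q * r * s : ℕ) * γ' ^ 2 = 1)
    (hfund : ∀ a b : ℤ, 0 < a → 0 < b → a ^ 2 - (η * q * r * s : ℕ) * b ^ 2 = 1 → γ ≤ a)
    (hnsq : ¬ ∃ t : ℤ, 2 ^ (if η = 1 then 1 else 0) * (q : ℤ) * (γ - 1) = t ^ 2)
    (h8 : h2 (IntermediateField.adjoin ℚ {Real.sqrt (η * q * r * s : ℕ)}) = 8) :
    ∀ n : ℕ,
      ∀ P : Sylow 2 (ClassGroup (NumberField.RingOfIntegers
        (layer (IntermediateField.adjoin ℚ {Real.sqrt (η * q * r * s : ℕ)}) n))),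
      Nonempty (P ≃* Multiplicative (ZMod 2 × ZMod 4)) := by
  intro n P
  have hkey : Nonempty (S4.A2 (ClassGroup (𝓞 (layer (adjoin ℚ {√((η * q * r * s : ℕ) : ℝ)}) n))) ≃*
      Multiplicative (ZMod 2 × ZMod 4)) := by
    have l2r := S4.leg_two hr8
    have l2s := S4.leg_two hs8
    rcases hη with rfl | rfl
    · rw [if_neg (by norm_num), pow_zero] at hqr hqs
      refine S4.main_all (η := 1) (η' := 2) (Or.inl rfl) (Or.inr rfl) (by norm_num) hq4 hr8 hs8 hrs ?_ ?_ ?_ ?_ ?_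
        γ γ' hγ hγ' hPell hfund hnsq rfl h8 n
      · rw [one_mul]; exact hqr
      · rw [one_mul]; exact hqs
      · push_cast; rw [legendreSym.mul, l2r, hqr]; norm_num
      · push_cast; rw [legendreSym.mul, l2s, hqs]; norm_num
      · rw [hqr, hqs]; norm_num
    · rw [if_pos rfl, pow_one] at hqr hqs
      refine S4.main_all (η := 2) (η' := 1) (Or.inr rfl) (Or.inl rfl) (by norm_num) hq4 hr8 hs8 hrs ?_ ?_ ?_ ?_ ?_
        γ γ' hγ hγ' hPell hfund hnsq rfl h8 n
      · push_cast; rw [legendreSym.mul, l2r, hqr]; norm_num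
      · push_cast; rw [legendreSym.mul, l2s, hqs]; norm_num
      · rw [one_mul]; exact hqr
      · rw [one_mul]; exact hqs
      · rw [hqr, hqs]; norm_num
  obtain ⟨e⟩ := hkey
  exact ⟨(MulEquiv.subgroupCongr (S4.sylow_eq_A2 P)).trans e⟩
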